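/- Let Ω ⊂ ℝ^N (N ≥ 2) be a smooth bounded domain, assume (S1), (P1), (μ1) and (F1)–(F2) hold, let q ∈ C₊(ℝ^N×ℝ^N) satisfy 2/q(x,y) + μ(x,y)/N = 2 for all (x,y), and let α ∈ C₊(Ω̄) with α⁺ < p⁻. Then there exists Λ > 0 such that for every λ ∈ (0,Λ) the problem (−Δ)_{p(·)}^{s(·)} u = λ|u|^{α(x)−2}u + (∫_Ω F(y,u(y))/|x−y|^{μ(x,y)} dy) f(x,u(x)) in Ω, u = 0 in ℝ^N∖Ω, admits at least two distinct nontrivial weak solutions, i.e., two distinct nonzero u ∈ X₀ such that for every w ∈ X₀: ∫_{ℝ^N×ℝ^N} |u(x)−u(y)|^{p(x,y)−2}(u(x)−u(y))(w(x)−w(y))/|x−y|^{N+s(x,y)p(x,y)} dx dy = λ∫_Ω |u(x)|^{α(x)−2}u(x)w(x) dx + (1/2)∫_Ω∫_Ω F(x,u(x)) f(y,u(y)) w(y)/|x−y|^{μ(x,y)} dx dy. -/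

import Mathlib

open MeasureTheory Set Filter ENNReal

noncomputable section

namespace VarOrderChoquard

variable {N : ℕ}

/-- `ℝ^N` with the Euclidean structure. -/
abbrev RN (N : ℕ) := EuclideanSpace ℝ (Fin N)

/-- `Φ⁻` : infimum of a two-variable real function over `ℝ^N × ℝ^N`. -/
def inf2 (f : RN N → RN N → ℝ) : ℝ := sInf {t | ∃ x y, f x y = t}

/-- `Φ⁺` : supremum of a two-variable real function over `ℝ^N × ℝ^N`. -/
def sup2 (f : RN N → RN N → ℝ) : ℝ := sSup {t | ∃ x y, f x y = t}

/-- `Φ⁻` over a subset `D ⊆ ℝ^N`. -/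
def infOn (D : Set (RN N)) (g : RN N → ℝ) : ℝ := sInf (g '' D)

/-- `Φ⁺` over a subset `D ⊆ ℝ^N`. -/
def supOn (D : Set (RN N)) (g : RN N → ℝ) : ℝ := sSup (g '' D)

/-- `C₊(ℝ^N × ℝ^N)` : continuous with `1 < Φ⁻ ≤ Φ⁺ < ∞`. -/
def CPlus2 (f : RN N → RN N → ℝ) : Prop :=
  Continuous (fun z : RN N × RN N => f z.1 z.2) ∧ 1 < inf2 f ∧
    BddAbove {t | ∃ x y, f x y = t}

/-- `C₊(D)` for `D ⊆ ℝ^N`. -/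
def CPlusOn (D : Set (RN N)) (g : RN N → ℝ) : Prop :=
  ContinuousOn g D ∧ 1 < infOn D g ∧ BddAbove (g '' D)

/-- Condition (S1). -/
def S1 (s : RN N → RN N → ℝ) : Prop :=
  Continuous (fun z : RN N × RN N => s z.1 z.2) ∧ (∀ x y, s x y = s y x) ∧
    BddAbove {t | ∃ x y, s x y = t} ∧ 0 < inf2 s ∧ sup2 s < 1

/-- Condition (P1). -/
def P1 (s p : RN N → RN N → ℝ) : Prop :=
  CPlus2 p ∧ (∀ x y, p x y = p y x) ∧ sup2 s * sup2 p < N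

/-- Condition (μ1). -/
def Mu1 (μ : RN N → RN N → ℝ) : Prop :=
  (∀ x y, μ x y = μ y x) ∧ BddAbove {t | ∃ x y, μ x y = t} ∧
    0 < inf2 μ ∧ sup2 μ < N

/-- The critical exponent `p_s*(x) = N p(x,x) / (N - s(x,x) p(x,x))`. -/
def pstar (s p : RN N → RN N → ℝ) (x : RN N) : ℝ :=
  N * p x x / (N - s x x * p x x)

/-- The class `𝓜` : `p(x,x) ≤ r(x)q⁻ ≤ r(x)q⁺ < p_s*(x)` for all `x`. -/
def MemM (s p q : RN N → RN N → ℝ) (r : RN N → ℝ) : Prop :=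
  ∀ x, p x x ≤ r x * inf2 q ∧ r x * inf2 q ≤ r x * sup2 q ∧
    r x * sup2 q < pstar s p x

/-- Variable-exponent modular `∫_U |u/l|^{γ(x)} dx`. -/
def lmodular (U : Set (RN N)) (γ : RN N → ℝ) (u : RN N → ℝ) (l : ℝ) : ℝ≥0∞ :=
  ∫⁻ x in U, ENNReal.ofReal (|u x| / l) ^ γ x

/-- Membership in the variable-exponent Lebesgue space `L^{γ(x)}(U)`. -/
def MemVarLp (U : Set (RN N)) (γ : RN N → ℝ) (u : RN N → ℝ) : Prop :=
  Measurable u ∧ ∃ l, 0 < l ∧ lmodular U γ u l < ⊤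

/-- Luxemburg norm on `L^{γ(x)}(U)`. -/
def luxNorm (U : Set (RN N)) (γ : RN N → ℝ) (u : RN N → ℝ) : ℝ :=
  sInf {l | 0 < l ∧ lmodular U γ u l ≤ 1}

/-- Membership in the classical Lebesgue space `L^t(U)` (constant exponent `t`). -/
def MemCLp (U : Set (RN N)) (t : ℝ) (g : RN N → ℝ) : Prop :=
  Measurable g ∧ (∫⁻ x in U, ENNReal.ofReal |g x| ^ t) < ⊤

/-- The classical `L^t(U)`-norm. -/
def cLpNorm (U : Set (RN N)) (t : ℝ) (g : RN N → ℝ) : ℝ :=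
  (∫⁻ x in U, ENNReal.ofReal |g x| ^ t).toReal ^ (1 / t)

/-- Gagliardo-type modular
`∫_A (|u(x)-u(y)|/l)^{p(x,y)} / |x-y|^{N+s(x,y)p(x,y)} dx dy`. -/
def gmodular (A : Set (RN N × RN N)) (s p : RN N → RN N → ℝ) (u : RN N → ℝ)
    (l : ℝ) : ℝ≥0∞ :=
  ∫⁻ z in A, ENNReal.ofReal (|u z.1 - u z.2| / l) ^ p z.1 z.2 /
    ENNReal.ofReal (dist z.1 z.2) ^ ((N : ℝ) + s z.1 z.2 * p z.1 z.2)

/-- Membership in `W^{s(x,y),β(x),p(x,y)}(U)`. -/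
def MemW (U : Set (RN N)) (s p : RN N → RN N → ℝ) (β : RN N → ℝ)
    (u : RN N → ℝ) : Prop :=
  MemVarLp U β u ∧ ∃ l, 0 < l ∧ gmodular (U ×ˢ U) s p u l < ⊤

/-- The Gagliardo seminorm `[u]_U^{s,p}`. -/
def wSeminorm (U : Set (RN N)) (s p : RN N → RN N → ℝ) (u : RN N → ℝ) : ℝ :=
  sInf {l | 0 < l ∧ gmodular (U ×ˢ U) s p u l < 1}

/-- The norm on `W`. -/
def wNorm (U : Set (RN N)) (s p : RN N → RN N → ℝ) (β : RN N → ℝ)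
    (u : RN N → ℝ) : ℝ :=
  luxNorm U β u + wSeminorm U s p u

/-- `Q = (ℝ^N × ℝ^N) \ (Ωᶜ × Ωᶜ)`. -/
def Qset (Ω : Set (RN N)) : Set (RN N × RN N) := univ \ (Ωᶜ ×ˢ Ωᶜ)

/-- Membership in `X₀`. -/
def MemX0 (Ω : Set (RN N)) (s p : RN N → RN N → ℝ) (β : RN N → ℝ)
    (u : RN N → ℝ) : Prop :=
  Measurable u ∧ MemVarLp Ω β u ∧ (∃ l, 0 < l ∧ gmodular (Qset Ω) s p u l < ⊤) ∧
    (∀ᵐ x, x ∉ Ω → u x = 0)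

/-- The `X₀`-norm. -/
def x0Norm (s p : RN N → RN N → ℝ) (u : RN N → ℝ) : ℝ :=
  sInf {l | 0 < l ∧ gmodular univ s p u l < 1}

/-- The modular `ρ_{X₀}`. -/
def rhoX0 (s p : RN N → RN N → ℝ) (u : RN N → ℝ) : ℝ≥0∞ :=
  gmodular univ s p u 1

/-- Carathéodory function. -/
def Caratheodory (f : RN N → ℝ → ℝ) : Prop :=
  (∀ t, Measurable fun x => f x t) ∧ ∀ x, Continuous fun t => f x t

/-- `F(x,t) = ∫₀ᵗ f(x,τ) dτ`. -/
def Fant (f : RN N → ℝ → ℝ) (x : RN N) (t : ℝ) : ℝ := ∫ τ in (0:ℝ)..t, f x τ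

/-- Growth condition (F1) (with data `M` and `r`). -/
def F1 (Ω : Set (RN N)) (f : RN N → ℝ → ℝ) (M : ℝ) (r : RN N → ℝ) : Prop :=
  0 < M ∧ ∀ x ∈ Ω, ∀ t : ℝ, |f x t| ≤ M * |t| ^ (r x - 1)

/-- Ambrosetti–Rabinowitz type condition (F2) (with data `Θ`). -/
def F2 (Ω : Set (RN N)) (f : RN N → ℝ → ℝ) (Θ : ℝ) : Prop :=
  ∀ᵐ x, x ∈ Ω → ∀ t : ℝ, t ≠ 0 →
    0 < Θ * Fant f x t ∧ Θ * Fant f x t ≤ 2 * (t * f x t)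

/-- The left-hand side pairing
`∫∫ |u(x)-u(y)|^{p-2}(u(x)-u(y))(w(x)-w(y)) / |x-y|^{N+sp} dx dy`. -/
def energyLHS (s p : RN N → RN N → ℝ) (u w : RN N → ℝ) : ℝ :=
  ∫ z : RN N × RN N,
    |u z.1 - u z.2| ^ (p z.1 z.2 - 2) * (u z.1 - u z.2) * (w z.1 - w z.2) /
      dist z.1 z.2 ^ ((N : ℝ) + s z.1 z.2 * p z.1 z.2)

/-- The Choquard right-hand side `∫_Ω ∫_Ω F(x,u(x)) f(y,u(y)) w(y) / |x-y|^μ`. -/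
def choquardRHS (Ω : Set (RN N)) (μ : RN N → RN N → ℝ) (f : RN N → ℝ → ℝ)
    (u w : RN N → ℝ) : ℝ :=
  ∫ x in Ω, ∫ y in Ω, Fant f x (u x) * f y (u y) * w y / dist x y ^ μ x y

/-- The energy functional `J`. -/
def Jfun (Ω : Set (RN N)) (s p μ : RN N → RN N → ℝ) (f : RN N → ℝ → ℝ)
    (u : RN N → ℝ) : ℝ :=
  (∫ z : RN N × RN N,
    |u z.1 - u z.2| ^ p z.1 z.2 /
      (p z.1 z.2 * dist z.1 z.2 ^ ((N : ℝ) + s z.1 z.2 * p z.1 z.2)))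
  - (1/2) * ∫ x in Ω, ∫ y in Ω,
      Fant f x (u x) * Fant f y (u y) / dist x y ^ μ x y

/-- `⟨J'(u), w⟩`. -/
def Jderiv (Ω : Set (RN N)) (s p μ : RN N → RN N → ℝ) (f : RN N → ℝ → ℝ)
    (u w : RN N → ℝ) : ℝ :=
  energyLHS s p u w - choquardRHS Ω μ f u w

/-- The perturbed functional `J_λ`. -/
def Jlam (Ω : Set (RN N)) (s p μ : RN N → RN N → ℝ) (f : RN N → ℝ → ℝ)
    (α : RN N → ℝ) (lam : ℝ) (u : RN N → ℝ) : ℝ :=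
  Jfun Ω s p μ f u - lam * ∫ x in Ω, |u x| ^ α x / α x


section Proof

open scoped Topology

/-- A finite-dimensional mountain pass theorem for functionals with compact superlevel sets: a
separating level set `{g = R}` on which `J ≥ c` forces a critical point with value in `[a, C]`. -/
theorem exists_critical_of_mountain {E : Type*} [NormedAddCommGroup E] [InnerProductSpace ℝ E]
    [FiniteDimensional ℝ E] {J g : E → ℝ} {G : E → E} (hJ : Continuous J) (hg : Continuous g)
    (hG : Continuous G)
    (hd : ∀ v w, HasDerivAt (fun t : ℝ => J (v + t • w)) (inner ℝ (G v) w) 0)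
    {a c C R : ℝ} {e : E} (hac : a < c) (hK : IsCompact {v | a ≤ J v}) (h0 : J 0 ≤ a)
    (he : J e ≤ a) (hg0 : g 0 < R) (hge : R < g e) (hsep : ∀ v, g v = R → c ≤ J v)
    (hseg : ∀ t ∈ Icc (0 : ℝ) 1, J (t • e) ≤ C) :
    ∃ v, G v = 0 ∧ a ≤ J v ∧ J v ≤ C := by
  by_contra! hcon
  have hK' : IsCompact {v | a ≤ J v ∧ J v ≤ C} :=
    hK.inter_right (isClosed_le hJ continuous_const)
  obtain ⟨δ, hδ, hGδ⟩ : ∃ δ, 0 < δ ∧ ∀ v, a ≤ J v → J v ≤ C → δ ≤ ‖G v‖ := by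
    obtain ⟨δ, h1, h2⟩ := hK'.exists_forall_le' (f := fun v => ‖G v‖) hG.norm.continuousOn
      (a := 0) (fun v hv => norm_pos_iff.2 fun h => (hcon v h hv.1).not_ge hv.2)
    exact ⟨δ, h1, fun v h3 h4 => h2 v ⟨h3, h4⟩⟩
  obtain ⟨D, hD⟩ := hK'.exists_bound_of_continuousOn hG.continuousOn
  obtain ⟨r, hr⟩ := hK'.isBounded.subset_closedBall (0 : E)
  have huc := (isCompact_closedBall (0 : E) (r + 1)).uniformContinuousOn_of_continuous
    hG.continuousOn
  rw [Metric.uniformContinuousOn_iff] at huc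
  obtain ⟨η, hη, huc⟩ := huc (δ / 2) (by positivity)
  set D' := max D 0 + 1 with hD'
  have hD'pos : 0 < D' := by positivity
  set τ := min 1 (η / 2) / D' with hτ
  have hτpos : 0 < τ := by positivity
  have hτ1 : τ * D' ≤ 1 := by rw [hτ, div_mul_cancel₀ _ hD'pos.ne']; exact min_le_left _ _
  have hτ2 : τ * D' < η := by
    rw [hτ, div_mul_cancel₀ _ hD'pos.ne']
    exact (min_le_right _ _).trans_lt (by linarith)
  have hline : ∀ v w (t : ℝ), HasDerivAt (fun t : ℝ => J (v + t • w))
      (inner ℝ (G (v + t • w)) w) t := by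
    intro v w t
    have h := hd (v + t • w) w
    have h2 : HasDerivAt (fun x : ℝ => x - t) 1 t := (hasDerivAt_id t).sub_const t
    have h3 := HasDerivAt.comp t (h₂ := fun t' : ℝ => J (v + t • w + t' • w)) (h := fun x => x - t)
      (by simpa using h) h2
    rw [mul_one] at h3
    refine h3.congr_of_eventuallyEq (Eventually.of_forall fun x => ?_)
    simp only [Function.comp]
    congr 1
    rw [add_assoc, ← add_smul]
    congr 2
    ring
  have hstep : ∀ v, a ≤ J v → J v ≤ C → ∀ θ ∈ Icc (0 : ℝ) τ,
      J (v - θ • G v) ≤ J v - θ * (δ ^ 2 / 2) := by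
    intro v h1 h2 θ hθ
    have hGv : ‖G v‖ ≤ D' := (hD v ⟨h1, h2⟩).trans (by rw [hD']; linarith [le_max_left D 0])
    have hder : ∀ t ∈ Icc (0 : ℝ) τ, inner ℝ (G (v + t • (-G v))) (-G v) ≤ -(δ ^ 2 / 2) := by
      intro t ht
      have hn : ‖t • (-G v)‖ ≤ τ * D' := by
        rw [norm_smul, norm_neg, Real.norm_eq_abs, abs_of_nonneg ht.1]
        exact mul_le_mul ht.2 hGv (norm_nonneg _) hτpos.le
      have hv : ‖v‖ ≤ r := by simpa using hr (show v ∈ {v | a ≤ J v ∧ J v ≤ C} from ⟨h1, h2⟩)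
      have hclose : ‖G (v + t • (-G v)) - G v‖ < δ / 2 := by
        have := huc (v + t • (-G v)) (by
            rw [mem_closedBall_zero_iff]
            exact (norm_add_le _ _).trans (by linarith)) v (by
            rw [mem_closedBall_zero_iff]; linarith) (by
            rw [dist_eq_norm, add_sub_cancel_left]; linarith)
        rwa [dist_eq_norm] at this
      have h3 : inner ℝ (G (v + t • (-G v))) (-G v)
          = -inner ℝ (G (v + t • (-G v)) - G v) (G v) - ‖G v‖ ^ 2 := by
        rw [inner_neg_right, inner_sub_left, real_inner_self_eq_norm_sq]; ring
      have h4 := abs_real_inner_le_norm (G (v + t • (-G v)) - G v) (G v)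
      have h5 := neg_abs_le (inner ℝ (G (v + t • (-G v)) - G v) (G v))
      have h6 := hGδ v h1 h2
      rw [h3]
      nlinarith [norm_nonneg (G v), mul_le_mul_of_nonneg_right hclose.le (norm_nonneg (G v))]
    have hmv := (convex_Icc (0 : ℝ) τ).image_sub_le_mul_sub_of_deriv_le
      (f := fun t : ℝ => J (v + t • (-G v)))
      (fun t _ => (hline v (-G v) t).continuousAt.continuousWithinAt)
      (fun t _ => (hline v (-G v) t).differentiableAt.differentiableWithinAt)
      (C := -(δ ^ 2 / 2))
      (fun t ht => by
        rw [(hline v (-G v) t).deriv]; exact hder t (interior_subset ht))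
      0 ⟨le_rfl, hτpos.le⟩ θ hθ hθ.1
    simp only [zero_smul, sub_zero, smul_neg, ← sub_eq_add_neg] at hmv
    linarith
  set φ : E → ℝ := fun v => max 0 (min 1 ((J v - a) / (c - a))) with hφ
  have hca : 0 < c - a := by linarith
  have hφc : Continuous φ := by fun_prop
  have hφ0 : ∀ v, 0 ≤ φ v := fun v => le_max_left _ _
  have hφ1 : ∀ v, φ v ≤ 1 := fun v => max_le zero_le_one (min_le_left _ _)
  have hφlow : ∀ v, J v ≤ a → φ v = 0 := by
    intro v hv
    refine max_eq_left ((min_le_right _ _).trans ?_)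
    exact div_nonpos_of_nonpos_of_nonneg (by linarith) hca.le
  have hφhigh : ∀ v, c ≤ J v → φ v = 1 := by
    intro v hv
    have : 1 ≤ (J v - a) / (c - a) := by rw [le_div_iff₀ hca]; linarith
    simp [hφ, min_eq_left this]
  set T : E → E := fun v => v - (τ * φ v) • G v with hT
  have hTc : Continuous T := by fun_prop
  have hTfix : ∀ v, J v ≤ a → T v = v := fun v hv => by simp [hT, hφlow v hv]
  have hmem : ∀ v, τ * φ v ∈ Icc (0 : ℝ) τ := fun v =>
    ⟨mul_nonneg hτpos.le (hφ0 v), by nlinarith [hφ1 v]⟩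
  have hTle : ∀ v, J v ≤ C → J (T v) ≤ J v := by
    intro v hv
    rcases le_or_gt a (J v) with h | h
    · have := hstep v h hv _ (hmem v)
      nlinarith [(hmem v).1, sq_nonneg δ]
    · rw [hTfix v h.le]
  have hTdec : ∀ v, J v ≤ C → c ≤ J v → J (T v) ≤ J v - τ * (δ ^ 2 / 2) := by
    intro v hv hc
    have := hstep v (hac.le.trans hc) hv _ (hmem v)
    simpa [hT, hφhigh v hc] using this
  have hiter : ∀ n : ℕ, ∀ v, J v ≤ C →
      J (T^[n] v) ≤ C ∧ (J (T^[n] v) < c ∨ J (T^[n] v) ≤ C - n * (τ * (δ ^ 2 / 2))) := by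
    intro n v hv
    induction n with
    | zero => simp [hv]
    | succ n ih =>
      rw [Function.iterate_succ_apply']
      refine ⟨(hTle _ ih.1).trans ih.1, ?_⟩
      by_cases hc : c ≤ J (T^[n] v)
      · right
        have h1 := hTdec _ ih.1 hc
        rcases ih.2 with h2 | h2
        · linarith
        · push_cast; linarith
      · left; exact (hTle _ ih.1).trans_lt (not_le.1 hc)
  have hfixn : ∀ n : ℕ, ∀ v, J v ≤ a → T^[n] v = v := fun n v hv =>
    Function.iterate_fixed (hTfix v hv) n
  obtain ⟨n, hn⟩ := exists_nat_gt ((C - c) / (τ * (δ ^ 2 / 2)))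
  rw [div_lt_iff₀ (by positivity)] at hn
  have hcont : Continuous fun t : ℝ => g (T^[n] (t • e)) :=
    hg.comp ((hTc.iterate n).comp (by fun_prop))
  have hivt := intermediate_value_Icc (zero_le_one (α := ℝ)) hcont.continuousOn
  obtain ⟨t, ht, htR⟩ := hivt (show R ∈ Icc _ _ by
    simp only [zero_smul, one_smul, hfixn n 0 h0, hfixn n e he]; exact ⟨hg0.le, hge.le⟩)
  have h1 := hsep _ htR
  rcases (hiter n (t • e) (hseg t ht)).2 with h2 | h2
  · linarith
  · linarith

/-- On a finite measure space, almost everywhere convergence together with a bound in `L^e`, `e > 1`,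
implies convergence of the integrals. -/
theorem tendsto_integral_of_rpow_bound {X : Type*} [MeasurableSpace X] {ν : Measure X}
    [IsFiniteMeasure ν] {h : ℕ → X → ℝ} {h' : X → ℝ} {e C : ℝ} (he : 1 < e)
    (hm : ∀ n, AEStronglyMeasurable (h n) ν)
    (hi : ∀ n, Integrable (fun x => |h n x| ^ e) ν) (hb : ∀ n, ∫ x, |h n x| ^ e ∂ν ≤ C)
    (hl : ∀ᵐ x ∂ν, Tendsto (fun n => h n x) atTop (𝓝 (h' x))) :
    Integrable h' ν ∧ Tendsto (fun n => ∫ x, h n x ∂ν) atTop (𝓝 (∫ x, h' x ∂ν)) := by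
  have hint : ∀ n, Integrable (h n) ν := fun n => by
    refine ((integrable_const (1 : ℝ)).add (hi n)).mono' (hm n) (Eventually.of_forall fun x => ?_)
    rw [Real.norm_eq_abs]
    simp only [Pi.add_apply]
    rcases le_total (|h n x|) 1 with h1 | h1
    · linarith [Real.rpow_nonneg (abs_nonneg (h n x)) e]
    · have := Real.rpow_le_rpow_of_exponent_le h1 he.le
      rw [Real.rpow_one] at this
      linarith
  have hm' : AEStronglyMeasurable h' ν := aestronglyMeasurable_of_tendsto_ae atTop hm hl
  have hC0 : 0 ≤ C := (integral_nonneg fun x => by positivity).trans (hb 0)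
  have hL1 : ∀ n, ∫⁻ x, ‖h n x‖ₑ ∂ν ≤ ν univ + ENNReal.ofReal C := by
    intro n
    calc ∫⁻ x, ‖h n x‖ₑ ∂ν ≤ ∫⁻ x, (1 + ENNReal.ofReal (|h n x| ^ e)) ∂ν := by
          refine lintegral_mono fun x => ?_
          rw [← ofReal_norm, Real.norm_eq_abs, ← ENNReal.ofReal_one,
            ← ENNReal.ofReal_add zero_le_one (by positivity)]
          refine ENNReal.ofReal_le_ofReal ?_
          rcases le_total (|h n x|) 1 with h1 | h1
          · linarith [Real.rpow_nonneg (abs_nonneg (h n x)) e]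
          · have := Real.rpow_le_rpow_of_exponent_le h1 he.le
            rw [Real.rpow_one] at this
            linarith
      _ = ν univ + ENNReal.ofReal (∫ x, |h n x| ^ e ∂ν) := by
          rw [lintegral_add_left measurable_const, lintegral_const, one_mul,
            ofReal_integral_eq_lintegral_ofReal (hi n) (Eventually.of_forall fun x => by positivity)]
      _ ≤ _ := by gcongr; exact hb n
  have hint' : Integrable h' ν := by
    refine ⟨hm', ?_⟩
    have hfat : ∫⁻ x, ‖h' x‖ₑ ∂ν ≤ liminf (fun n => ∫⁻ x, ‖h n x‖ₑ ∂ν) atTop := by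
      calc ∫⁻ x, ‖h' x‖ₑ ∂ν = ∫⁻ x, liminf (fun n => ‖h n x‖ₑ) atTop ∂ν := by
            refine lintegral_congr_ae ?_
            filter_upwards [hl] with x hx
            exact (hx.enorm.liminf_eq).symm
        _ ≤ _ := lintegral_liminf_le' fun n => (hm n).enorm
    refine lt_of_le_of_lt (hfat.trans (liminf_le_of_le (by isBoundedDefault) fun b hb => ?_))
      (show ν univ + ENNReal.ofReal C < ⊤ from
        ENNReal.add_lt_top.2 ⟨measure_lt_top _ _, ENNReal.ofReal_lt_top⟩)
    obtain ⟨n, hn⟩ := hb.exists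
    exact hn.trans (hL1 n)
  refine ⟨hint', ?_⟩
  have hui : UnifIntegrable h 1 ν := by
    refine unifIntegrable_of le_rfl one_ne_top hm fun ε hε => ?_
    obtain ⟨K, hK⟩ : ∃ K : ℝ, 1 ≤ K ∧ K ^ (1 - e) * C ≤ ε := by
      have h1 : Tendsto (fun K : ℝ => K ^ (1 - e) * C) atTop (𝓝 (0 * C)) := by
        refine Tendsto.mul_const C ?_
        have := tendsto_rpow_neg_atTop (show 0 < e - 1 by linarith)
        simpa using this
      rw [zero_mul] at h1
      obtain ⟨K, hK1, hK2⟩ := ((eventually_ge_atTop 1).and (h1.eventually_le_const hε)).exists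
      exact ⟨K, hK1, hK2⟩
    refine ⟨⟨K, by linarith⟩, fun n => ?_⟩
    rw [eLpNorm_one_eq_lintegral_enorm]
    calc ∫⁻ x, ‖({x | (⟨K, by linarith⟩ : NNReal) ≤ ‖h n x‖₊}.indicator (h n)) x‖ₑ ∂ν
        ≤ ∫⁻ x, ENNReal.ofReal (K ^ (1 - e) * |h n x| ^ e) ∂ν := by
          refine lintegral_mono fun x => ?_
          rw [← ofReal_norm]
          refine ENNReal.ofReal_le_ofReal ?_
          by_cases hx : K ≤ |h n x|
          · have hx' : x ∈ {x | (⟨K, by linarith⟩ : NNReal) ≤ ‖h n x‖₊} := hx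
            rw [indicator_of_mem hx', Real.norm_eq_abs]
            have hpos : 0 < |h n x| := by linarith
            have : |h n x| = |h n x| ^ (1 - e) * |h n x| ^ e := by
              rw [← Real.rpow_add hpos]; simp
            have h2 : |h n x| ^ (1 - e) ≤ K ^ (1 - e) :=
              Real.rpow_le_rpow_of_nonpos (by linarith) hx (by linarith)
            calc |h n x| = |h n x| ^ (1 - e) * |h n x| ^ e := this
              _ ≤ _ := by gcongr
          · have hx' : x ∉ {x | (⟨K, by linarith⟩ : NNReal) ≤ ‖h n x‖₊} := hx
            rw [indicator_of_notMem hx', norm_zero]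
            have : 0 ≤ K := by linarith
            positivity
      _ = ENNReal.ofReal (K ^ (1 - e) * ∫ x, |h n x| ^ e ∂ν) := by
          rw [← integral_const_mul, ofReal_integral_eq_lintegral_ofReal ((hi n).const_mul _)]
          have : 0 ≤ K := by linarith
          exact Eventually.of_forall fun x => by positivity
      _ ≤ ENNReal.ofReal ε := by
          refine ENNReal.ofReal_le_ofReal (le_trans ?_ hK.2)
          have : 0 ≤ K := by linarith
          gcongr
          exact hb n
  have := tendsto_Lp_finite_of_tendsto_ae le_rfl one_ne_top hm (memLp_one_iff_integrable.2 hint')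
    hui hl
  exact tendsto_integral_of_L1' h' hint'.1 (Eventually.of_forall hint) this

/-- Fatou's lemma for non-negative real functions. -/
theorem integrable_and_integral_le_of_fatou {X : Type*} [MeasurableSpace X] {ν : Measure X}
    {h : ℕ → X → ℝ} {h' : X → ℝ} {C : ℝ} (hi : ∀ n, Integrable (h n) ν)
    (h0 : ∀ n, ∀ x, 0 ≤ h n x) (hb : ∀ᶠ n in atTop, ∫ x, h n x ∂ν ≤ C)
    (hl : ∀ᵐ x ∂ν, Tendsto (fun n => h n x) atTop (𝓝 (h' x))) :
    Integrable h' ν ∧ ∫ x, h' x ∂ν ≤ C := by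
  have hm' : AEStronglyMeasurable h' ν :=
    aestronglyMeasurable_of_tendsto_ae atTop (fun n => (hi n).1) hl
  have h0' : 0 ≤ᵐ[ν] h' := by
    filter_upwards [hl] with x hx
    exact ge_of_tendsto' hx fun n => h0 n x
  have hC0 : 0 ≤ C := by
    obtain ⟨n, hn⟩ := hb.exists
    exact (integral_nonneg (h0 n)).trans hn
  have hfat : ∫⁻ x, ENNReal.ofReal (h' x) ∂ν ≤ ENNReal.ofReal C := by
    calc ∫⁻ x, ENNReal.ofReal (h' x) ∂ν
        = ∫⁻ x, liminf (fun n => ENNReal.ofReal (h n x)) atTop ∂ν := by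
          refine lintegral_congr_ae ?_
          filter_upwards [hl] with x hx
          exact ((ENNReal.continuous_ofReal.tendsto _).comp hx).liminf_eq.symm
      _ ≤ liminf (fun n => ∫⁻ x, ENNReal.ofReal (h n x) ∂ν) atTop :=
          lintegral_liminf_le' fun n => (hi n).1.aemeasurable.ennreal_ofReal
      _ ≤ _ := by
          refine liminf_le_of_le (by isBoundedDefault) fun b hb' => ?_
          obtain ⟨n, hn, hn'⟩ := (hb'.and hb).exists
          refine hn.trans ?_
          rw [← ofReal_integral_eq_lintegral_ofReal (hi n) (Eventually.of_forall (h0 n))]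
          exact ENNReal.ofReal_le_ofReal hn'
  have hint : Integrable h' ν := by
    refine ⟨hm', ?_⟩
    rw [hasFiniteIntegral_iff_ofReal h0']
    exact hfat.trans_lt ENNReal.ofReal_lt_top
  refine ⟨hint, ?_⟩
  rw [← ENNReal.ofReal_le_ofReal_iff hC0, ofReal_integral_eq_lintegral_ofReal hint h0']
  exact hfat

/-- Uniform bounds on the variable exponents `s` and `p`. -/
structure Exps (s p : RN N → RN N → ℝ) (s₀ s₁ p₀ p₁ : ℝ) : Prop where
  contS : Continuous fun z : RN N × RN N => s z.1 z.2
  contP : Continuous fun z : RN N × RN N => p z.1 z.2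
  s₀_pos : 0 < s₀
  s_ge : ∀ x y, s₀ ≤ s x y
  s_le : ∀ x y, s x y ≤ s₁
  s₁_lt : s₁ < 1
  p₀_gt : 1 < p₀
  p_ge : ∀ x y, p₀ ≤ p x y
  p_le : ∀ x y, p x y ≤ p₁
  sub : s₁ * p₁ < N

namespace Exps

variable {s p : RN N → RN N → ℝ} {s₀ s₁ p₀ p₁ : ℝ} (H : Exps s p s₀ s₁ p₀ p₁)
include H

lemma p_pos (x y : RN N) : 0 < p x y := by linarith [H.p_ge x y, H.p₀_gt]

lemma p_gt (x y : RN N) : 1 < p x y := by linarith [H.p_ge x y, H.p₀_gt]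

lemma s_pos (x y : RN N) : 0 < s x y := by linarith [H.s_ge x y, H.s₀_pos]

lemma p₀_le : p₀ ≤ p₁ := (H.p_ge 0 0).trans (H.p_le 0 0)

lemma p₁_pos : 0 < p₁ := by linarith [H.p₀_le, H.p₀_gt]

lemma s₁_pos : 0 < s₁ := by linarith [H.s_le 0 0, H.s_pos 0 0]

lemma N_pos : 0 < (N : ℝ) := (mul_pos H.s₁_pos H.p₁_pos).trans H.sub

lemma N_pos' : 0 < N := by exact_mod_cast H.N_pos

lemma sp_pos (x y : RN N) : 0 < s x y * p x y := mul_pos (H.s_pos x y) (H.p_pos x y)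

lemma sp_le (x y : RN N) : s x y * p x y ≤ s₁ * p₁ :=
  mul_le_mul (H.s_le x y) (H.p_le x y) (H.p_pos x y).le H.s₁_pos.le

lemma sp_ge (x y : RN N) : s₀ * p₀ ≤ s x y * p x y :=
  mul_le_mul (H.s_ge x y) (H.p_ge x y) (by linarith [H.p₀_gt]) (H.s_pos x y).le

end Exps

lemma integrable_kernel_ball {β : ℝ} (hN : 0 < N) (hβ : β < N) (R : ℝ) :
    IntegrableOn (fun z : RN N => ‖z‖ ^ (-β)) (Metric.ball 0 R) := by
  refine integrableOn_ball_of_norm_le_rpow (C := 1) (α := β) ?_ ?_ ?_ ?_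
  · rw [finrank_euclideanSpace_fin]; exact hN
  · rw [finrank_euclideanSpace_fin]; exact hβ
  · refine Eventually.of_forall fun x => ?_
    rw [Real.norm_eq_abs, abs_of_nonneg (by positivity), one_mul]
  · exact (Measurable.pow_const measurable_norm _).aestronglyMeasurable

lemma integrable_kernel_tail {δ : ℝ} (hδ : 0 < δ) :
    IntegrableOn (fun z : RN N => ‖z‖ ^ (-(N + δ))) (Metric.ball 0 1)ᶜ := by
  have h := (integrable_one_add_norm (E := RN N) (μ := volume) (r := N + δ)
    (by rw [finrank_euclideanSpace_fin]; linarith)).const_mul ((2 : ℝ) ^ ((N : ℝ) + δ))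
  refine h.integrableOn.mono' (Measurable.pow_const measurable_norm _).aestronglyMeasurable ?_
  refine (ae_restrict_iff' Metric.isOpen_ball.measurableSet.compl).2 (Eventually.of_forall ?_)
  intro z hz
  have hz1 : 1 ≤ ‖z‖ := by simpa using hz
  rw [Real.norm_eq_abs, abs_of_nonneg (by positivity), Real.rpow_neg (by positivity),
    Real.rpow_neg (by positivity), ← div_eq_mul_inv, ← one_div,
    div_le_div_iff₀ (by positivity) (by positivity), one_mul,
    ← Real.mul_rpow (by positivity) (by positivity)]
  exact Real.rpow_le_rpow (by positivity) (by linarith) (by positivity)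

/-- The radial kernel `|z|^{-N+δ}` near the origin and `|z|^{-N-δ}` away from it. -/
def radialKernel (N : ℕ) (δ : ℝ) (z : RN N) : ℝ :=
  if ‖z‖ < 1 then ‖z‖ ^ (-(N - δ)) else ‖z‖ ^ (-(N + δ))

lemma radialKernel_nonneg (δ : ℝ) (z : RN N) : 0 ≤ radialKernel N δ z := by
  unfold radialKernel; split_ifs <;> positivity

lemma integrable_radialKernel {δ : ℝ} (hN : 0 < N) (hδ : 0 < δ) :
    Integrable (radialKernel N δ) := by
  rw [← integrableOn_univ, ← union_compl_self (Metric.ball (0 : RN N) 1)]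
  refine IntegrableOn.union ?_ ?_
  · refine (integrable_kernel_ball hN (show (N : ℝ) - δ < N by linarith) 1).congr_fun ?_
      Metric.isOpen_ball.measurableSet
    intro z hz
    have : ‖z‖ < 1 := by simpa using hz
    simp [radialKernel, this]
  · refine (integrable_kernel_tail hδ).congr_fun ?_ Metric.isOpen_ball.measurableSet.compl
    intro z hz
    have : ¬ ‖z‖ < 1 := by simpa using hz
    simp [radialKernel, this]

/-- Pointwise density of the Gagliardo modular. -/
def gden (s p : RN N → RN N → ℝ) (u : RN N → ℝ) (z : RN N × RN N) : ℝ :=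
  |u z.1 - u z.2| ^ p z.1 z.2 / dist z.1 z.2 ^ ((N : ℝ) + s z.1 z.2 * p z.1 z.2)

/-- The Gagliardo modular as a real number. -/
def rho (s p : RN N → RN N → ℝ) (u : RN N → ℝ) : ℝ := ∫ z, gden s p u z

/-- Measurable functions vanishing outside `Ω` with finite Gagliardo modular. -/
structure Adm (Ω : Set (RN N)) (s p : RN N → RN N → ℝ) (u : RN N → ℝ) : Prop where
  meas : Measurable u
  zero : ∀ x, x ∉ Ω → u x = 0
  int : Integrable (gden s p u)

section gden

variable {s p : RN N → RN N → ℝ} {s₀ s₁ p₀ p₁ : ℝ} {u v w : RN N → ℝ} {Ω : Set (RN N)}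

lemma gden_nonneg (z : RN N × RN N) : 0 ≤ gden s p u z := by unfold gden; positivity

lemma rho_nonneg : 0 ≤ rho s p u := integral_nonneg fun z => gden_nonneg z

lemma measurable_dist_pow (H : Exps s p s₀ s₁ p₀ p₁) :
    Measurable fun z : RN N × RN N => dist z.1 z.2 ^ ((N : ℝ) + s z.1 z.2 * p z.1 z.2) :=
  measurable_dist.pow ((H.contS.mul H.contP).measurable.const_add _)

lemma measurable_gden (H : Exps s p s₀ s₁ p₀ p₁) (hu : Measurable u) :
    Measurable (gden s p u) := by
  have h1 : Measurable fun z : RN N × RN N => |u z.1 - u z.2| :=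
    ((hu.comp measurable_fst).sub (hu.comp measurable_snd)).abs
  exact (h1.pow H.contP.measurable).div (measurable_dist_pow H)

lemma two_pow_add (H : Exps s p s₀ s₁ p₀ p₁) (x y : RN N) (a b : ℝ) :
    |a + b| ^ p x y ≤ 2 ^ p₁ * (|a| ^ p x y + |b| ^ p x y) := by
  have hp := H.p_pos x y
  have h1 : |a + b| ≤ 2 * max |a| |b| := by
    have := abs_add_le a b
    linarith [le_max_left |a| |b|, le_max_right |a| |b|]
  have h2 : (max |a| |b|) ^ p x y ≤ |a| ^ p x y + |b| ^ p x y := by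
    rcases max_cases |a| |b| with h | h <;> rw [h.1]
    · linarith [Real.rpow_nonneg (abs_nonneg b) (p x y)]
    · linarith [Real.rpow_nonneg (abs_nonneg a) (p x y)]
  have hm : 0 ≤ max |a| |b| := (abs_nonneg a).trans (le_max_left _ _)
  calc |a + b| ^ p x y ≤ (2 * max |a| |b|) ^ p x y :=
        Real.rpow_le_rpow (abs_nonneg _) h1 hp.le
    _ = 2 ^ p x y * (max |a| |b|) ^ p x y := Real.mul_rpow (by norm_num) hm
    _ ≤ _ := by
        gcongr
        · norm_num
        · exact H.p_le x y

lemma gden_add_le (H : Exps s p s₀ s₁ p₀ p₁) (z : RN N × RN N) :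
    gden s p (u + v) z ≤ 2 ^ p₁ * (gden s p u z + gden s p v z) := by
  unfold gden
  rw [← add_div, ← mul_div_assoc]
  gcongr
  have h : (u + v) z.1 - (u + v) z.2 = (u z.1 - u z.2) + (v z.1 - v z.2) := by
    simp only [Pi.add_apply]; ring
  rw [h]
  exact two_pow_add H z.1 z.2 _ _

lemma gden_smul (c : ℝ) (z : RN N × RN N) :
    gden s p (c • u) z = |c| ^ p z.1 z.2 * gden s p u z := by
  unfold gden
  rw [← mul_div_assoc, ← Real.mul_rpow (abs_nonneg _) (abs_nonneg _), ← abs_mul]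
  simp only [Pi.smul_apply, smul_eq_mul]
  congr 3; ring

lemma rpow_le_max (H : Exps s p s₀ s₁ p₀ p₁) {c : ℝ} (hc : 0 ≤ c) (x y : RN N) :
    c ^ p x y ≤ (max 1 c) ^ p₁ :=
  (Real.rpow_le_rpow hc (le_max_right _ _) (H.p_pos x y).le).trans
    (Real.rpow_le_rpow_of_exponent_le (le_max_left _ _) (H.p_le x y))

namespace Adm

lemma add (H : Exps s p s₀ s₁ p₀ p₁) (hu : Adm Ω s p u) (hv : Adm Ω s p v) :
    Adm Ω s p (u + v) where
  meas := hu.meas.add hv.meas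
  zero x hx := by simp [hu.zero x hx, hv.zero x hx]
  int := by
    refine ((hu.int.add hv.int).const_mul (2 ^ p₁)).mono'
      (measurable_gden H (hu.meas.add hv.meas)).aestronglyMeasurable (Eventually.of_forall fun z => ?_)
    rw [Real.norm_eq_abs, abs_of_nonneg (gden_nonneg z)]
    exact gden_add_le H z

lemma smul (H : Exps s p s₀ s₁ p₀ p₁) (hu : Adm Ω s p u) (c : ℝ) : Adm Ω s p (c • u) where
  meas := hu.meas.const_smul c
  zero x hx := by simp [hu.zero x hx]
  int := by
    refine (hu.int.const_mul ((max 1 |c|) ^ p₁)).mono'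
      (measurable_gden H (hu.meas.const_smul c)).aestronglyMeasurable
      (Eventually.of_forall fun z => ?_)
    rw [Real.norm_eq_abs, abs_of_nonneg (gden_nonneg z), gden_smul]
    exact mul_le_mul_of_nonneg_right (rpow_le_max H (abs_nonneg c) _ _) (gden_nonneg z)

lemma zero_fun (H : Exps s p s₀ s₁ p₀ p₁) : Adm Ω s p (0 : RN N → ℝ) where
  meas := measurable_const
  zero _ _ := rfl
  int := by
    have : gden s p (0 : RN N → ℝ) = fun _ => 0 := by
      funext z
      simp [gden, Real.zero_rpow (H.p_pos z.1 z.2).ne']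
    rw [this]
    exact integrable_zero _ _ _

lemma neg (H : Exps s p s₀ s₁ p₀ p₁) (hu : Adm Ω s p u) : Adm Ω s p (-u) := by
  have := hu.smul H (-1); rwa [neg_one_smul] at this

lemma sub (H : Exps s p s₀ s₁ p₀ p₁) (hu : Adm Ω s p u) (hv : Adm Ω s p v) :
    Adm Ω s p (u - v) := by
  rw [sub_eq_add_neg]; exact hu.add H (hv.neg H)

lemma sum (H : Exps s p s₀ s₁ p₀ p₁) {ι : Type*} (t : Finset ι) {f : ι → RN N → ℝ}
    (hf : ∀ i ∈ t, Adm Ω s p (f i)) : Adm Ω s p (∑ i ∈ t, f i) :=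
  Finset.sum_induction _ _ (fun _ _ h1 h2 => h1.add H h2) (zero_fun H) hf

end Adm

lemma rho_add_le (H : Exps s p s₀ s₁ p₀ p₁) (hu : Adm Ω s p u) (hv : Adm Ω s p v) :
    rho s p (u + v) ≤ 2 ^ p₁ * (rho s p u + rho s p v) := by
  unfold rho
  rw [← integral_add hu.int hv.int, ← integral_const_mul]
  exact integral_mono (hu.add H hv).int ((hu.int.add hv.int).const_mul _)
    fun z => gden_add_le H z

lemma rho_smul_le_max (H : Exps s p s₀ s₁ p₀ p₁) (hu : Adm Ω s p u) (c : ℝ) :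
    rho s p (c • u) ≤ (max 1 |c|) ^ p₁ * rho s p u := by
  unfold rho
  rw [← integral_const_mul]
  refine integral_mono (hu.smul H c).int (hu.int.const_mul _) fun z => ?_
  rw [gden_smul]
  exact mul_le_mul_of_nonneg_right (rpow_le_max H (abs_nonneg c) _ _) (gden_nonneg z)

lemma rho_neg : rho s p (-u) = rho s p u := by
  unfold rho
  congr 1; funext z
  rw [← neg_one_smul ℝ u, gden_smul]; simp

lemma rho_sub_le (H : Exps s p s₀ s₁ p₀ p₁) (hu : Adm Ω s p u) (hv : Adm Ω s p v) :
    rho s p (u - v) ≤ 2 ^ p₁ * (rho s p u + rho s p v) := by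
  rw [sub_eq_add_neg, ← rho_neg (u := v)]; exact rho_add_le H hu (hv.neg H)

lemma gden_congr_ae (h : u =ᵐ[volume] v) : gden s p u =ᵐ[volume] gden s p v := by
  have h1 : ∀ᵐ z : RN N × RN N, u z.1 = v z.1 := Measure.quasiMeasurePreserving_fst.ae h
  have h2 : ∀ᵐ z : RN N × RN N, u z.2 = v z.2 := Measure.quasiMeasurePreserving_snd.ae h
  filter_upwards [h1, h2] with z hz1 hz2
  simp [gden, hz1, hz2]

/-- Every nonempty open set carries an admissible function that is not almost everywhere zero. -/
lemma exists_adm_ne_zero (H : Exps s p s₀ s₁ p₀ p₁) (hΩo : IsOpen Ω)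
    (hΩb : Bornology.IsBounded Ω) (hΩne : Ω.Nonempty) :
    ∃ φ : RN N → ℝ, Adm Ω s p φ ∧ ¬ (φ =ᵐ[volume] fun _ => 0) := by
  obtain ⟨x₀, hx₀⟩ := hΩne
  obtain ⟨ε, hε, hball⟩ := Metric.isOpen_iff.1 hΩo x₀ hx₀
  set η := min ε 1 with hη
  have hηpos : 0 < η := lt_min hε one_pos
  have hη1 : η ≤ 1 := min_le_right _ _
  set φ : RN N → ℝ := fun x => max 0 (η - dist x x₀) with hφ
  have hφc : Continuous φ := by fun_prop
  have hφz : ∀ x, x ∉ Ω → φ x = 0 := by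
    intro x hx
    have : ε ≤ dist x x₀ := not_lt.1 fun h => hx (hball h)
    exact max_eq_left (by linarith [min_le_left ε 1])
  have hφ0 : ∀ x, 0 ≤ φ x := fun x => le_max_left _ _
  have hφ1 : ∀ x, φ x ≤ 1 := fun x => max_le zero_le_one (by linarith [dist_nonneg (x := x) (y := x₀)])
  have hφL : ∀ x y, |φ x - φ y| ≤ dist x y := by
    intro x y
    refine (abs_max_sub_max_le_max _ _ _ _).trans ?_
    rw [sub_self, abs_zero, max_eq_right (abs_nonneg _)]
    have h := abs_dist_sub_le y x x₀
    rw [dist_comm y x] at h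
    have h' : η - dist x x₀ - (η - dist y x₀) = dist y x₀ - dist x x₀ := by ring
    rwa [h']
  set δ := min (p₀ * (1 - s₁)) (s₀ * p₀) with hδ
  have hp0 : 0 < p₀ := by linarith [H.p₀_gt]
  have hδpos : 0 < δ := lt_min (mul_pos hp0 (by linarith [H.s₁_lt])) (mul_pos H.s₀_pos hp0)
  have hκ := integrable_radialKernel (N := N) H.N_pos' hδpos
  have hbound : ∀ x y, gden s p φ (x, y) ≤
      (Ω.indicator 1 x + Ω.indicator 1 y) * radialKernel N δ (x - y) := by
    intro x y
    have hk := radialKernel_nonneg (N := N) δ (x - y)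
    have hi : ∀ x, 0 ≤ Ω.indicator (1 : RN N → ℝ) x :=
      fun x => indicator_nonneg (fun _ _ => zero_le_one) x
    have hp := H.p_pos x y
    by_cases hxy : x ∉ Ω ∧ y ∉ Ω
    · have : gden s p φ (x, y) = 0 := by
        simp [gden, hφz x hxy.1, hφz y hxy.2, Real.zero_rpow hp.ne']
      rw [this]
      exact mul_nonneg (add_nonneg (hi x) (hi y)) hk
    have hone : (1 : ℝ) ≤ Ω.indicator 1 x + Ω.indicator 1 y := by
      by_cases hx : x ∈ Ω
      · rw [indicator_of_mem hx]; simpa using hi y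
      · have hy : y ∈ Ω := by tauto
        rw [indicator_of_mem hy]; simpa using hi x
    refine le_trans ?_ (mul_le_mul_of_nonneg_right hone hk)
    rw [one_mul]
    rcases eq_or_ne x y with rfl | hne
    · simp only [gden, sub_self, abs_zero, Real.zero_rpow hp.ne', zero_div]
      exact radialKernel_nonneg _ _
    have hd : 0 < dist x y := dist_pos.2 hne
    simp only [gden, radialKernel, ← dist_eq_norm]
    rw [div_le_iff₀ (by positivity)]
    split_ifs with h1
    · rw [← Real.rpow_add hd]
      refine (Real.rpow_le_rpow (abs_nonneg _) (hφL x y) hp.le).trans ?_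
      refine Real.rpow_le_rpow_of_exponent_ge hd h1.le ?_
      have h2 : δ ≤ p₀ * (1 - s₁) := min_le_left _ _
      have h3 : p₀ * (1 - s₁) ≤ p x y * (1 - s x y) :=
        mul_le_mul (H.p_ge x y) (by linarith [H.s_le x y]) (by linarith [H.s₁_lt]) hp.le
      nlinarith
    · rw [← Real.rpow_add hd]
      have h4 : |φ x - φ y| ≤ 1 := by
        rw [abs_le]; constructor <;> linarith [hφ0 x, hφ0 y, hφ1 x, hφ1 y]
      refine (Real.rpow_le_one (abs_nonneg _) h4 hp.le).trans ?_
      refine Real.one_le_rpow (not_lt.1 h1) ?_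
      have h2 : δ ≤ s₀ * p₀ := min_le_right _ _
      linarith [H.sp_ge x y]
  refine ⟨φ, ⟨hφc.measurable, hφz, ?_⟩, ?_⟩
  · have hΩm := hΩo.measurableSet
    have hind : Integrable (Ω.indicator (1 : RN N → ℝ)) :=
      (integrable_indicator_iff hΩm).2 (integrableOn_const (hΩb.measure_lt_top.ne))
    have h1 : Integrable fun z : RN N × RN N => Ω.indicator (1 : RN N → ℝ) z.1 *
        radialKernel N δ (z.1 - z.2) := by
      have h2 : Integrable fun z : RN N × RN N => Ω.indicator (1 : RN N → ℝ) z.2 *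
          radialKernel N δ (z.1 - z.2) := by
        have := Integrable.convolution_integrand (ContinuousLinearMap.mul ℝ ℝ)
          (μ := (volume : Measure (RN N))) (ν := volume) hind hκ
        rw [Measure.volume_eq_prod]
        simpa using this
      have h3 := h2.swap
      refine h3.congr (Eventually.of_forall fun z => ?_)
      have : ‖z.2 - z.1‖ = ‖z.1 - z.2‖ := norm_sub_rev _ _
      simp [radialKernel, Function.comp, this]
    have h2 : Integrable fun z : RN N × RN N => Ω.indicator (1 : RN N → ℝ) z.2 *
        radialKernel N δ (z.1 - z.2) := by
      have := Integrable.convolution_integrand (ContinuousLinearMap.mul ℝ ℝ)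
        (μ := (volume : Measure (RN N))) (ν := volume) hind hκ
      rw [Measure.volume_eq_prod]
      simpa using this
    refine (h1.add h2).mono' (measurable_gden H hφc.measurable).aestronglyMeasurable
      (Eventually.of_forall fun z => ?_)
    rw [Real.norm_eq_abs, abs_of_nonneg (gden_nonneg z)]
    refine (hbound z.1 z.2).trans_eq ?_
    simp only [Pi.add_apply]; ring
  · intro h
    have h1 : φ = fun _ => 0 := hφc.ae_eq_iff_eq volume continuous_const |>.1 h
    have h2 := congrFun h1 x₀
    simp [hφ] at h2
    linarith

end gden

section Embedding

variable {s p : RN N → RN N → ℝ} {s₀ s₁ p₀ p₁ : ℝ} {Ω : Set (RN N)}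

lemma rpow_le_one_add_rpow {a e e' : ℝ} (ha : 0 ≤ a) (he : 0 ≤ e) (hee : e ≤ e') :
    a ^ e ≤ 1 + a ^ e' := by
  rcases le_total a 1 with h | h
  · linarith [Real.rpow_le_one ha h he, Real.rpow_nonneg ha e']
  · linarith [Real.rpow_le_rpow_of_exponent_le h hee]

/-- A Poincaré inequality for the Gagliardo modular. -/
lemma exists_poincare (H : Exps s p s₀ s₁ p₀ p₁) (hΩo : IsOpen Ω)
    (hΩb : Bornology.IsBounded Ω) :
    ∃ C, 0 ≤ C ∧ ∀ u, Adm Ω s p u → IntegrableOn (fun x => |u x| ^ p₀) Ω ∧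
      ∫ x in Ω, |u x| ^ p₀ ≤ C * (1 + rho s p u) := by
  obtain ⟨R, hR⟩ := hΩb.subset_closedBall (0 : RN N)
  have : Nontrivial (RN N) := by
    apply Module.nontrivial_of_finrank_pos (R := ℝ)
    rw [finrank_euclideanSpace_fin]; exact H.N_pos'
  set R' := max R 0 with hR'
  have hR0 : 0 ≤ R' := le_max_right _ _
  obtain ⟨a, ha⟩ := exists_norm_eq (RN N) (show 0 ≤ R' + 2 by linarith)
  set A := Metric.ball a 1 with hA
  set d := 2 * R' + 3 with hd
  set D := d ^ ((N : ℝ) + s₁ * p₁) with hD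
  have hdpos : 1 ≤ d := by linarith
  have hDpos : 0 < D := by positivity
  have hxΩ : ∀ x ∈ Ω, ‖x‖ ≤ R' := fun x hx => by
    have := hR hx
    rw [mem_closedBall_zero_iff] at this
    exact this.trans (le_max_left _ _)
  have hyA : ∀ y ∈ A, R' + 1 < ‖y‖ ∧ ‖y‖ < R' + 3 := fun y hy => by
    have h1 : ‖y - a‖ < 1 := by rw [← dist_eq_norm]; exact hy
    have h2 := norm_sub_norm_le a y
    have h3 := norm_sub_norm_le y a
    rw [norm_sub_rev] at h2
    constructor <;> linarith
  have hΩm : volume Ω ≠ ⊤ := hΩb.measure_lt_top.ne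
  have hAfin : volume A ≠ ⊤ := measure_ball_lt_top.ne
  have hApos : 0 < volume.real A := by
    rw [measureReal_def]
    exact ENNReal.toReal_pos (Metric.measure_ball_pos volume a one_pos).ne' hAfin
  set νΩ := (volume : Measure (RN N)).restrict Ω with hνΩ
  set νA := (volume : Measure (RN N)).restrict A with hνA
  have : IsFiniteMeasure νΩ := ⟨by rw [hνΩ, Measure.restrict_apply_univ]; exact hΩb.measure_lt_top⟩
  have : IsFiniteMeasure νA := ⟨by rw [hνA, Measure.restrict_apply_univ]; exact measure_ball_lt_top⟩
  have hprod : νΩ.prod νA = (volume : Measure (RN N × RN N)).restrict (Ω ×ˢ A) := by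
    rw [Measure.volume_eq_prod, Measure.prod_restrict]
  have hpt : ∀ u, Adm Ω s p u → ∀ z ∈ Ω ×ˢ A, |u z.1| ^ p₀ ≤ 1 + D * gden s p u z := by
    rintro u hu ⟨x, y⟩ ⟨hx, hy⟩
    have h1 := hxΩ x hx
    have h2 := hyA y hy
    have hyΩ : y ∉ Ω := fun h => by linarith [hxΩ y h]
    have hdist : dist x y ≤ d := by
      rw [dist_eq_norm]
      refine (norm_sub_le x y).trans ?_
      linarith
    have hdist' : 0 < dist x y := dist_pos.2 fun h => hyΩ (h ▸ hx)
    refine (rpow_le_one_add_rpow (abs_nonneg _) (by linarith [H.p₀_gt]) (H.p_ge x y)).trans ?_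
    have h3 : dist x y ^ ((N : ℝ) + s x y * p x y) ≤ D := by
      calc dist x y ^ ((N : ℝ) + s x y * p x y) ≤ d ^ ((N : ℝ) + s x y * p x y) :=
            Real.rpow_le_rpow hdist'.le hdist (by have := H.sp_pos x y; positivity)
        _ ≤ D := Real.rpow_le_rpow_of_exponent_le hdpos (by linarith [H.sp_le x y])
    have h4 : |u x| ^ p x y ≤ D * gden s p u (x, y) := by
      simp only [gden, hu.zero y hyΩ, sub_zero]
      rw [← mul_div_assoc, le_div_iff₀ (by positivity), mul_comm]
      exact mul_le_mul_of_nonneg_right h3 (by positivity)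
    simpa using h4
  refine ⟨(volume.real A)⁻¹ * (volume.real (Ω ×ˢ A) + D), by positivity, fun u hu => ?_⟩
  have hint : Integrable (fun z : RN N × RN N => 1 + D * gden s p u z) (νΩ.prod νA) := by
    refine (integrable_const _).add ?_
    rw [hprod]
    exact hu.int.integrableOn.const_mul D
  have hmeas : Measurable fun x => |u x| ^ p₀ := (hu.meas.abs.pow_const _)
  have hae : ∀ᵐ z ∂(νΩ.prod νA), |u z.1| ^ p₀ ≤ 1 + D * gden s p u z := by
    rw [hprod]
    refine (ae_restrict_iff' (hΩo.measurableSet.prod Metric.isOpen_ball.measurableSet)).2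
      (Eventually.of_forall fun z hz => hpt u hu z hz)
  have hint2 : Integrable (fun z : RN N × RN N => |u z.1| ^ p₀) (νΩ.prod νA) := by
    refine hint.mono' (hmeas.comp measurable_fst).aestronglyMeasurable ?_
    filter_upwards [hae] with z hz
    rw [Real.norm_eq_abs, abs_of_nonneg (by positivity)]; exact hz
  have hνA0 : νA ≠ 0 := by
    rw [hνA, Ne, Measure.restrict_eq_zero]
    exact (Metric.measure_ball_pos volume a one_pos).ne'
  have : NeZero νA := ⟨hνA0⟩
  refine ⟨Integrable.of_comp_fst hint2 hνA0, ?_⟩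
  have h1 : ∫ z, |u z.1| ^ p₀ ∂(νΩ.prod νA) = volume.real A * ∫ x in Ω, |u x| ^ p₀ := by
    rw [integral_fun_fst (fun x => |u x| ^ p₀)]
    simp only [hνA, smul_eq_mul, measureReal_def, Measure.restrict_apply_univ]
    rfl
  have h2 : ∫ z, |u z.1| ^ p₀ ∂(νΩ.prod νA) ≤ volume.real (Ω ×ˢ A) + D * rho s p u := by
    refine (integral_mono_ae hint2 hint hae).trans ?_
    rw [integral_add (integrable_const _) (by
      rw [hprod]; exact hu.int.integrableOn.const_mul D), integral_const_mul]
    refine add_le_add ?_ (mul_le_mul_of_nonneg_left ?_ hDpos.le)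
    · rw [hprod]; simp [measureReal_def]
    · rw [hprod]
      exact setIntegral_le_integral hu.int (Eventually.of_forall fun z => gden_nonneg z)
  rw [h1] at h2
  rw [mul_assoc, ← div_eq_inv_mul, le_div_iff₀ hApos, mul_comm]
  refine h2.trans ?_
  have := rho_nonneg (s := s) (p := p) (u := u)
  have h3 : 0 ≤ volume.real (Ω ×ˢ A) := measureReal_nonneg
  nlinarith [mul_nonneg h3 this]

lemma exists_geometric_bound {P θ γ C V : ℝ} {k₀ : ℕ} (hθ0 : 0 ≤ θ) (hθ1 : θ < 1) (hγ0 : 0 ≤ γ)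
    (hγ : γ * (1 - θ) ≤ P) (hC : 0 ≤ C) :
    ∃ A, 0 ≤ A ∧ ∀ a : ℕ → ℝ, (∀ k, 0 ≤ a k) → (∀ k, a k ≤ V) →
      (∀ k, k₀ ≤ k → a (k + 1) ≤ C * 2 ^ (-(k * P)) * a k ^ θ) →
      ∀ k : ℕ, a k ≤ A * 2 ^ (-(k * γ)) := by
  set A := max (max V 0 * 2 ^ (k₀ * γ)) ((C * 2 ^ γ) ^ (1 / (1 - θ))) with hA
  have hA0 : 0 ≤ A := le_max_of_le_left (by positivity)
  have h1θ : 0 < 1 - θ := by linarith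
  have hA1 : C * 2 ^ γ ≤ A ^ (1 - θ) := by
    calc C * 2 ^ γ = ((C * 2 ^ γ) ^ (1 / (1 - θ))) ^ (1 - θ) := by
          rw [← Real.rpow_mul (by positivity), one_div, inv_mul_cancel₀ h1θ.ne', Real.rpow_one]
      _ ≤ _ := Real.rpow_le_rpow (by positivity) (le_max_right _ _) h1θ.le
  refine ⟨A, hA0, fun a ha0 haV hstep k => ?_⟩
  induction k with
  | zero =>
    simp only [Nat.cast_zero, zero_mul, neg_zero, Real.rpow_zero, mul_one]
    refine (haV 0).trans ((le_max_left V 0).trans (le_max_of_le_left ?_))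
    exact le_mul_of_one_le_right (le_max_right _ _) (Real.one_le_rpow one_le_two (by positivity))
  | succ k ih =>
    by_cases hk : k₀ ≤ k
    · refine (hstep k hk).trans ?_
      have h1 : a k ^ θ ≤ A ^ θ * 2 ^ (-(k * γ) * θ) := by
        rw [Real.rpow_mul zero_le_two, ← Real.mul_rpow hA0 (by positivity)]
        exact Real.rpow_le_rpow (ha0 k) ih hθ0
      calc C * 2 ^ (-(k * P)) * a k ^ θ
          ≤ C * 2 ^ (-(k * P)) * (A ^ θ * 2 ^ (-(k * γ) * θ)) := by gcongr
        _ = C * A ^ θ * 2 ^ (-(k * P) + -(k * γ) * θ) := by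
            rw [Real.rpow_add two_pos]; ring
        _ ≤ C * A ^ θ * 2 ^ (-(k * γ)) := by
            gcongr
            · exact one_le_two
            · have : (0 : ℝ) ≤ k := Nat.cast_nonneg k
              nlinarith
        _ = C * 2 ^ γ * A ^ θ * 2 ^ (-((k + 1 : ℕ) * γ)) := by
            have : (2 : ℝ) ^ (-((k : ℝ) * γ)) = 2 ^ γ * 2 ^ (-((k + 1 : ℕ) * γ)) := by
              rw [← Real.rpow_add two_pos]; push_cast; ring_nf
            rw [this]; ring
        _ ≤ A ^ (1 - θ) * A ^ θ * 2 ^ (-((k + 1 : ℕ) * γ)) := by gcongr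
        _ = A * 2 ^ (-((k + 1 : ℕ) * γ)) := by
            rw [← Real.rpow_add' hA0 (by simp)]; simp
    · have hk' : ((k + 1 : ℕ) : ℝ) ≤ k₀ := by exact_mod_cast not_le.1 hk
      calc a (k + 1) ≤ max V 0 := (haV _).trans (le_max_left _ _)
        _ = max V 0 * (2 ^ (((k + 1 : ℕ) : ℝ) * γ) * 2 ^ (-((k + 1 : ℕ) * γ))) := by
            rw [← Real.rpow_add two_pos, add_neg_cancel, Real.rpow_zero, mul_one]
        _ ≤ max V 0 * (2 ^ (k₀ * γ) * 2 ^ (-((k + 1 : ℕ) * γ))) := by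
            gcongr
            exact one_le_two
        _ ≤ A * 2 ^ (-((k + 1 : ℕ) * γ)) := by
            rw [← mul_assoc]; gcongr; exact le_max_left _ _

lemma half_ball_subset {x₀ x : RN N} {δ τ : ℝ} (hx : x ∈ Metric.ball x₀ δ) (hτ : 0 < τ)
    (hτδ : τ ≤ δ) :
    ∃ z, Metric.ball z (τ / 2) ⊆ Metric.ball x₀ δ ∩ Metric.ball x τ := by
  have hδ : 0 < δ := hτ.trans_le hτδ
  have hx' : ‖x - x₀‖ < δ := by rw [← dist_eq_norm]; exact hx
  refine ⟨x + (τ / (2 * δ)) • (x₀ - x), fun y hy => ?_⟩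
  have hy' : ‖y - (x + (τ / (2 * δ)) • (x₀ - x))‖ < τ / 2 := by rw [← dist_eq_norm]; exact hy
  set c := τ / (2 * δ) with hc
  have hc0 : 0 < c := by positivity
  have hcδ : c * δ = τ / 2 := by rw [hc]; field_simp
  have hc1 : c ≤ 1 := by
    rw [hc, div_le_one (by positivity)]; linarith
  constructor
  · rw [Metric.mem_ball, dist_eq_norm]
    have h1 : y - x₀ = (y - (x + c • (x₀ - x))) + (1 - c) • (x - x₀) := by module
    rw [h1]
    refine (norm_add_le _ _).trans_lt ?_
    rw [norm_smul, Real.norm_eq_abs, abs_of_nonneg (by linarith)]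
    nlinarith [mul_le_mul_of_nonneg_left hx'.le (show 0 ≤ 1 - c by linarith)]
  · rw [Metric.mem_ball, dist_eq_norm]
    have h1 : y - x = (y - (x + c • (x₀ - x))) + c • (x₀ - x) := by module
    rw [h1]
    refine (norm_add_le _ _).trans_lt ?_
    rw [norm_smul, Real.norm_eq_abs, abs_of_nonneg hc0.le, norm_sub_rev x₀ x]
    nlinarith [mul_lt_mul_of_pos_left hx' hc0]

lemma volume_ball_eq (z : RN N) {τ : ℝ} (hτ : 0 < τ) :
    volume.real (Metric.ball z τ) = τ ^ N * volume.real (Metric.ball (0 : RN N) 1) := by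
  have := Measure.addHaar_ball_of_pos (volume : Measure (RN N)) z hτ
  rw [measureReal_def, this, ENNReal.toReal_mul, finrank_euclideanSpace_fin,
    ENNReal.toReal_ofReal (by positivity), measureReal_def]

/-- Decay of consecutive level sets inside a small ball. -/
lemma level_set_step (H : Exps s p s₀ s₁ p₀ p₁) {x₀ : RN N} {δ P σ : ℝ} (hδ1 : δ ≤ 1 / 2)
    (hP : ∀ x ∈ Metric.ball x₀ δ, ∀ y ∈ Metric.ball x₀ δ, P ≤ p x y)
    (hσ : ∀ x ∈ Metric.ball x₀ δ, ∀ y ∈ Metric.ball x₀ δ, σ ≤ s x y * p x y)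
    (hσ0 : 0 < σ) {u : RN N → ℝ} (hu : Adm Ω s p u) {τ a : ℝ} (hτ : 0 < τ) (hτδ : τ ≤ δ) (k : ℕ)
    (ha : volume.real (Metric.ball x₀ δ ∩ {x | (2 : ℝ) ^ k ≤ |u x|}) ≤ a)
    (haτ : 2 * a ≤ volume.real (Metric.ball (0 : RN N) (τ / 2))) :
    2 ^ (k * P) / τ ^ (N + σ) *
      (volume.real (Metric.ball x₀ δ ∩ {x | (2 : ℝ) ^ (k + 1) ≤ |u x|}) * a) ≤ rho s p u := by
  set B := Metric.ball x₀ δ with hB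
  set E := B ∩ {x | (2 : ℝ) ^ (k + 1) ≤ |u x|} with hE
  set L := 2 ^ (k * P) / τ ^ (N + σ) with hL
  have hBm : MeasurableSet B := Metric.isOpen_ball.measurableSet
  have hBfin : volume B ≠ ⊤ := measure_ball_lt_top.ne
  have hEm : MeasurableSet E := hBm.inter (measurableSet_le measurable_const hu.meas.abs)
  have hL0 : 0 ≤ L := by positivity
  set S : Set (RN N × RN N) := {z | z.1 ∈ E ∧ (z.2 ∈ B ∧ dist z.2 z.1 < τ) ∧ |u z.2| < 2 ^ k}
    with hS
  have hSm : MeasurableSet S := by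
    refine (hEm.preimage measurable_fst).inter (((hBm.preimage measurable_snd).inter
      (measurableSet_lt (measurable_snd.dist measurable_fst) measurable_const)).inter
      (measurableSet_lt (hu.meas.comp measurable_snd).abs measurable_const))
  have hSL : S ⊆ {z | L ≤ gden s p u z} := by
    rintro ⟨x, y⟩ ⟨⟨hx, hux⟩, ⟨hy, hyx⟩, huy⟩
    have hux' : (2 : ℝ) ^ (k + 1) ≤ |u x| := hux
    have huy' : |u y| < 2 ^ k := huy
    have hdiff : (2 : ℝ) ^ k ≤ |u x - u y| := by
      have := abs_sub_abs_le_abs_sub (u x) (u y)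
      rw [pow_succ] at hux'
      linarith
    have hne : x ≠ y := by
      rintro rfl
      simp only [sub_self, abs_zero] at hdiff
      linarith [pow_pos (two_pos (α := ℝ)) k]
    have hd : 0 < dist x y := dist_pos.2 hne
    have hdτ : dist x y < τ := by rw [dist_comm]; exact hyx
    have h1 : (2 : ℝ) ^ (k * P) ≤ |u x - u y| ^ p x y := by
      calc (2 : ℝ) ^ (k * P) ≤ 2 ^ (k * p x y) :=
            Real.rpow_le_rpow_of_exponent_le one_le_two
              (mul_le_mul_of_nonneg_left (hP x hx y hy) (Nat.cast_nonneg k))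
        _ = ((2 : ℝ) ^ k) ^ p x y := by rw [Real.rpow_mul zero_le_two, Real.rpow_natCast]
        _ ≤ _ := Real.rpow_le_rpow (by positivity) hdiff (H.p_pos x y).le
    have h2 : dist x y ^ ((N : ℝ) + s x y * p x y) ≤ τ ^ ((N : ℝ) + σ) := by
      calc dist x y ^ ((N : ℝ) + s x y * p x y) ≤ dist x y ^ ((N : ℝ) + σ) :=
            Real.rpow_le_rpow_of_exponent_ge hd (by linarith) (by linarith [hσ x hx y hy])
        _ ≤ _ := Real.rpow_le_rpow hd.le hdτ.le (by positivity)
    exact div_le_div₀ (by positivity) h1 (by positivity) h2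
  have hEfin : volume E ≠ ⊤ := measure_ne_top_of_subset inter_subset_left hBfin
  have hslice : ∀ x ∈ E, ENNReal.ofReal a ≤ volume (Prod.mk x ⁻¹' S) := by
    intro x hx
    obtain ⟨z, hz⟩ := half_ball_subset hx.1 hτ hτδ
    set W := B ∩ {x | (2 : ℝ) ^ k ≤ |u x|} with hW
    have hWfin : volume W ≠ ⊤ := measure_ne_top_of_subset inter_subset_left hBfin
    have hsub : Metric.ball z (τ / 2) ⊆ W ∪ Prod.mk x ⁻¹' S := by
      intro y hy
      by_cases hyk : (2 : ℝ) ^ k ≤ |u y|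
      · exact Or.inl ⟨(hz hy).1, hyk⟩
      · exact Or.inr ⟨hx, ⟨(hz hy).1, (hz hy).2⟩, not_le.1 hyk⟩
    have h1 : volume (Metric.ball z (τ / 2)) ≤ volume W + volume (Prod.mk x ⁻¹' S) :=
      (measure_mono hsub).trans (measure_union_le _ _)
    have h2 : ENNReal.ofReal (2 * a) ≤ volume (Metric.ball z (τ / 2)) := by
      refine ENNReal.ofReal_le_of_le_toReal ?_
      rw [← measureReal_def, volume_ball_eq z (by positivity),
        ← volume_ball_eq (0 : RN N) (by positivity)]
      exact haτ
    have h3 : volume W ≤ ENNReal.ofReal a := by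
      rw [← ENNReal.ofReal_toReal hWfin]; exact ENNReal.ofReal_le_ofReal ha
    have ha0 : 0 ≤ a := measureReal_nonneg.trans ha
    rw [two_mul, ENNReal.ofReal_add ha0 ha0] at h2
    have h4 := (h2.trans h1).trans (add_le_add_left h3 _)
    exact (ENNReal.add_le_add_iff_left ENNReal.ofReal_ne_top).1 h4
  have hvol : volume E * ENNReal.ofReal a ≤ volume S := by
    rw [Measure.volume_eq_prod, Measure.prod_apply hSm]
    calc volume E * ENNReal.ofReal a = ∫⁻ _ in E, ENNReal.ofReal a := by
          rw [setLIntegral_const, mul_comm]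
      _ ≤ ∫⁻ x in E, volume (Prod.mk x ⁻¹' S) := setLIntegral_mono' hEm hslice
      _ ≤ _ := setLIntegral_le_lintegral _ _
  have hLE : ENNReal.ofReal L * volume S ≤ ENNReal.ofReal (rho s p u) := by
    rw [rho, ofReal_integral_eq_lintegral_ofReal hu.int
      (Eventually.of_forall fun z => gden_nonneg z)]
    calc ENNReal.ofReal L * volume S = ∫⁻ _ in S, ENNReal.ofReal L := by rw [setLIntegral_const]
      _ ≤ ∫⁻ z in S, ENNReal.ofReal (gden s p u z) :=
          setLIntegral_mono' hSm fun z hz => ENNReal.ofReal_le_ofReal (hSL hz)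
      _ ≤ _ := setLIntegral_le_lintegral _ _
  have ha0 : 0 ≤ a := measureReal_nonneg.trans ha
  have hfinal : ENNReal.ofReal (L * (volume.real E * a)) ≤ ENNReal.ofReal (rho s p u) := by
    rw [ENNReal.ofReal_mul hL0, ENNReal.ofReal_mul measureReal_nonneg, measureReal_def,
      ENNReal.ofReal_toReal hEfin]
    exact (mul_le_mul_right hvol _).trans hLE
  exact (ENNReal.ofReal_le_ofReal_iff rho_nonneg).1 hfinal

end Embedding

section Embedding

variable {s p : RN N → RN N → ℝ} {s₀ s₁ p₀ p₁ : ℝ} {Ω : Set (RN N)}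

lemma lintegral_rpow_le_of_level_sets {B : Set (RN N)} (hBfin : volume B ≠ ⊤) {u : RN N → ℝ}
    (hu : Measurable u) {m γ A : ℝ} (hm : 0 ≤ m) (hγ : m < γ) (hA : 0 ≤ A)
    (h : ∀ k : ℕ, volume.real (B ∩ {x | (2 : ℝ) ^ k ≤ |u x|}) ≤ A * 2 ^ (-(k * γ))) :
    ∫⁻ x in B, ENNReal.ofReal (|u x| ^ m) ≤
      ENNReal.ofReal (volume.real B + 2 ^ m * A * (1 - 2 ^ (m - γ))⁻¹) := by
  set E : ℕ → Set (RN N) := fun k => {x | (2 : ℝ) ^ k ≤ |u x|} with hE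
  have hEm : ∀ k, MeasurableSet (E k) := fun k => measurableSet_le measurable_const hu.abs
  have hq0 : (0 : ℝ) ≤ 2 ^ (m - γ) := by positivity
  have hq1 : (2 : ℝ) ^ (m - γ) < 1 := Real.rpow_lt_one_of_one_lt_of_neg one_lt_two (by linarith)
  have hpt : ∀ x, ENNReal.ofReal (|u x| ^ m) ≤ 1 + ∑' k : ℕ,
      (E k).indicator (fun _ => ENNReal.ofReal (2 ^ (((k : ℝ) + 1) * m))) x := by
    intro x
    rcases le_total |u x| 1 with h1 | h1
    · refine le_add_right ?_
      rw [← ENNReal.ofReal_one]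
      exact ENNReal.ofReal_le_ofReal (Real.rpow_le_one (abs_nonneg _) h1 hm)
    · obtain ⟨k, hk1, hk2⟩ := exists_nat_pow_near h1 one_lt_two
      refine le_add_left (le_trans ?_ (ENNReal.le_tsum k))
      rw [indicator_of_mem (show x ∈ E k from hk1)]
      refine ENNReal.ofReal_le_ofReal ?_
      rw [Real.rpow_mul zero_le_two]
      refine Real.rpow_le_rpow (abs_nonneg _) ?_ hm
      exact_mod_cast hk2.le
  have hterm : ∀ k : ℕ, ENNReal.ofReal (2 ^ (((k : ℝ) + 1) * m)) * volume (B ∩ E k) ≤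
      ENNReal.ofReal (2 ^ m * A * (2 ^ (m - γ)) ^ k) := by
    intro k
    rw [← ENNReal.ofReal_toReal (measure_ne_top_of_subset inter_subset_left hBfin),
      ← ENNReal.ofReal_mul (by positivity)]
    refine ENNReal.ofReal_le_ofReal ?_
    calc (2 : ℝ) ^ (((k : ℝ) + 1) * m) * (volume (B ∩ E k)).toReal
        ≤ 2 ^ (((k : ℝ) + 1) * m) * (A * 2 ^ (-(k * γ))) :=
          mul_le_mul_of_nonneg_left (h k) (by positivity)
      _ = 2 ^ m * A * (2 ^ (m - γ)) ^ k := by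
          rw [← Real.rpow_natCast, ← Real.rpow_mul zero_le_two, mul_left_comm,
            ← Real.rpow_add two_pos, mul_right_comm, ← Real.rpow_add two_pos, mul_comm]
          ring_nf
  calc ∫⁻ x in B, ENNReal.ofReal (|u x| ^ m)
      ≤ ∫⁻ x in B, (1 + ∑' k : ℕ,
        (E k).indicator (fun _ => ENNReal.ofReal (2 ^ (((k : ℝ) + 1) * m))) x) :=
        lintegral_mono hpt
    _ = volume B + ∑' k : ℕ, ENNReal.ofReal (2 ^ (((k : ℝ) + 1) * m)) * volume (B ∩ E k) := by
        rw [lintegral_add_left measurable_const, lintegral_tsum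
          (fun k => (measurable_const.indicator (hEm k)).aemeasurable)]
        congr 1
        · simp
        · congr 1; funext k
          rw [lintegral_indicator (hEm k), setLIntegral_const, Measure.restrict_apply (hEm k),
            inter_comm]
    _ ≤ volume B + ∑' k : ℕ, ENNReal.ofReal (2 ^ m * A * (2 ^ (m - γ)) ^ k) := by
        gcongr with k
        exact hterm k
    _ = _ := by
        rw [← ENNReal.ofReal_tsum_of_nonneg (fun k => by positivity)
          ((summable_geometric_of_lt_one hq0 hq1).mul_left _), tsum_mul_left,
          tsum_geometric_of_lt_one hq0 hq1, ENNReal.ofReal_add measureReal_nonneg, measureReal_def,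
          ENNReal.ofReal_toReal hBfin]
        have : 0 < 1 - (2 : ℝ) ^ (m - γ) := by linarith
        positivity

/-- A local higher integrability bound in a small ball. -/
lemma exists_local_bound (H : Exps s p s₀ s₁ p₀ p₁) (hΩo : IsOpen Ω)
    (hΩb : Bornology.IsBounded Ω) {x₀ : RN N} {δ P σ m : ℝ} (hδ : 0 < δ) (hδ1 : δ ≤ 1 / 2)
    (hP : ∀ x ∈ Metric.ball x₀ δ, ∀ y ∈ Metric.ball x₀ δ, P ≤ p x y)
    (hσ : ∀ x ∈ Metric.ball x₀ δ, ∀ y ∈ Metric.ball x₀ δ, σ ≤ s x y * p x y)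
    (hσ0 : 0 < σ) (hσN : σ < N) (hm : 0 ≤ m) (hmP : m * (N - σ) < N * P) (K : ℝ) :
    ∃ C, ∀ u, Adm Ω s p u → rho s p u ≤ K →
      ∫⁻ x in Metric.ball x₀ δ, ENNReal.ofReal (|u x| ^ m) ≤ ENNReal.ofReal C := by
  obtain ⟨C₁, hC₁, hpoin⟩ := exists_poincare H hΩo hΩb
  have hN := H.N_pos
  have hNσ : 0 < N - σ := by linarith
  set B := Metric.ball x₀ δ with hB
  have hBfin : volume B ≠ ⊤ := measure_ball_lt_top.ne
  set ω := volume.real (Metric.ball (0 : RN N) 1) with hω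
  have hω0 : 0 < ω := by
    rw [hω, measureReal_def]
    exact ENNReal.toReal_pos (Metric.measure_ball_pos volume _ one_pos).ne' measure_ball_lt_top.ne
  set K' := max K 0 with hK'
  set C₂ := C₁ * (1 + K') with hC₂
  have hK0 : 0 ≤ K' := le_max_right _ _
  have hC₂0 : 0 ≤ C₂ := by positivity
  obtain ⟨k₀, hk₀⟩ : ∃ k₀ : ℕ, 2 * C₂ < ω * (δ / 2) ^ N * 2 ^ k₀ := by
    obtain ⟨k₀, h⟩ := pow_unbounded_of_one_lt (2 * C₂ / (ω * (δ / 2) ^ N)) (one_lt_two (α := ℝ))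
    exact ⟨k₀, by rwa [div_lt_iff₀' (by positivity)] at h⟩
  set c := (2 : ℝ) ^ ((N : ℝ) + σ) * (2 / ω) ^ (1 + σ / N) with hc
  set γ := N * P / (N - σ) with hγ
  have hmγ : m < γ := by rw [hγ, lt_div_iff₀ hNσ]; exact hmP
  have hθ : σ / N < 1 := (div_lt_one hN).2 hσN
  have hγθ : γ * (1 - σ / N) ≤ P := by
    apply le_of_eq; rw [hγ]; field_simp
  obtain ⟨A, hA0, hA⟩ := exists_geometric_bound (P := P) (θ := σ / N) (γ := γ) (C := K' * c)
    (V := volume.real B) (k₀ := k₀) (by positivity) hθ (by linarith) hγθ (by positivity)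
  refine ⟨volume.real B + 2 ^ m * A * (1 - 2 ^ (m - γ))⁻¹, fun u hu hρ => ?_⟩
  set a : ℕ → ℝ := fun k => volume.real (B ∩ {x | (2 : ℝ) ^ k ≤ |u x|}) with ha
  have ha0 : ∀ k, 0 ≤ a k := fun k => measureReal_nonneg
  have hmark : ∀ k, 2 ^ k * a k ≤ C₂ := by
    intro k
    have hsub : B ∩ {x | (2 : ℝ) ^ k ≤ |u x|} ⊆ Ω ∩ {x | (2 : ℝ) ^ k ≤ |u x| ^ p₀} := by
      rintro x ⟨-, hx⟩
      have hx' : (2 : ℝ) ^ k ≤ |u x| := hx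
      have h1 : (1 : ℝ) ≤ |u x| := (one_le_pow₀ one_le_two).trans hx'
      refine ⟨by_contra fun h => ?_, hx'.trans ?_⟩
      · rw [hu.zero x h, abs_zero] at h1; linarith
      · conv_lhs => rw [← Real.rpow_one |u x|]
        exact Real.rpow_le_rpow_of_exponent_le h1 H.p₀_gt.le
    have hΩfin : volume Ω ≠ ⊤ := hΩb.measure_lt_top.ne
    have h1 : a k ≤ (volume.restrict Ω).real {x | (2 : ℝ) ^ k ≤ |u x| ^ p₀} := by
      rw [measureReal_restrict_apply
        (measurableSet_le measurable_const (hu.meas.abs.pow_const _)), inter_comm]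
      exact measureReal_mono hsub (measure_ne_top_of_subset inter_subset_left hΩfin)
    have h2 := mul_meas_ge_le_integral_of_nonneg (μ := volume.restrict Ω)
      (f := fun x => |u x| ^ p₀) (Eventually.of_forall fun x => by positivity)
      (hpoin u hu).1 (2 ^ k)
    calc 2 ^ k * a k ≤ _ := mul_le_mul_of_nonneg_left h1 (by positivity)
      _ ≤ _ := h2
      _ ≤ _ := (hpoin u hu).2
      _ ≤ C₂ := by rw [hC₂]; gcongr; exact hρ.trans (le_max_left _ _)
  refine lintegral_rpow_le_of_level_sets hBfin hu.meas hm hmγ hA0 (hA a ha0 (fun k =>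
    measureReal_mono inter_subset_left hBfin) fun k hk => ?_)
  rcases (ha0 k).eq_or_lt with h0 | h0
  · have : a (k + 1) ≤ a k := by
      refine measureReal_mono (fun x hx => ⟨hx.1, ?_⟩)
        (measure_ne_top_of_subset inter_subset_left hBfin)
      have h2 : (2 : ℝ) ^ (k + 1) ≤ |u x| := hx.2
      exact (pow_le_pow_right₀ one_le_two (Nat.le_succ k)).trans h2
    rw [← h0] at this
    exact this.trans (by rw [← h0]; positivity)
  set τ := 2 * (2 * a k / ω) ^ (1 / (N : ℝ)) with hτ
  have hτ0 : 0 < τ := by positivity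
  have hpowN : (τ / 2) ^ N = 2 * a k / ω := by
    rw [hτ, mul_div_cancel_left₀ _ two_ne_zero, ← Real.rpow_natCast, ← Real.rpow_mul (by positivity),
      one_div, inv_mul_cancel₀ hN.ne', Real.rpow_one]
  have hτδ : τ ≤ δ := by
    have h1 : (τ / 2) ^ N ≤ (δ / 2) ^ N := by
      rw [hpowN, div_le_iff₀ hω0]
      have h2 : (2 : ℝ) ^ k₀ ≤ 2 ^ k := pow_le_pow_right₀ one_le_two hk
      have h3 := hmark k
      have h4 : 2 ^ k₀ * a k ≤ C₂ := (mul_le_mul_of_nonneg_right h2 (ha0 k)).trans h3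
      have h5 : (0 : ℝ) < 2 ^ k₀ := by positivity
      nlinarith
    have := le_of_pow_le_pow_left₀ (H.N_pos').ne' (by positivity) h1
    linarith
  have hstep := level_set_step H hδ1 hP hσ hσ0 hu hτ0 hτδ k (le_refl (a k)) (by
    rw [volume_ball_eq _ (by positivity), hpowN]; field_simp; rfl)
  have hτpow : τ ^ (N + σ) = c * a k * a k ^ (σ / N) := by
    rw [hτ, Real.mul_rpow zero_le_two (by positivity), ← Real.rpow_mul (by positivity)]
    have : 1 / (N : ℝ) * (N + σ) = 1 + σ / N := by field_simp
    rw [this, mul_div_right_comm, Real.mul_rpow (by positivity) (ha0 k), Real.rpow_add h0,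
      Real.rpow_one, hc]
    ring
  have h1 : 2 ^ (k * P) / τ ^ (N + σ) * (a (k + 1) * a k) ≤ K' :=
    hstep.trans (hρ.trans (le_max_left _ _))
  have h2 : (2 : ℝ) ^ (k * P) / τ ^ (N + σ) * (a (k + 1) * a k) =
      a (k + 1) / (c * 2 ^ (-(k * P)) * a k ^ (σ / N)) := by
    rw [hτpow, Real.rpow_neg zero_le_two]
    field_simp
  rw [h2, div_le_iff₀ (by positivity)] at h1
  linarith

end Embedding

section Embedding

variable {s p : RN N → RN N → ℝ} {s₀ s₁ p₀ p₁ : ℝ} {Ω : Set (RN N)}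

/-- The Sobolev embedding into variable exponent Lebesgue spaces, in modular form. -/
lemma exists_embedding (H : Exps s p s₀ s₁ p₀ p₁) (hΩo : IsOpen Ω)
    (hΩb : Bornology.IsBounded Ω) {m : RN N → ℝ} (hmc : Continuous m)
    (hm0 : ∀ x ∈ closure Ω, 0 < m x)
    (hmp : ∀ x ∈ closure Ω, m x * (N - s x x * p x x) < N * p x x) (K : ℝ) :
    ∃ C, 0 ≤ C ∧ ∀ u, Adm Ω s p u → rho s p u ≤ K →
      IntegrableOn (fun x => |u x| ^ m x) Ω ∧ ∫ x in Ω, |u x| ^ m x ≤ C := by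
  have hcomp : IsCompact (closure Ω) := hΩb.isCompact_closure
  have key : ∃ C, ∀ u, Adm Ω s p u → rho s p u ≤ K →
      ∫⁻ x in closure Ω, ENNReal.ofReal (|u x| ^ m x) ≤ ENNReal.ofReal C := by
    refine hcomp.induction_on (p := fun A => ∃ C, ∀ u, Adm Ω s p u → rho s p u ≤ K →
      ∫⁻ x in A, ENNReal.ofReal (|u x| ^ m x) ≤ ENNReal.ofReal C) ⟨0, by simp⟩ ?_ ?_ ?_
    · rintro A A' hA ⟨C, hC⟩
      exact ⟨C, fun u hu hρ => (lintegral_mono_set hA).trans (hC u hu hρ)⟩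
    · rintro A A' ⟨C, hC⟩ ⟨C', hC'⟩
      refine ⟨max C 0 + max C' 0, fun u hu hρ => (lintegral_union_le _ _ _).trans ?_⟩
      rw [ENNReal.ofReal_add (le_max_right _ _) (le_max_right _ _)]
      exact add_le_add ((hC u hu hρ).trans (ENNReal.ofReal_le_ofReal (le_max_left _ _)))
        ((hC' u hu hρ).trans (ENNReal.ofReal_le_ofReal (le_max_left _ _)))
    · intro x₀ hx₀
      have hcont : Continuous fun ε : ℝ =>
          (m x₀ + ε) * (N - (s x₀ x₀ * p x₀ x₀ - ε)) - N * (p x₀ x₀ - ε) := by fun_prop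
      have hev : ∀ᶠ ε : ℝ in 𝓝[>] 0,
          (m x₀ + ε) * (N - (s x₀ x₀ * p x₀ x₀ - ε)) - N * (p x₀ x₀ - ε) < 0 ∧
            ε < s x₀ x₀ * p x₀ x₀ ∧ 0 < ε := by
        refine Filter.Eventually.and ?_ (Filter.Eventually.and ?_ self_mem_nhdsWithin)
        · refine (hcont.tendsto 0).eventually_lt_const ?_ |>.filter_mono nhdsWithin_le_nhds
          have := hmp x₀ hx₀
          simp only [add_zero, sub_zero]; linarith
        · exact (eventually_lt_nhds (H.sp_pos x₀ x₀)).filter_mono nhdsWithin_le_nhds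
      obtain ⟨ε, hε1, hε2, hε0⟩ := hev.exists
      have hx₀' : Tendsto (fun z : RN N × RN N => p z.1 z.2) (𝓝 (x₀, x₀)) (𝓝 (p x₀ x₀)) :=
        H.contP.tendsto (x₀, x₀)
      have hs' : Tendsto (fun z : RN N × RN N => s z.1 z.2 * p z.1 z.2) (𝓝 (x₀, x₀))
          (𝓝 (s x₀ x₀ * p x₀ x₀)) := (H.contS.mul H.contP).tendsto (x₀, x₀)
      have hmε : ∀ᶠ x in 𝓝 x₀, m x < m x₀ + ε :=
        (hmc.tendsto x₀).eventually_lt_const (by linarith)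
      have hmε0 : ∀ᶠ x in 𝓝 x₀, 0 < m x :=
        (hmc.tendsto x₀).eventually_const_lt (hm0 x₀ hx₀)
      have h2 := (hx₀'.eventually_const_lt (show p x₀ x₀ - ε < p x₀ x₀ by linarith)).and
        (hs'.eventually_const_lt
          (show s x₀ x₀ * p x₀ x₀ - ε < s x₀ x₀ * p x₀ x₀ by linarith))
      obtain ⟨δ₁, hδ₁, hball₁⟩ := Metric.eventually_nhds_iff_ball.1 (hmε.and hmε0)
      obtain ⟨δ₂, hδ₂, hball₂⟩ := Metric.eventually_nhds_iff_ball.1 h2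
      set δ := min (min δ₁ δ₂) (1 / 2) with hδ
      have hδ0 : 0 < δ := by positivity
      have hδδ₂ : δ ≤ δ₂ := (min_le_left _ _).trans (min_le_right _ _)
      have hδδ₁ : δ ≤ δ₁ := (min_le_left _ _).trans (min_le_left _ _)
      have hpair : ∀ x ∈ Metric.ball x₀ δ, ∀ y ∈ Metric.ball x₀ δ,
          (x, y) ∈ Metric.ball (x₀, x₀) δ₂ := fun x hx y hy => by
        rw [← ball_prod_same]
        exact ⟨Metric.ball_subset_ball hδδ₂ hx, Metric.ball_subset_ball hδδ₂ hy⟩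
      have hm0' : 0 ≤ m x₀ + ε := by have := hm0 x₀ hx₀; linarith
      obtain ⟨C, hC⟩ := exists_local_bound H hΩo hΩb (x₀ := x₀) (δ := δ) (P := p x₀ x₀ - ε)
        (σ := s x₀ x₀ * p x₀ x₀ - ε) (m := m x₀ + ε) hδ0 (min_le_right _ _)
        (fun x hx y hy => (hball₂ _ (hpair x hx y hy)).1.le)
        (fun x hx y hy => (hball₂ _ (hpair x hx y hy)).2.le)
        (by linarith) (by linarith [H.sp_le x₀ x₀, H.sub]) hm0' (by linarith) K
      refine ⟨_, mem_nhdsWithin_of_mem_nhds (Metric.ball_mem_nhds x₀ hδ0),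
        volume.real (Metric.ball x₀ δ) + max C 0, fun u hu hρ => ?_⟩
      calc ∫⁻ x in Metric.ball x₀ δ, ENNReal.ofReal (|u x| ^ m x)
          ≤ ∫⁻ x in Metric.ball x₀ δ, (1 + ENNReal.ofReal (|u x| ^ (m x₀ + ε))) := by
            refine setLIntegral_mono' Metric.isOpen_ball.measurableSet fun x hx => ?_
            have hx1 := hball₁ x (Metric.ball_subset_ball hδδ₁ hx)
            rw [← ENNReal.ofReal_one, ← ENNReal.ofReal_add zero_le_one (by positivity)]
            exact ENNReal.ofReal_le_ofReal
              (rpow_le_one_add_rpow (abs_nonneg _) hx1.2.le hx1.1.le)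
        _ ≤ _ := by
            rw [lintegral_add_left measurable_const, ENNReal.ofReal_add measureReal_nonneg
              (le_max_right _ _), measureReal_def, ENNReal.ofReal_toReal measure_ball_lt_top.ne]
            refine add_le_add (by simp) ((hC u hu hρ).trans
              (ENNReal.ofReal_le_ofReal (le_max_left _ _)))
  obtain ⟨C, hC⟩ := key
  refine ⟨max C 0, le_max_right _ _, fun u hu hρ => ?_⟩
  have h1 : ∫⁻ x in Ω, ENNReal.ofReal (|u x| ^ m x) ≤ ENNReal.ofReal (max C 0) :=
    (lintegral_mono_set subset_closure).trans
      ((hC u hu hρ).trans (ENNReal.ofReal_le_ofReal (le_max_left _ _)))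
  have hnn : ∀ x, 0 ≤ |u x| ^ m x := fun x => by positivity
  have hmeas : Measurable fun x => |u x| ^ m x := hu.meas.abs.pow hmc.measurable
  have hint : IntegrableOn (fun x => |u x| ^ m x) Ω := by
    refine ⟨hmeas.aestronglyMeasurable, ?_⟩
    rw [hasFiniteIntegral_iff_ofReal (Eventually.of_forall hnn)]
    exact h1.trans_lt ENNReal.ofReal_lt_top
  refine ⟨hint, ?_⟩
  rw [← ofReal_integral_eq_lintegral_ofReal hint (Eventually.of_forall hnn)] at h1
  exact (ENNReal.ofReal_le_ofReal_iff (le_max_right _ _)).1 h1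

end Embedding

section Compactness

variable {s p : RN N → RN N → ℝ} {s₀ s₁ p₀ p₁ : ℝ} {Ω : Set (RN N)}

lemma abs_sub_le_add_gden (H : Exps s p s₀ s₁ p₀ p₁) (w : RN N → ℝ) {l d : ℝ} (hl : 0 < l)
    (hl1 : l ≤ 1) (hd1 : d ≤ 1) {x y : RN N} (hxy : dist x y ≤ d) :
    |w x - w y| ≤ l + l ^ (1 - p₁) * d ^ (N + s₀ * p₀) * gden s p w (x, y) := by
  have hg := gden_nonneg (s := s) (p := p) (u := w) (x, y)
  rcases eq_or_ne x y with rfl | hne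
  · have hd0 : 0 ≤ d := by simpa using hxy
    simp only [sub_self, abs_zero]; positivity
  have hd0 : 0 < dist x y := dist_pos.2 hne
  have hd0' : 0 < d := hd0.trans_le hxy
  rcases le_total |w x - w y| l with h | h
  · have : 0 ≤ l ^ (1 - p₁) * d ^ (N + s₀ * p₀) * gden s p w (x, y) := by positivity
    linarith
  have h1 : |w x - w y| ≤ l ^ (1 - p₁) * |w x - w y| ^ p x y := by
    have hp := H.p_gt x y
    have h0 : 0 < |w x - w y| := hl.trans_le h
    calc |w x - w y| = |w x - w y| ^ (1 - p x y) * |w x - w y| ^ p x y := by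
          rw [← Real.rpow_add h0]; simp
      _ ≤ l ^ (1 - p x y) * |w x - w y| ^ p x y := by
          gcongr ?_ * _
          exact Real.rpow_le_rpow_of_nonpos hl h (by linarith)
      _ ≤ _ := by
          gcongr ?_ * _
          exact Real.rpow_le_rpow_of_exponent_ge hl hl1 (by linarith [H.p_le x y])
  have h2 : |w x - w y| ^ p x y ≤ d ^ (N + s₀ * p₀) * gden s p w (x, y) := by
    unfold gden
    rw [← mul_div_assoc, le_div_iff₀ (by positivity), mul_comm]
    gcongr
    calc dist x y ^ ((N : ℝ) + s x y * p x y) ≤ d ^ ((N : ℝ) + s x y * p x y) :=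
          Real.rpow_le_rpow hd0.le hxy (by have := H.sp_pos x y; positivity)
      _ ≤ _ := Real.rpow_le_rpow_of_exponent_ge hd0' hd1 (by linarith [H.sp_ge x y])
  calc |w x - w y| ≤ l ^ (1 - p₁) * |w x - w y| ^ p x y := h1
    _ ≤ l ^ (1 - p₁) * (d ^ (N + s₀ * p₀) * gden s p w (x, y)) := by gcongr
    _ ≤ _ := by rw [mul_assoc]; linarith

/-- The `L¹` norm is controlled by finitely many local averages and the modular. -/
lemma lintegral_le_of_averages (H : Exps s p s₀ s₁ p₀ p₁) (hΩo : IsOpen Ω)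
    (hΩb : Bornology.IsBounded Ω) {w : RN N → ℝ} (hw : Adm Ω s p w) (hwi : Integrable w)
    {h l η : ℝ} (hh : 0 < h) (hh1 : 2 * h ≤ 1) (hl : 0 < l) (hl1 : l ≤ 1) (hη : 0 ≤ η)
    {t : Set (RN N)} (ht : Ω ⊆ ⋃ c ∈ t, Metric.ball c h)
    (hav : ∀ c ∈ t, |∫ y in Metric.ball c h, w y| ≤
      η * volume.real (Metric.ball (0 : RN N) h)) :
    ∫⁻ x, ‖w x‖ₑ ≤ ENNReal.ofReal (l * 2 ^ N * volume.real Ω +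
      l ^ (1 - p₁) * (2 * h) ^ (N + s₀ * p₀) / volume.real (Metric.ball (0 : RN N) h) *
        rho s p w + η * volume.real Ω) := by
  set V := volume.real (Metric.ball (0 : RN N) h) with hV
  set L := l ^ (1 - p₁) * (2 * h) ^ (N + s₀ * p₀) with hL
  have hL0 : 0 ≤ L := by positivity
  have hV0 : 0 < V := by
    rw [hV, measureReal_def]
    exact ENNReal.toReal_pos (Metric.measure_ball_pos volume _ hh).ne' measure_ball_lt_top.ne
  have hΩfin : volume Ω ≠ ⊤ := hΩb.measure_lt_top.ne
  have hball : ∀ (x : RN N) (τ : ℝ), volume (Metric.ball x τ) =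
      ENNReal.ofReal (volume.real (Metric.ball x τ)) := fun x τ => by
    rw [measureReal_def, ENNReal.ofReal_toReal measure_ball_lt_top.ne]
  have hVc : ∀ c : RN N, volume.real (Metric.ball c h) = V := fun c => by
    rw [hV, volume_ball_eq c hh, volume_ball_eq 0 hh]
  have hV2 : ∀ c : RN N, volume.real (Metric.ball c (2 * h)) = 2 ^ N * V := fun c => by
    rw [hV, volume_ball_eq c (by positivity), volume_ball_eq 0 hh, mul_pow, mul_assoc]
  have hgm := measurable_gden H hw.meas
  have hpt : ∀ x ∈ Ω, ENNReal.ofReal V * ‖w x‖ₑ ≤ ENNReal.ofReal (l * (2 ^ N * V)) +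
      ENNReal.ofReal L * (∫⁻ y, ENNReal.ofReal (gden s p w (x, y))) +
        ENNReal.ofReal (η * V) := by
    intro x hx
    obtain ⟨c, hc, hxc⟩ := mem_iUnion₂.1 (ht hx)
    set B := Metric.ball c h with hB
    have hsub : B ⊆ Metric.ball x (2 * h) := fun y hy => by
      have h1 : dist y c < h := hy
      have h2 : dist x c < h := hxc
      have := dist_triangle_right y x c
      rw [Metric.mem_ball]; linarith
    have hconst : IntegrableOn (fun _ => w x) B := integrableOn_const measure_ball_lt_top.ne
    have h1 : V * |w x| ≤ |∫ y in B, (w x - w y)| + η * V := by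
      have h2 : ∫ y in B, (w x - w y) = V * w x - ∫ y in B, w y := by
        rw [integral_sub hconst hwi.integrableOn,
          setIntegral_const, hVc, smul_eq_mul]
      have h3 : V * |w x| = |V * w x| := by rw [abs_mul, abs_of_pos hV0]
      have h4 := abs_sub_abs_le_abs_sub (V * w x) (∫ y in B, w y)
      have h5 := hav c hc
      rw [h2, h3]; linarith
    calc ENNReal.ofReal V * ‖w x‖ₑ = ENNReal.ofReal (V * |w x|) := by
          rw [ENNReal.ofReal_mul hV0.le, ← Real.norm_eq_abs, ofReal_norm]
      _ ≤ ENNReal.ofReal (|∫ y in B, (w x - w y)| + η * V) := ENNReal.ofReal_le_ofReal h1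
      _ = ‖∫ y in B, (w x - w y)‖ₑ + ENNReal.ofReal (η * V) := by
          rw [ENNReal.ofReal_add (abs_nonneg _) (by positivity), ← Real.norm_eq_abs, ofReal_norm]
      _ ≤ (∫⁻ y in B, ‖w x - w y‖ₑ) + ENNReal.ofReal (η * V) := by
          gcongr; exact enorm_integral_le_lintegral_enorm _
      _ ≤ (∫⁻ y in Metric.ball x (2 * h),
            (ENNReal.ofReal l + ENNReal.ofReal L * ENNReal.ofReal (gden s p w (x, y)))) +
            ENNReal.ofReal (η * V) := by
          gcongr ?_ + _
          refine (lintegral_mono_set hsub).trans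
            (setLIntegral_mono' Metric.isOpen_ball.measurableSet fun y hy => ?_)
          rw [← ENNReal.ofReal_mul hL0, ← ENNReal.ofReal_add hl.le
            (mul_nonneg hL0 (gden_nonneg _)), ← ofReal_norm, Real.norm_eq_abs]
          refine ENNReal.ofReal_le_ofReal (abs_sub_le_add_gden H w hl hl1 hh1 ?_)
          rw [dist_comm]; exact (Metric.mem_ball.1 hy).le
      _ ≤ _ := by
          gcongr ?_ + _
          rw [lintegral_add_left measurable_const, lintegral_const_mul _
            (show Measurable fun y => ENNReal.ofReal (gden s p w (x, y)) from
              (hgm.comp measurable_prodMk_left).ennreal_ofReal), setLIntegral_const, hball, hV2,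
            ← ENNReal.ofReal_mul hl.le]
          gcongr
          exact Measure.restrict_le_self
  have hint : ∫⁻ x in Ω, ENNReal.ofReal V * ‖w x‖ₑ ≤
      ENNReal.ofReal (V * (l * 2 ^ N * volume.real Ω + L / V * rho s p w +
        η * volume.real Ω)) := by
    have hgi : Measurable fun x => ∫⁻ y, ENNReal.ofReal (gden s p w (x, y)) :=
      hgm.ennreal_ofReal.lintegral_prod_right'
    have hΩr : volume Ω = ENNReal.ofReal (volume.real Ω) := by
      rw [measureReal_def, ENNReal.ofReal_toReal hΩfin]
    have hρ : ∫⁻ x, ∫⁻ y, ENNReal.ofReal (gden s p w (x, y)) = ENNReal.ofReal (rho s p w) := by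
      rw [rho, ofReal_integral_eq_lintegral_ofReal hw.int
        (Eventually.of_forall fun z => gden_nonneg z), Measure.volume_eq_prod,
        lintegral_prod _ hgm.ennreal_ofReal.aemeasurable]
    have hρ0 := rho_nonneg (s := s) (p := p) (u := w)
    calc ∫⁻ x in Ω, ENNReal.ofReal V * ‖w x‖ₑ
        ≤ ∫⁻ x in Ω, (ENNReal.ofReal (l * (2 ^ N * V)) +
          ENNReal.ofReal L * (∫⁻ y, ENNReal.ofReal (gden s p w (x, y))) +
            ENNReal.ofReal (η * V)) := setLIntegral_mono' hΩo.measurableSet hpt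
      _ ≤ ENNReal.ofReal (l * (2 ^ N * V)) * volume Ω +
            ENNReal.ofReal L * ENNReal.ofReal (rho s p w) + ENNReal.ofReal (η * V) * volume Ω := by
          rw [lintegral_add_right _ measurable_const, lintegral_add_left measurable_const,
            lintegral_const_mul _ hgi, setLIntegral_const, setLIntegral_const, ← hρ]
          gcongr
          exact Measure.restrict_le_self
      _ = _ := by
          rw [hΩr, ← ENNReal.ofReal_mul (by positivity), ← ENNReal.ofReal_mul (by positivity),
            ← ENNReal.ofReal_mul (by positivity), ← ENNReal.ofReal_add (by positivity)
            (by positivity), ← ENNReal.ofReal_add (by positivity) (by positivity)]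
          congr 1
          field_simp
  have hrestr : ∫⁻ x, ‖w x‖ₑ = ∫⁻ x in Ω, ‖w x‖ₑ := by
    rw [setLIntegral_eq_of_support_subset]
    intro x hx
    by_contra h
    exact hx (by simp [hw.zero x h])
  rw [lintegral_const_mul _ hw.meas.enorm, ENNReal.ofReal_mul hV0.le] at hint
  rw [hrestr]
  exact (ENNReal.mul_le_mul_iff_right (by simpa using hV0) ENNReal.ofReal_ne_top).1 hint

end Compactness

section Compactness

variable {s p : RN N → RN N → ℝ} {s₀ s₁ p₀ p₁ : ℝ} {Ω : Set (RN N)}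

lemma exists_integral_abs_bound (H : Exps s p s₀ s₁ p₀ p₁) (hΩo : IsOpen Ω)
    (hΩb : Bornology.IsBounded Ω) :
    ∃ C, 0 ≤ C ∧ ∀ u, Adm Ω s p u → Integrable u ∧ ∫ x, |u x| ≤ C * (1 + rho s p u) := by
  obtain ⟨C, hC0, hC⟩ := exists_poincare H hΩo hΩb
  have hfin : volume Ω ≠ ⊤ := hΩb.measure_lt_top.ne
  refine ⟨volume.real Ω + C, by positivity, fun u hu => ?_⟩
  obtain ⟨hi, hle⟩ := hC u hu
  have hle1 : ∀ x, |u x| ≤ 1 + |u x| ^ p₀ := fun x => by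
    simpa using rpow_le_one_add_rpow (abs_nonneg (u x)) zero_le_one H.p₀_gt.le
  have hone : IntegrableOn (fun _ : RN N => (1 : ℝ)) Ω := integrableOn_const hfin
  have hsum : IntegrableOn (fun x => 1 + |u x| ^ p₀) Ω := hone.add hi
  have hon : IntegrableOn u Ω := hsum.mono' hu.meas.aestronglyMeasurable
    (Eventually.of_forall hle1)
  refine ⟨(integrableOn_iff_integrable_of_support_subset fun x hx => by
    by_contra h; exact hx (hu.zero x h)).1 hon, ?_⟩
  have h1 : ∫ x, |u x| = ∫ x in Ω, |u x| :=
    (setIntegral_eq_integral_of_forall_compl_eq_zero fun x hx => by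
      simp [hu.zero x hx]).symm
  have h2 : ∫ x in Ω, |u x| ≤ volume.real Ω + ∫ x in Ω, |u x| ^ p₀ := by
    refine (integral_mono hon.abs hsum hle1).trans (le_of_eq ?_)
    rw [integral_add hone hi]; simp [measureReal_def]
  have h3 := rho_nonneg (s := s) (p := p) (u := u)
  have h4 : 0 ≤ volume.real Ω := measureReal_nonneg
  rw [h1]
  nlinarith [mul_nonneg h4 h3]

/-- Functions with bounded modular form a totally bounded subset of `L¹`. -/
lemma totallyBounded_sublevel (H : Exps s p s₀ s₁ p₀ p₁) (hΩo : IsOpen Ω)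
    (hΩb : Bornology.IsBounded Ω) (R : ℝ) :
    TotallyBounded {g : Lp ℝ 1 (volume : Measure (RN N)) |
      ∃ u, (Adm Ω s p u ∧ rho s p u ≤ R) ∧ g =ᵐ[volume] u} := by
  obtain ⟨C, hC0, hC⟩ := exists_integral_abs_bound H hΩo hΩb
  refine Metric.totallyBounded_of_finite_discretization fun ε hε => ?_
  set ω := volume.real (Metric.ball (0 : RN N) 1) with hω
  have hω0 : 0 < ω := by
    rw [hω, measureReal_def]
    exact ENNReal.toReal_pos (Metric.measure_ball_pos volume _ one_pos).ne' measure_ball_lt_top.ne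
  have hΩ0 : 0 ≤ volume.real Ω := measureReal_nonneg
  set R' := 2 ^ p₁ * (max R 0 + max R 0) with hR'
  have hR0 : 0 ≤ R' := by positivity
  set l := min 1 (ε / (4 * (2 ^ N * volume.real Ω + 1))) with hl
  have hl0 : 0 < l := by positivity
  have hl4 : l * 2 ^ N * volume.real Ω ≤ ε / 4 := by
    have h1 : l ≤ ε / (4 * (2 ^ N * volume.real Ω + 1)) := min_le_right _ _
    rw [le_div_iff₀ (by positivity)] at h1
    nlinarith
  set σ := s₀ * p₀ with hσ
  have hσ0 : 0 < σ := mul_pos H.s₀_pos (by linarith [H.p₀_gt])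
  have hlim : Tendsto (fun h : ℝ => l ^ (1 - p₁) * 2 ^ (N + σ) / ω * R' * h ^ σ) (𝓝[>] 0)
      (𝓝 0) := by
    have h1 : Tendsto (fun h : ℝ => h ^ σ) (𝓝 0) (𝓝 0) := by
      have := (Real.continuous_rpow_const hσ0.le).tendsto 0
      rwa [Real.zero_rpow hσ0.ne'] at this
    have := (h1.const_mul (l ^ (1 - p₁) * 2 ^ (N + σ) / ω * R')).mono_left
      (nhdsWithin_le_nhds (s := Ioi 0))
    rwa [mul_zero] at this
  obtain ⟨h, hh4, hh2, hh0⟩ : ∃ h : ℝ, l ^ (1 - p₁) * 2 ^ (N + σ) / ω * R' * h ^ σ < ε / 4 ∧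
      h < 1 / 2 ∧ 0 < h :=
    ((hlim.eventually_lt_const (show 0 < ε / 4 by linarith)).and
      (((eventually_lt_nhds (show (0 : ℝ) < 1 / 2 by norm_num)).filter_mono
        nhdsWithin_le_nhds).and self_mem_nhdsWithin)).exists
  set V := volume.real (Metric.ball (0 : RN N) h) with hV
  have hVω : V = h ^ N * ω := volume_ball_eq 0 hh0
  have hV0 : 0 < V := by rw [hVω]; positivity
  have hmid : l ^ (1 - p₁) * (2 * h) ^ (N + σ) / V * R' ≤ ε / 4 := by
    refine le_trans (le_of_eq ?_) hh4.le
    rw [hVω, Real.mul_rpow zero_le_two hh0.le, Real.rpow_add hh0, Real.rpow_natCast]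
    field_simp
  set η := ε / (4 * (volume.real Ω + 1)) with hη
  have hη0 : 0 < η := by positivity
  have hη4 : η * volume.real Ω ≤ ε / 4 := by
    have h1 : η * (4 * (volume.real Ω + 1)) = ε := by rw [hη]; field_simp
    nlinarith
  obtain ⟨t, htfin, ht⟩ := Metric.totallyBounded_iff.1
    (hΩb.isCompact_closure.totallyBounded.subset subset_closure) h hh0
  have : Finite t := htfin
  have : Fintype t := Fintype.ofFinite t
  obtain ⟨m, hm⟩ := exists_nat_gt (C * (1 + R) / (η * V) + 1)
  have hfloor : ∀ u, Adm Ω s p u → rho s p u ≤ R → ∀ c : RN N,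
      ⌊(∫ y in Metric.ball c h, u y) / (η * V)⌋ ∈ Finset.Icc (-(m : ℤ)) m := by
    intro u hu hρ c
    have h1 : |∫ y in Metric.ball c h, u y| ≤ C * (1 + R) :=
      calc |∫ y in Metric.ball c h, u y| ≤ ∫ y in Metric.ball c h, |u y| :=
            abs_integral_le_integral_abs
        _ ≤ ∫ y, |u y| := setIntegral_le_integral (hC u hu).1.abs
            (Eventually.of_forall fun x => abs_nonneg _)
        _ ≤ C * (1 + rho s p u) := (hC u hu).2
        _ ≤ _ := by gcongr
    have h2 : |(∫ y in Metric.ball c h, u y) / (η * V)| ≤ C * (1 + R) / (η * V) := by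
      rw [abs_div, abs_of_pos (show 0 < η * V by positivity)]; gcongr
    have h3 := abs_le.1 h2
    rw [Finset.mem_Icc]
    constructor
    · rw [Int.le_floor]; push_cast; linarith
    · have := Int.floor_le ((∫ y in Metric.ball c h, u y) / (η * V))
      have h5 : ((⌊(∫ y in Metric.ball c h, u y) / (η * V)⌋ : ℤ) : ℝ) ≤ ((m : ℤ) : ℝ) := by
        push_cast; linarith
      exact_mod_cast h5
  refine ⟨t → Finset.Icc (-(m : ℤ)) m, inferInstance, fun g c =>
    ⟨_, hfloor g.2.choose g.2.choose_spec.1.1 g.2.choose_spec.1.2 c⟩, fun g g' hgg => ?_⟩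
  obtain ⟨⟨hu, hρu⟩, hgu⟩ := g.2.choose_spec
  obtain ⟨⟨hv, hρv⟩, hgv⟩ := g'.2.choose_spec
  set u := g.2.choose
  set v := g'.2.choose
  have hui := (hC u hu).1
  have hvi := (hC v hv).1
  have hdist : edist (g : Lp ℝ 1 (volume : Measure (RN N))) g' = ∫⁻ x, ‖(u - v) x‖ₑ := by
    rw [Lp.edist_def, eLpNorm_one_eq_lintegral_enorm]
    refine lintegral_congr_ae ?_
    filter_upwards [hgu, hgv] with x hx hx'
    simp only [Pi.sub_apply, hx, hx']
  have hmain := lintegral_le_of_averages H hΩo hΩb (hu.sub H hv) (hui.sub hvi) hh0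
    (by linarith) hl0 (min_le_left _ _) hη0.le (t := t) (by simpa using ht) (fun c hc => by
      have h1 := congrArg Subtype.val (congrFun hgg ⟨c, hc⟩)
      have h2 := Int.abs_sub_lt_one_of_floor_eq_floor h1
      rw [← sub_div, abs_div, abs_of_pos (show 0 < η * V by positivity),
        div_lt_one (by positivity)] at h2
      simp only [Pi.sub_apply]
      rw [integral_sub hui.integrableOn hvi.integrableOn]
      exact h2.le)
  have hρ : rho s p (u - v) ≤ R' := by
    refine (rho_sub_le H hu hv).trans ?_
    rw [hR']
    gcongr
    · exact hρu.trans (le_max_left _ _)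
    · exact hρv.trans (le_max_left _ _)
  have hfin : edist (g : Lp ℝ 1 (volume : Measure (RN N))) g' ≤ ENNReal.ofReal (3 * (ε / 4)) := by
    rw [hdist]
    refine hmain.trans (ENNReal.ofReal_le_ofReal ?_)
    have : l ^ (1 - p₁) * (2 * h) ^ (N + σ) / V * rho s p (u - v) ≤ ε / 4 := by
      refine le_trans ?_ hmid
      gcongr
    linarith
  rw [edist_dist, ENNReal.ofReal_le_ofReal_iff (by positivity)] at hfin
  exact hfin.trans_lt (by linarith)

lemma Adm.of_tendsto (H : Exps s p s₀ s₁ p₀ p₁) {u : ℕ → RN N → ℝ} {v : RN N → ℝ} {R : ℝ}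
    (hu : ∀ n, Adm Ω s p (u n)) (hρ : ∀ n, rho s p (u n) ≤ R) (hv : Measurable v)
    (hv0 : ∀ x, x ∉ Ω → v x = 0)
    (hl : ∀ᵐ x, Tendsto (fun n => u n x) atTop (𝓝 (v x))) :
    Adm Ω s p v ∧ rho s p v ≤ R := by
  have h1 : ∀ᵐ z : RN N × RN N, Tendsto (fun n => u n z.1) atTop (𝓝 (v z.1)) :=
    Measure.quasiMeasurePreserving_fst.ae hl
  have h2 : ∀ᵐ z : RN N × RN N, Tendsto (fun n => u n z.2) atTop (𝓝 (v z.2)) :=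
    Measure.quasiMeasurePreserving_snd.ae hl
  have := integrable_and_integral_le_of_fatou (fun n => (hu n).int)
    (fun n z => gden_nonneg z) (Eventually.of_forall hρ) (h' := gden s p v) (by
      filter_upwards [h1, h2] with z hz1 hz2
      exact ((hz1.sub hz2).abs.rpow_const (Or.inr (H.p_pos _ _).le)).div_const _)
  exact ⟨⟨hv, hv0, this.1⟩, this.2⟩

/-- Compactness: a net with bounded modular has a cluster point for almost everywhere
convergence along sequences. -/
lemma exists_cluster (H : Exps s p s₀ s₁ p₀ p₁) (hΩo : IsOpen Ω)
    (hΩb : Bornology.IsBounded Ω) {ι : Type*} [Preorder ι] [IsDirectedOrder ι] [Nonempty ι]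
    {u : ι → RN N → ℝ} {R : ℝ} (hu : ∀ i, Adm Ω s p (u i)) (hρ : ∀ i, rho s p (u i) ≤ R) :
    ∃ v, Adm Ω s p v ∧ rho s p v ≤ R ∧ ∀ i₀ : ℕ → ι, Monotone i₀ →
      ∃ j : ℕ → ι, (∀ n, i₀ n ≤ j n) ∧
        ∀ᵐ x, Tendsto (fun n => u (j n) x) atTop (𝓝 (v x)) := by
  obtain ⟨C, hC0, hC⟩ := exists_integral_abs_bound H hΩo hΩb
  have hi : ∀ i, Integrable (u i) := fun i => (hC _ (hu i)).1
  set A : Set (Lp ℝ 1 (volume : Measure (RN N))) :=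
    {g | ∃ u, (Adm Ω s p u ∧ rho s p u ≤ R) ∧ g =ᵐ[volume] u} with hA
  have hcpt : IsCompact (closure A) :=
    isCompact_iff_totallyBounded_isComplete.2 ⟨(totallyBounded_sublevel H hΩo hΩb R).closure,
      isClosed_closure.isComplete⟩
  set U : ι → Lp ℝ 1 (volume : Measure (RN N)) := fun i => (hi i).toL1 (u i) with hU
  obtain ⟨g, -, hg⟩ := hcpt.exists_mapClusterPt (f := (atTop : Filter ι)) (u := U) (by
    rw [le_principal_iff]
    exact mem_map.2 (Eventually.of_forall fun i => subset_closure
      ⟨u i, ⟨hu i, hρ i⟩, (hi i).coeFn_toL1⟩))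
  rw [mapClusterPt_iff_frequently] at hg
  set v : RN N → ℝ := Ω.indicator g with hv
  have hseq : ∀ i₀ : ℕ → ι, Monotone i₀ → ∃ j : ℕ → ι, (∀ n, i₀ n ≤ j n) ∧
      ∀ᵐ x, Tendsto (fun n => u (j n) x) atTop (𝓝 (v x)) := by
    intro i₀ hi₀
    have h1 : ∀ n : ℕ, ∃ b, i₀ n ≤ b ∧ U b ∈ Metric.ball g (1 / ((n : ℝ) + 1)) := fun n =>
      frequently_atTop.1 (hg _ (Metric.ball_mem_nhds g (by positivity))) (i₀ n)
    choose b hb hbd using h1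
    have h2 : Tendsto (fun n => U (b n)) atTop (𝓝 g) := by
      rw [tendsto_iff_dist_tendsto_zero]
      exact squeeze_zero (fun _ => dist_nonneg) (fun n => (Metric.mem_ball.1 (hbd n)).le)
        tendsto_one_div_add_atTop_nhds_zero_nat
    obtain ⟨ns, hns, hae⟩ := (tendstoInMeasure_of_tendsto_Lp h2).exists_seq_tendsto_ae
    refine ⟨fun n => b (ns n), fun n => (hi₀ (hns.id_le n)).trans (hb _), ?_⟩
    have h3 : ∀ᵐ x, ∀ n, (U (b (ns n))) x = u (b (ns n)) x :=
      ae_all_iff.2 fun n => (hi _).coeFn_toL1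
    filter_upwards [hae, h3] with x hx hx3
    by_cases hxΩ : x ∈ Ω
    · rw [hv, indicator_of_mem hxΩ]
      simpa only [hx3] using hx
    · rw [hv, indicator_of_notMem hxΩ]
      simp only [(hu _).zero x hxΩ]
      exact tendsto_const_nhds
  have hvm : Measurable v := (Lp.stronglyMeasurable g).measurable.indicator hΩo.measurableSet
  obtain ⟨j, -, hj⟩ := hseq (fun _ => Classical.arbitrary ι) monotone_const
  obtain ⟨hv1, hv2⟩ := Adm.of_tendsto H (fun n => hu (j n)) (fun n => hρ (j n)) hvm
    (fun x hx => indicator_of_notMem hx _) hj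
  exact ⟨v, hv1, hv2, hseq⟩

end Compactness

/-- The data of the Choquard problem together with the numerical constants used to treat it. -/
structure Problem (N : ℕ) where
  Ω : Set (RN N)
  isOpen : IsOpen Ω
  bdd : Bornology.IsBounded Ω
  nonempty : Ω.Nonempty
  (s p μ : RN N → RN N → ℝ)
  (s₀ s₁ p₀ p₁ : ℝ)
  H : Exps s p s₀ s₁ p₀ p₁
  μ₁ : ℝ
  contμ : Continuous fun z : RN N × RN N => μ z.1 z.2
  symmμ : ∀ x y, μ x y = μ y x
  μ_pos : ∀ x y, 0 < μ x y
  μ_le : ∀ x y, μ x y ≤ μ₁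
  f : RN N → ℝ → ℝ
  car : Caratheodory f
  M : ℝ
  M_pos : 0 < M
  r : RN N → ℝ
  contr : Continuous r
  (r₀ r₁ : ℝ)
  r₀_gt : p₁ < r₀
  r_ge : ∀ x, r₀ ≤ r x
  r_le : ∀ x, r x ≤ r₁
  growth : ∀ x ∈ Ω, ∀ τ : ℝ, |f x τ| ≤ M * |τ| ^ (r x - 1)
  Θ : ℝ
  Θ_gt : p₁ < Θ
  ar : F2 Ω f Θ
  (t e : ℝ)
  t_gt : 1 < t
  t_le : t ≤ 2
  e_gt : 1 < e
  kernel_sub : e * (t / (2 * t - 2)) * μ₁ < N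
  growth_sub : ∀ x ∈ closure Ω, e * t * r x * (N - s x x * p x x) < N * p x x
  α : RN N → ℝ
  measα : Measurable α
  (a₁ a₂ : ℝ)
  a₁_gt : 1 < a₁
  α_ge : ∀ x, a₁ ≤ α x
  α_le : ∀ x, α x ≤ a₂
  a₂_lt : a₂ < p₀

lemma Caratheodory.continuous_Fant {f : RN N → ℝ → ℝ} (hf : Caratheodory f) (x : RN N) :
    Continuous (Fant f x) :=
  continuous_iff_continuousAt.2 fun τ =>
    ((hf.2 x).integral_hasStrictDerivAt 0 τ).hasDerivAt.continuousAt

lemma Caratheodory.hasDerivAt_Fant {f : RN N → ℝ → ℝ} (hf : Caratheodory f) (x : RN N) (τ : ℝ) :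
    HasDerivAt (Fant f x) (f x τ) τ :=
  ((hf.2 x).integral_hasStrictDerivAt 0 τ).hasDerivAt

lemma Caratheodory.measurable_comp {f : RN N → ℝ → ℝ} (hf : Caratheodory f) {u : RN N → ℝ}
    (hu : Measurable u) : Measurable fun x => f x (u x) := by
  have : Measurable (Function.uncurry fun (τ : ℝ) (x : RN N) => f x τ) :=
    measurable_uncurry_of_continuous_of_measurable (u := fun τ x => f x τ) hf.2 hf.1
  exact this.comp (hu.prodMk measurable_id)

lemma Caratheodory.measurable_Fant_comp {f : RN N → ℝ → ℝ} (hf : Caratheodory f)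
    {u : RN N → ℝ} (hu : Measurable u) : Measurable fun x => Fant f x (u x) := by
  have hjoint : Measurable (Function.uncurry fun (τ : ℝ) (x : RN N) => f x τ) :=
    measurable_uncurry_of_continuous_of_measurable (u := fun τ x => f x τ) hf.2 hf.1
  have hswap : StronglyMeasurable (Function.uncurry f) :=
    (hjoint.comp measurable_swap).stronglyMeasurable
  have hF : ∀ τ, Measurable fun x => Fant f x τ := fun τ => by
    unfold Fant
    simp only [intervalIntegral]
    exact (hswap.integral_prod_right (ν := volume.restrict (Ioc 0 τ))).measurable.sub
      (hswap.integral_prod_right (ν := volume.restrict (Ioc τ 0))).measurable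
  have : Measurable (Function.uncurry fun (τ : ℝ) (x : RN N) => Fant f x τ) :=
    measurable_uncurry_of_continuous_of_measurable (u := fun τ x => Fant f x τ)
      hf.continuous_Fant hF
  exact this.comp (hu.prodMk measurable_id)

lemma mul_mul_le_of_young {G₁ G₂ k t : ℝ} (h₁ : 0 ≤ G₁) (h₂ : 0 ≤ G₂) (hk : 0 ≤ k) (ht : 1 < t)
    (ht2 : t ≤ 2) :
    G₁ * G₂ * k ≤ G₁ ^ t * G₂ ^ t + G₁ ^ t * k ^ (t / (2 * t - 2)) +
      G₂ ^ t * k ^ (t / (2 * t - 2)) := by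
  set a := t / (2 * t - 2) with ha
  have ht0 : 0 < t := by linarith
  have ht1 : t - 1 ≠ 0 := by linarith
  have hw1 : 0 ≤ 2 / t - 1 := by
    rw [sub_nonneg, le_div_iff₀ ht0]; linarith
  have hw2 : 0 ≤ 1 - 1 / t := by
    rw [sub_nonneg, div_le_iff₀ ht0]; linarith
  have hw1' : 2 / t - 1 ≤ 1 := by
    rw [sub_le_iff_le_add, div_le_iff₀ ht0]; linarith
  have hw2' : 1 - 1 / t ≤ 1 := by
    have : 0 < 1 / t := by positivity
    linarith
  have hX : 0 ≤ G₁ ^ t * G₂ ^ t := by positivity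
  have hY : 0 ≤ G₁ ^ t * k ^ a := by positivity
  have hZ : 0 ≤ G₂ ^ t * k ^ a := by positivity
  have h := Real.geom_mean_le_arith_mean3_weighted hw1 hw2 hw2 hX hY hZ (by ring)
  have e1 : t * (2 / t - 1) + t * (1 - 1 / t) = 1 := by field_simp; ring
  have e2 : a * (1 - 1 / t) + a * (1 - 1 / t) = 1 := by
    rw [ha]
    have : 2 * t - 2 ≠ 0 := by intro h; apply ht1; linarith
    field_simp; ring
  have hid : (G₁ ^ t * G₂ ^ t) ^ (2 / t - 1) * (G₁ ^ t * k ^ a) ^ (1 - 1 / t) *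
      (G₂ ^ t * k ^ a) ^ (1 - 1 / t) = G₁ * G₂ * k := by
    have hp : ∀ (g b c d : ℝ), 0 ≤ g → b * c + b * d = 1 → (g ^ b) ^ c * (g ^ b) ^ d = g := by
      intro g b c d hg hbc
      rw [← Real.rpow_mul hg, ← Real.rpow_mul hg, ← Real.rpow_add' hg (by rw [hbc]; norm_num),
        hbc, Real.rpow_one]
    rw [Real.mul_rpow (by positivity) (by positivity), Real.mul_rpow (by positivity) (by positivity),
      Real.mul_rpow (by positivity) (by positivity)]
    calc _ = ((G₁ ^ t) ^ (2 / t - 1) * (G₁ ^ t) ^ (1 - 1 / t)) *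
          ((G₂ ^ t) ^ (2 / t - 1) * (G₂ ^ t) ^ (1 - 1 / t)) *
          ((k ^ a) ^ (1 - 1 / t) * (k ^ a) ^ (1 - 1 / t)) := by ring
      _ = _ := by rw [hp _ _ _ _ h₁ e1, hp _ _ _ _ h₂ e1, hp _ _ _ _ hk e2]
  rw [hid] at h
  refine h.trans ?_
  exact add_le_add (add_le_add (mul_le_of_le_one_left hX hw1') (mul_le_of_le_one_left hY hw2'))
    (mul_le_of_le_one_left hZ hw2')

namespace Problem

variable (D : Problem N)

lemma r_pos (x : RN N) : 1 < D.r x := by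
  linarith [D.r_ge x, D.r₀_gt, D.H.p₀_le, D.H.p₀_gt]

lemma volume_ne_top : volume D.Ω ≠ ⊤ := D.bdd.measure_lt_top.ne

lemma measurableSet : MeasurableSet D.Ω := D.isOpen.measurableSet

lemma abs_Fant_le {x : RN N} (hx : x ∈ D.Ω) (τ : ℝ) : |Fant D.f x τ| ≤ D.M * |τ| ^ D.r x := by
  have hr := D.r_pos x
  have h := intervalIntegral.norm_integral_le_of_norm_le_const (a := 0) (b := τ)
    (f := fun σ => D.f x σ) (C := D.M * |τ| ^ (D.r x - 1)) (by
      intro σ hσ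
      refine (D.growth x hx σ).trans ?_
      have hle : |σ| ≤ |τ| := by
        have := abs_sub_left_of_mem_uIcc (uIoc_subset_uIcc hσ)
        simpa using this
      exact mul_le_mul_of_nonneg_left (Real.rpow_le_rpow (abs_nonneg _) hle (by linarith))
        D.M_pos.le)
  rw [sub_zero, mul_assoc] at h
  refine h.trans (le_of_eq ?_)
  congr 1
  rw [← Real.rpow_add_one' (abs_nonneg _) (by linarith)]
  simp

lemma abs_Fant_le_of_le {x : RN N} (hx : x ∈ D.Ω) {τ g : ℝ} (hg : |τ| ≤ g) :
    |Fant D.f x τ| ≤ D.M * g ^ D.r x :=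
  (D.abs_Fant_le hx τ).trans (mul_le_mul_of_nonneg_left
    (Real.rpow_le_rpow (abs_nonneg _) hg (by linarith [D.r_pos x])) D.M_pos.le)

lemma abs_f_mul_le {x : RN N} (hx : x ∈ D.Ω) {τ b g : ℝ} (hg : |τ| ≤ g) (hb : |b| ≤ g) :
    |D.f x τ * b| ≤ D.M * g ^ D.r x := by
  have hg0 : 0 ≤ g := (abs_nonneg _).trans hg
  have hr := D.r_pos x
  rw [abs_mul]
  calc |D.f x τ| * |b| ≤ D.M * g ^ (D.r x - 1) * g := by
        refine mul_le_mul ((D.growth x hx τ).trans ?_) hb (abs_nonneg _)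
          (mul_nonneg D.M_pos.le (by positivity))
        exact mul_le_mul_of_nonneg_left (Real.rpow_le_rpow (abs_nonneg _) hg (by linarith))
          D.M_pos.le
    _ = D.M * g ^ D.r x := by
        rw [mul_assoc, ← Real.rpow_add_one' hg0 (by linarith)]; simp

/-- The product measure on `Ω × Ω`. -/
def ν : Measure (RN N × RN N) := (volume.restrict D.Ω).prod (volume.restrict D.Ω)

instance : IsFiniteMeasure (volume.restrict D.Ω) :=
  ⟨by rw [Measure.restrict_apply_univ]; exact D.bdd.measure_lt_top⟩

instance : IsFiniteMeasure D.ν := by unfold ν; infer_instance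

lemma ae_ν {P : RN N × RN N → Prop} (h : ∀ x ∈ D.Ω, ∀ y ∈ D.Ω, P (x, y)) : ∀ᵐ z ∂D.ν, P z := by
  rw [ν, Measure.prod_restrict]
  exact (ae_restrict_iff' (D.measurableSet.prod D.measurableSet)).2
    (Eventually.of_forall fun z hz => h z.1 hz.1 z.2 hz.2)

lemma ae_ν_fst {P : RN N → Prop} (h : ∀ᵐ x ∂(volume.restrict D.Ω), P x) : ∀ᵐ z ∂D.ν, P z.1 :=
  Measure.quasiMeasurePreserving_fst.ae h

lemma ae_ν_snd {P : RN N → Prop} (h : ∀ᵐ x ∂(volume.restrict D.Ω), P x) : ∀ᵐ z ∂D.ν, P z.2 :=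
  Measure.quasiMeasurePreserving_snd.ae h

lemma exists_kernel_bound :
    ∃ C, 0 ≤ C ∧ ∀ x ∈ D.Ω, ∀ y ∈ D.Ω,
      1 / dist x y ^ D.μ x y ≤ C * dist x y ^ (-D.μ₁) := by
  obtain ⟨d, hd⟩ := Metric.isBounded_iff.1 D.bdd
  refine ⟨(max 1 d) ^ D.μ₁, by positivity, fun x hx y hy => ?_⟩
  rcases eq_or_ne x y with rfl | hne
  · rw [dist_self, Real.zero_rpow (D.μ_pos x x).ne', _root_.div_zero]
    positivity
  have hd0 : 0 < dist x y := dist_pos.2 hne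
  have h1 : 1 / dist x y ^ D.μ x y = dist x y ^ (D.μ₁ - D.μ x y) * dist x y ^ (-D.μ₁) := by
    rw [← Real.rpow_add hd0, one_div, ← Real.rpow_neg hd0.le]; ring_nf
  rw [h1]
  gcongr
  calc dist x y ^ (D.μ₁ - D.μ x y) ≤ (max 1 d) ^ (D.μ₁ - D.μ x y) :=
        Real.rpow_le_rpow hd0.le ((hd hx hy).trans (le_max_right _ _)) (by linarith [D.μ_le x y])
    _ ≤ _ := Real.rpow_le_rpow_of_exponent_le (le_max_left _ _) (by linarith [D.μ_pos x y])

lemma exists_lintegral_kernel_le {β : ℝ} (hβ : β < N) :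
    ∃ C, 0 ≤ C ∧ ∀ x ∈ D.Ω,
      ∫⁻ y in D.Ω, ENNReal.ofReal (dist x y ^ (-β)) ≤ ENNReal.ofReal C := by
  obtain ⟨d, hd⟩ := Metric.isBounded_iff.1 D.bdd
  have hi := integrable_kernel_ball D.H.N_pos' hβ (d + 1)
  refine ⟨∫ z in Metric.ball (0 : RN N) (d + 1), ‖z‖ ^ (-β),
    integral_nonneg fun z => by positivity, fun x hx => ?_⟩
  rw [ofReal_integral_eq_lintegral_ofReal hi (Eventually.of_forall fun z => by positivity)]
  have hsub : D.Ω ⊆ (fun y => y - x) ⁻¹' Metric.ball (0 : RN N) (d + 1) := fun y hy => by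
    have := hd hy hx
    rw [mem_preimage, mem_ball_zero_iff, ← dist_eq_norm]; linarith
  refine (lintegral_mono_set hsub).trans (le_of_eq ?_)
  have hmp : MeasurePreserving (fun y : RN N => y - x) volume volume :=
    measurePreserving_sub_right volume x
  rw [← hmp.setLIntegral_comp_preimage Metric.isOpen_ball.measurableSet
    (f := fun z : RN N => ENNReal.ofReal (‖z‖ ^ (-β)))
    (measurable_norm.pow_const _).ennreal_ofReal]
  simp only [dist_comm x, dist_eq_norm]

/-- The majorant of the double integrals. -/
def Phi (g : RN N → ℝ) (z : RN N × RN N) : ℝ :=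
  g z.1 ^ D.r z.1 * g z.2 ^ D.r z.2 * dist z.1 z.2 ^ (-D.μ₁)

variable {D}

lemma Phi_nonneg {g : RN N → ℝ} (hg : ∀ x, 0 ≤ g x) (z : RN N × RN N) : 0 ≤ D.Phi g z := by
  have h1 := hg z.1
  have h2 := hg z.2
  unfold Phi; positivity

lemma measurable_Phi {g : RN N → ℝ} (hg : Measurable g) : Measurable (D.Phi g) := by
  have h : Measurable fun x => g x ^ D.r x := hg.pow D.contr.measurable
  exact ((h.comp measurable_fst).mul (h.comp measurable_snd)).mul (measurable_dist.pow_const _)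

variable (D) in
lemma exists_Phi_bound (K : ℝ) :
    ∃ C, 0 ≤ C ∧ ∀ g : RN N → ℝ, Measurable g → (∀ x, 0 ≤ g x) →
      ∫⁻ x in D.Ω, ENNReal.ofReal (g x ^ (D.e * D.t * D.r x)) ≤ ENNReal.ofReal K →
      Integrable (fun z => |D.Phi g z| ^ D.e) D.ν ∧ ∫ z, |D.Phi g z| ^ D.e ∂D.ν ≤ C := by
  have hK : (0 : ℝ) ≤ max K 0 := le_max_right _ _
  set a := D.t / (2 * D.t - 2) with ha
  set β := D.e * a * D.μ₁ with hβ
  obtain ⟨Ck, hCk0, hCk⟩ := D.exists_lintegral_kernel_le (β := β) D.kernel_sub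
  set I := max K 0 with hI
  refine ⟨I * I + I * Ck + I * Ck, by positivity, fun g hg hg0 hgK => ?_⟩
  have hgI : ∫⁻ x in D.Ω, ENNReal.ofReal (g x ^ (D.e * D.t * D.r x)) ≤ ENNReal.ofReal I :=
    hgK.trans (ENNReal.ofReal_le_ofReal (le_max_left _ _))
  set q : RN N → ℝ≥0∞ := fun x => ENNReal.ofReal (g x ^ (D.e * D.t * D.r x)) with hq
  set κ : RN N × RN N → ℝ≥0∞ := fun z => ENNReal.ofReal (dist z.1 z.2 ^ (-β)) with hκ
  have hqm : Measurable q := (hg.pow (D.contr.measurable.const_mul _)).ennreal_ofReal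
  have hκm : Measurable κ := (measurable_dist.pow_const _).ennreal_ofReal
  have hpt : ∀ z, ENNReal.ofReal (|D.Phi g z| ^ D.e) ≤
      q z.1 * q z.2 + q z.1 * κ z + q z.2 * κ z := by
    rintro ⟨x, y⟩
    have h1 := hg0 x
    have h2 := hg0 y
    have hd : 0 ≤ dist x y := dist_nonneg
    have hy := mul_mul_le_of_young (G₁ := (g x ^ D.r x) ^ D.e) (G₂ := (g y ^ D.r y) ^ D.e)
      (k := (dist x y ^ (-D.μ₁)) ^ D.e) (t := D.t) (by positivity) (by positivity) (by positivity)
      D.t_gt D.t_le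
    have e1 : ∀ x, 0 ≤ g x → ((g x ^ D.r x) ^ D.e) ^ D.t = g x ^ (D.e * D.t * D.r x) :=
      fun x hx => by rw [← Real.rpow_mul hx, ← Real.rpow_mul hx]; ring_nf
    have e2 : ((dist x y ^ (-D.μ₁)) ^ D.e) ^ a = dist x y ^ (-β) := by
      rw [← Real.rpow_mul hd, ← Real.rpow_mul hd, hβ]; ring_nf
    rw [e1 x h1, e1 y h2, e2] at hy
    rw [abs_of_nonneg (Phi_nonneg hg0 _), Phi, Real.mul_rpow (by positivity) (by positivity),
      Real.mul_rpow (by positivity) (by positivity)]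
    refine (ENNReal.ofReal_le_ofReal hy).trans (le_of_eq ?_)
    rw [ENNReal.ofReal_add (by positivity) (by positivity),
      ENNReal.ofReal_add (by positivity) (by positivity), ENNReal.ofReal_mul (by positivity),
      ENNReal.ofReal_mul (by positivity), ENNReal.ofReal_mul (by positivity)]
  have hfst : ∫⁻ z, q z.1 * κ z ∂D.ν ≤ ENNReal.ofReal I * ENNReal.ofReal Ck := by
    rw [ν, lintegral_prod _ (show AEMeasurable (fun z : RN N × RN N => q z.1 * κ z) _ from
      ((hqm.comp measurable_fst).mul hκm).aemeasurable)]
    calc ∫⁻ x in D.Ω, ∫⁻ y in D.Ω, q x * κ (x, y)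
        = ∫⁻ x in D.Ω, q x * ∫⁻ y in D.Ω, κ (x, y) := by
          congr 1; funext x
          exact lintegral_const_mul _ (hκm.comp measurable_prodMk_left)
      _ ≤ ∫⁻ x in D.Ω, q x * ENNReal.ofReal Ck :=
          setLIntegral_mono' D.measurableSet fun x hx => by gcongr; exact hCk x hx
      _ ≤ _ := by rw [lintegral_mul_const _ hqm]; gcongr
  have hsnd : ∫⁻ z, q z.2 * κ z ∂D.ν ≤ ENNReal.ofReal I * ENNReal.ofReal Ck := by
    refine le_trans (le_of_eq ?_) hfst
    have hmp : MeasurePreserving Prod.swap D.ν D.ν := Measure.measurePreserving_swap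
    rw [← hmp.lintegral_comp (show Measurable fun z : RN N × RN N => q z.1 * κ z from
      (hqm.comp measurable_fst).mul hκm)]
    simp only [hκ, Prod.fst_swap, Prod.snd_swap, dist_comm]
  have hmain : ∫⁻ z, ENNReal.ofReal (|D.Phi g z| ^ D.e) ∂D.ν ≤
      ENNReal.ofReal (I * I + I * Ck + I * Ck) := by
    calc _ ≤ ∫⁻ z, (q z.1 * q z.2 + q z.1 * κ z + q z.2 * κ z) ∂D.ν := lintegral_mono hpt
      _ = (∫⁻ z, q z.1 * q z.2 ∂D.ν) + (∫⁻ z, q z.1 * κ z ∂D.ν) + ∫⁻ z, q z.2 * κ z ∂D.ν := by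
          rw [lintegral_add_right _ (show Measurable fun z : RN N × RN N => q z.2 * κ z from
              (hqm.comp measurable_snd).mul hκm),
            lintegral_add_right _ (show Measurable fun z : RN N × RN N => q z.1 * κ z from
              (hqm.comp measurable_fst).mul hκm)]
      _ ≤ ENNReal.ofReal I * ENNReal.ofReal I + ENNReal.ofReal I * ENNReal.ofReal Ck +
            ENNReal.ofReal I * ENNReal.ofReal Ck := by
          refine add_le_add (add_le_add ?_ hfst) hsnd
          rw [ν, lintegral_prod_mul hqm.aemeasurable hqm.aemeasurable]
          gcongr
      _ = _ := by
          rw [← ENNReal.ofReal_mul hK, ← ENNReal.ofReal_mul hK, ← ENNReal.ofReal_add (by positivity)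
            (by positivity), ← ENNReal.ofReal_add (by positivity) (by positivity)]
  have hnn : ∀ z, 0 ≤ |D.Phi g z| ^ D.e := fun z => by positivity
  have hint : Integrable (fun z => |D.Phi g z| ^ D.e) D.ν := by
    refine ⟨((measurable_Phi hg).abs.pow_const _).aestronglyMeasurable, ?_⟩
    rw [hasFiniteIntegral_iff_ofReal (Eventually.of_forall hnn)]
    exact hmain.trans_lt ENNReal.ofReal_lt_top
  refine ⟨hint, ?_⟩
  rw [← ofReal_integral_eq_lintegral_ofReal hint (Eventually.of_forall hnn)] at hmain
  exact (ENNReal.ofReal_le_ofReal_iff (by positivity)).1 hmain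

end Problem

namespace Problem

variable (D : Problem N)

/-- Admissible functions of the problem. -/
abbrev Admissible (u : RN N → ℝ) : Prop := Adm D.Ω D.s D.p u

/-- The Gagliardo modular of the problem. -/
abbrev modular (u : RN N → ℝ) : ℝ := rho D.s D.p u

/-- The integrand of the Choquard functional. -/
def tden (u : RN N → ℝ) (z : RN N × RN N) : ℝ :=
  Fant D.f z.1 (u z.1) * Fant D.f z.2 (u z.2) / dist z.1 z.2 ^ D.μ z.1 z.2

/-- The integrand of the derivative of the Choquard functional. -/
def dtden (u w : RN N → ℝ) (z : RN N × RN N) : ℝ :=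
  Fant D.f z.1 (u z.1) * D.f z.2 (u z.2) * w z.2 / dist z.1 z.2 ^ D.μ z.1 z.2

/-- The Choquard functional. -/
def T (u : RN N → ℝ) : ℝ := ∫ z, D.tden u z ∂D.ν

/-- Half the derivative of the Choquard functional. -/
def dT (u w : RN N → ℝ) : ℝ := ∫ z, D.dtden u w z ∂D.ν

/-- The sublinear functional. -/
def S (u : RN N → ℝ) : ℝ := ∫ x in D.Ω, |u x| ^ D.α x / D.α x

/-- The derivative of the sublinear functional. -/
def dS (u w : RN N → ℝ) : ℝ := ∫ x in D.Ω, |u x| ^ (D.α x - 2) * u x * w x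

lemma exists_weight_bound (K : ℝ) :
    ∃ C, 0 ≤ C ∧ ∀ u w, D.Admissible u → D.Admissible w → D.modular u ≤ K → D.modular w ≤ K →
      ∫⁻ x in D.Ω, ENNReal.ofReal ((|u x| + |w x|) ^ (D.e * D.t * D.r x)) ≤ ENNReal.ofReal C := by
  have het : 0 < D.e * D.t := mul_pos (by linarith [D.e_gt]) (by linarith [D.t_gt])
  have hm0 : ∀ x, 0 < D.e * D.t * D.r x := fun x => mul_pos het (by linarith [D.r_pos x])
  obtain ⟨C, hC0, hC⟩ := exists_embedding D.H D.isOpen D.bdd (m := fun x => D.e * D.t * D.r x)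
    (continuous_const.mul D.contr) (fun x _ => hm0 x) D.growth_sub K
  refine ⟨2 ^ (D.e * D.t * D.r₁) * (C + C), by positivity, fun u w hu hw hρu hρw => ?_⟩
  obtain ⟨hiu, hu1⟩ := hC u hu hρu
  obtain ⟨hiw, hw1⟩ := hC w hw hρw
  have hpt : ∀ x, (|u x| + |w x|) ^ (D.e * D.t * D.r x) ≤ 2 ^ (D.e * D.t * D.r₁) *
      (|u x| ^ (D.e * D.t * D.r x) + |w x| ^ (D.e * D.t * D.r x)) := by
    intro x
    have ha := abs_nonneg (u x)
    have hb := abs_nonneg (w x)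
    have h1 : |u x| + |w x| ≤ 2 * max |u x| |w x| := by
      linarith [le_max_left |u x| |w x|, le_max_right |u x| |w x|]
    have h2 : (max |u x| |w x|) ^ (D.e * D.t * D.r x) ≤
        |u x| ^ (D.e * D.t * D.r x) + |w x| ^ (D.e * D.t * D.r x) := by
      rcases max_choice |u x| |w x| with h | h <;> rw [h]
      · linarith [Real.rpow_nonneg hb (D.e * D.t * D.r x)]
      · linarith [Real.rpow_nonneg ha (D.e * D.t * D.r x)]
    calc _ ≤ (2 * max |u x| |w x|) ^ (D.e * D.t * D.r x) :=
          Real.rpow_le_rpow (by positivity) h1 (hm0 x).le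
      _ = 2 ^ (D.e * D.t * D.r x) * (max |u x| |w x|) ^ (D.e * D.t * D.r x) :=
          Real.mul_rpow (by norm_num) (by positivity)
      _ ≤ _ := by
          refine mul_le_mul (Real.rpow_le_rpow_of_exponent_le (by norm_num) ?_) h2 (by positivity)
            (by positivity)
          exact mul_le_mul_of_nonneg_left (D.r_le x) het.le
  calc _ ≤ ∫⁻ x in D.Ω, ENNReal.ofReal (2 ^ (D.e * D.t * D.r₁) *
        (|u x| ^ (D.e * D.t * D.r x) + |w x| ^ (D.e * D.t * D.r x))) :=
        lintegral_mono fun x => ENNReal.ofReal_le_ofReal (hpt x)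
    _ = ENNReal.ofReal (∫ x in D.Ω, 2 ^ (D.e * D.t * D.r₁) *
        (|u x| ^ (D.e * D.t * D.r x) + |w x| ^ (D.e * D.t * D.r x))) :=
        (ofReal_integral_eq_lintegral_ofReal ((hiu.add hiw).const_mul _)
          (Eventually.of_forall fun x => mul_nonneg (by positivity)
            (add_nonneg (Real.rpow_nonneg (abs_nonneg _) _)
              (Real.rpow_nonneg (abs_nonneg _) _)))).symm
    _ ≤ _ := by
        refine ENNReal.ofReal_le_ofReal ?_
        rw [integral_const_mul, integral_add hiu hiw]
        gcongr

/-- Functions on `Ω × Ω` controlled by the growth of the nonlinearity at `u` and `w`. -/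
def Dominated (u w : RN N → ℝ) (h : RN N × RN N → ℝ) : Prop :=
  Measurable h ∧ ∀ x ∈ D.Ω, ∀ y ∈ D.Ω, |h (x, y)| ≤ D.M * (|u x| + |w x|) ^ D.r x *
    (D.M * (|u y| + |w y|) ^ D.r y) * (1 / dist x y ^ D.μ x y)

lemma exists_rpow_bound (K : ℝ) :
    ∃ C, 0 ≤ C ∧ ∀ u w, D.Admissible u → D.Admissible w → D.modular u ≤ K → D.modular w ≤ K →
      ∀ h, D.Dominated u w h → Integrable (fun z => |h z| ^ D.e) D.ν ∧
        ∫ z, |h z| ^ D.e ∂D.ν ≤ C := by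
  obtain ⟨C₁, hC₁0, hC₁⟩ := D.exists_weight_bound K
  obtain ⟨C₂, hC₂0, hC₂⟩ := D.exists_Phi_bound C₁
  obtain ⟨Ck, hCk0, hCk⟩ := D.exists_kernel_bound
  have hM := D.M_pos
  have he0 : 0 ≤ D.e := by linarith [D.e_gt]
  refine ⟨(D.M * D.M * Ck) ^ D.e * C₂, by positivity, fun u w hu hw hρu hρw h hh => ?_⟩
  obtain ⟨hi, hle⟩ := hC₂ (fun x => |u x| + |w x|) (hu.meas.abs.add hw.meas.abs)
    (fun x => by positivity) (hC₁ u w hu hw hρu hρw)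
  have hpt : ∀ᵐ z ∂D.ν, |h z| ^ D.e ≤ (D.M * D.M * Ck) ^ D.e *
      |D.Phi (fun x => |u x| + |w x|) z| ^ D.e := by
    refine D.ae_ν fun x hx y hy => ?_
    rw [← Real.mul_rpow (by positivity) (abs_nonneg _)]
    refine Real.rpow_le_rpow (abs_nonneg _) ((hh.2 x hx y hy).trans ?_) he0
    rw [abs_of_nonneg (Phi_nonneg (fun x => by positivity) _)]
    calc _ ≤ D.M * (|u x| + |w x|) ^ D.r x * (D.M * (|u y| + |w y|) ^ D.r y) *
          (Ck * dist x y ^ (-D.μ₁)) := by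
          gcongr; exact hCk x hx y hy
      _ = _ := by unfold Phi; ring
  have hint : Integrable (fun z => |h z| ^ D.e) D.ν := by
    refine (hi.const_mul ((D.M * D.M * Ck) ^ D.e)).mono'
      (hh.1.abs.pow_const _).aestronglyMeasurable ?_
    filter_upwards [hpt] with z hz
    rwa [Real.norm_eq_abs, abs_of_nonneg (by positivity)]
  refine ⟨hint, ?_⟩
  calc _ ≤ ∫ z, (D.M * D.M * Ck) ^ D.e * |D.Phi (fun x => |u x| + |w x|) z| ^ D.e ∂D.ν :=
        integral_mono_ae hint (hi.const_mul _) hpt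
    _ ≤ _ := by
        rw [integral_const_mul]
        gcongr

lemma exists_integral_bound (K : ℝ) :
    ∃ C, 0 ≤ C ∧ ∀ u w, D.Admissible u → D.Admissible w → D.modular u ≤ K → D.modular w ≤ K →
      ∀ h, D.Dominated u w h → Integrable h D.ν ∧ |∫ z, h z ∂D.ν| ≤ C := by
  obtain ⟨C, hC0, hC⟩ := D.exists_rpow_bound K
  refine ⟨D.ν.real univ + C, by positivity, fun u w hu hw hρu hρw h hh => ?_⟩
  obtain ⟨hi, hle⟩ := hC u w hu hw hρu hρw h hh
  have hpt : ∀ z, |h z| ≤ 1 + |h z| ^ D.e := fun z => by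
    simpa using rpow_le_one_add_rpow (abs_nonneg (h z)) zero_le_one D.e_gt.le
  have hsum : Integrable (fun z => 1 + |h z| ^ D.e) D.ν := (integrable_const 1).add hi
  have hint : Integrable h D.ν :=
    hsum.mono' hh.1.aestronglyMeasurable (Eventually.of_forall hpt)
  refine ⟨hint, abs_integral_le_integral_abs.trans ((integral_mono hint.abs hsum hpt).trans ?_)⟩
  rw [integral_add (integrable_const 1) hi]
  simp only [integral_const, smul_eq_mul, mul_one]
  gcongr

variable {D}

lemma dominated_tden {u w v : RN N → ℝ} (hv : Measurable v)
    (h : ∀ x, |v x| ≤ |u x| + |w x|) : D.Dominated u w (D.tden v) := by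
  have hF := D.car.measurable_Fant_comp hv
  refine ⟨((hF.comp measurable_fst).mul (hF.comp measurable_snd)).div
    (measurable_dist.pow D.contμ.measurable), fun x hx y hy => ?_⟩
  have hM := D.M_pos
  rw [tden, div_eq_mul_one_div, abs_mul, abs_mul,
    abs_of_nonneg (show 0 ≤ 1 / dist x y ^ D.μ x y by positivity)]
  have h1 := D.abs_Fant_le_of_le hx (h x)
  have h2 := D.abs_Fant_le_of_le hy (h y)
  gcongr

lemma dominated_dtden {u w v φ : RN N → ℝ} (hv : Measurable v) (hφ : Measurable φ)
    (h : ∀ x, |v x| ≤ |u x| + |w x|) (h' : ∀ x, |φ x| ≤ |u x| + |w x|) :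
    D.Dominated u w (D.dtden v φ) := by
  have hF := D.car.measurable_Fant_comp hv
  have hf := D.car.measurable_comp hv
  refine ⟨(((hF.comp measurable_fst).mul (hf.comp measurable_snd)).mul
    (hφ.comp measurable_snd)).div (measurable_dist.pow D.contμ.measurable), fun x hx y hy => ?_⟩
  have hM := D.M_pos
  rw [dtden, mul_assoc, div_eq_mul_one_div, abs_mul, abs_mul,
    abs_of_nonneg (show 0 ≤ 1 / dist x y ^ D.μ x y by positivity)]
  have h1 := D.abs_Fant_le_of_le hx (h x)
  have h2 := D.abs_f_mul_le hy (h y) (h' y)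
  gcongr

lemma integrable_of_dominated {u w : RN N → ℝ} (hu : D.Admissible u) (hw : D.Admissible w)
    {h : RN N × RN N → ℝ} (hh : D.Dominated u w h) : Integrable h D.ν := by
  obtain ⟨C, -, hC⟩ := D.exists_integral_bound (max (D.modular u) (D.modular w))
  exact (hC u w hu hw (le_max_left _ _) (le_max_right _ _) h hh).1

lemma integrable_tden {u : RN N → ℝ} (hu : D.Admissible u) : Integrable (D.tden u) D.ν :=
  integrable_of_dominated hu hu (dominated_tden hu.meas fun x => by linarith [abs_nonneg (u x)])

lemma integrable_dtden {u w : RN N → ℝ} (hu : D.Admissible u) (hw : D.Admissible w) :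
    Integrable (D.dtden u w) D.ν :=
  integrable_of_dominated hu hw (dominated_dtden hu.meas hw.meas
    (fun x => by linarith [abs_nonneg (w x)]) (fun x => by linarith [abs_nonneg (u x)]))

lemma tendsto_integral_of_dominated {u w : ℕ → RN N → ℝ} {K : ℝ} {h : ℕ → RN N × RN N → ℝ}
    {h' : RN N × RN N → ℝ} (hu : ∀ n, D.Admissible (u n)) (hw : ∀ n, D.Admissible (w n))
    (hρu : ∀ n, D.modular (u n) ≤ K) (hρw : ∀ n, D.modular (w n) ≤ K)
    (hh : ∀ n, D.Dominated (u n) (w n) (h n))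
    (hl : ∀ᵐ z ∂D.ν, Tendsto (fun n => h n z) atTop (𝓝 (h' z))) :
    Tendsto (fun n => ∫ z, h n z ∂D.ν) atTop (𝓝 (∫ z, h' z ∂D.ν)) := by
  obtain ⟨C, -, hC⟩ := D.exists_rpow_bound K
  exact (tendsto_integral_of_rpow_bound D.e_gt (fun n => (hh n).1.aestronglyMeasurable)
    (fun n => (hC _ _ (hu n) (hw n) (hρu n) (hρw n) _ (hh n)).1)
    (fun n => (hC _ _ (hu n) (hw n) (hρu n) (hρw n) _ (hh n)).2) hl).2

lemma tendsto_T {u : ℕ → RN N → ℝ} {v : RN N → ℝ} {K : ℝ} (hu : ∀ n, D.Admissible (u n))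
    (hρu : ∀ n, D.modular (u n) ≤ K)
    (hl : ∀ᵐ x, Tendsto (fun n => u n x) atTop (𝓝 (v x))) :
    Tendsto (fun n => D.T (u n)) atTop (𝓝 (D.T v)) := by
  have hl' := ae_restrict_of_ae (s := D.Ω) hl
  refine tendsto_integral_of_dominated hu hu hρu hρu
    (fun n => dominated_tden (hu n).meas fun x => by linarith [abs_nonneg (u n x)]) ?_
  filter_upwards [D.ae_ν_fst hl', D.ae_ν_snd hl'] with z h1 h2
  exact ((((D.car.continuous_Fant z.1).tendsto _).comp h1).mul
    (((D.car.continuous_Fant z.2).tendsto _).comp h2)).div_const _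

lemma tendsto_dT {u w : ℕ → RN N → ℝ} {v φ : RN N → ℝ} {K : ℝ} (hu : ∀ n, D.Admissible (u n))
    (hw : ∀ n, D.Admissible (w n)) (hρu : ∀ n, D.modular (u n) ≤ K)
    (hρw : ∀ n, D.modular (w n) ≤ K)
    (hl : ∀ᵐ x, Tendsto (fun n => u n x) atTop (𝓝 (v x)))
    (hlw : ∀ᵐ x, Tendsto (fun n => w n x) atTop (𝓝 (φ x))) :
    Tendsto (fun n => D.dT (u n) (w n)) atTop (𝓝 (D.dT v φ)) := by
  have hl' := ae_restrict_of_ae (s := D.Ω) hl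
  have hlw' := ae_restrict_of_ae (s := D.Ω) hlw
  refine tendsto_integral_of_dominated hu hw hρu hρw
    (fun n => dominated_dtden (hu n).meas (hw n).meas
      (fun x => by linarith [abs_nonneg (w n x)]) (fun x => by linarith [abs_nonneg (u n x)])) ?_
  filter_upwards [D.ae_ν_fst hl', D.ae_ν_snd hl', D.ae_ν_snd hlw'] with z h1 h2 h3
  exact (((((D.car.continuous_Fant z.1).tendsto _).comp h1).mul
    (((D.car.2 z.2).tendsto _).comp h2)).mul h3).div_const _

lemma integral_dtden_swap (u w : RN N → ℝ) :
    ∫ z, D.dtden u w z.swap ∂D.ν = D.dT u w := by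
  have hmp : MeasurePreserving Prod.swap D.ν D.ν := Measure.measurePreserving_swap
  exact hmp.integral_comp MeasurableEquiv.prodComm.measurableEmbedding (D.dtden u w)

lemma hasDerivAt_T {u w : RN N → ℝ} (hu : D.Admissible u) (hw : D.Admissible w) :
    HasDerivAt (fun τ : ℝ => D.T (u + τ • w)) (2 * D.dT u w) 0 := by
  have hv : ∀ τ : ℝ, D.Admissible (u + τ • w) := fun τ => hu.add D.H (hw.smul D.H τ)
  have hle : ∀ τ ∈ Metric.ball (0 : ℝ) 1, ∀ x, |(u + τ • w) x| ≤ |u x| + |w x| := by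
    intro τ hτ x
    rw [mem_ball_zero_iff, Real.norm_eq_abs] at hτ
    refine (abs_add_le _ _).trans ?_
    rw [Pi.smul_apply, smul_eq_mul, abs_mul]
    nlinarith [abs_nonneg (w x)]
  have hdom : ∀ τ ∈ Metric.ball (0 : ℝ) 1, D.Dominated u w (D.dtden (u + τ • w) w) :=
    fun τ hτ => dominated_dtden (hv τ).meas hw.meas (hle τ hτ)
      (fun x => by linarith [abs_nonneg (u x)])
  set B : RN N × RN N → ℝ := fun z => D.M * (|u z.1| + |w z.1|) ^ D.r z.1 *
    (D.M * (|u z.2| + |w z.2|) ^ D.r z.2) * (1 / dist z.1 z.2 ^ D.μ z.1 z.2) with hB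
  have hM := D.M_pos
  have hBi : Integrable B D.ν := by
    refine integrable_of_dominated hu hw ⟨?_, fun x _ y _ => ?_⟩
    · have h1 : Measurable fun x => D.M * (|u x| + |w x|) ^ D.r x :=
        ((hu.meas.abs.add hw.meas.abs).pow D.contr.measurable).const_mul _
      exact ((h1.comp measurable_fst).mul (h1.comp measurable_snd)).mul
        ((measurable_dist.pow D.contμ.measurable).const_div 1)
    · rw [abs_of_nonneg]; positivity
  have hBswap : ∀ z : RN N × RN N, B z.swap = B z := fun z => by
    simp only [hB, Prod.fst_swap, Prod.snd_swap]
    rw [dist_comm, D.symmμ]; ring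
  have h := hasDerivAt_integral_of_dominated_loc_of_deriv_le (μ := D.ν) (𝕜 := ℝ)
    (F := fun τ : ℝ => D.tden (u + τ • w))
    (F' := fun τ z => D.dtden (u + τ • w) w z.swap + D.dtden (u + τ • w) w z)
    (x₀ := (0 : ℝ)) (s := Metric.ball 0 1) (bound := fun z => B z + B z)
    (Metric.ball_mem_nhds _ one_pos)
    (Eventually.of_forall fun τ => (integrable_tden (hv τ)).1)
    (integrable_tden (hv 0))
    (((hdom 0 (Metric.mem_ball_self one_pos)).1.comp measurable_swap).add
      (hdom 0 (Metric.mem_ball_self one_pos)).1).aestronglyMeasurable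
    (D.ae_ν fun x hx y hy τ hτ => by
      refine (norm_add_le _ _).trans (add_le_add ?_ ?_)
      · rw [← hBswap]; exact (hdom τ hτ).2 y hy x hx
      · exact (hdom τ hτ).2 x hx y hy)
    (hBi.add hBi)
    (Eventually.of_forall fun z τ _ => by
      have hl : ∀ x, HasDerivAt (fun τ : ℝ => (u + τ • w) x) (w x) τ := fun x => by
        simpa using ((hasDerivAt_id τ).mul_const (w x)).const_add (u x)
      have h1 := (D.car.hasDerivAt_Fant z.1 ((u + τ • w) z.1)).comp τ (hl z.1)
      have h2 := (D.car.hasDerivAt_Fant z.2 ((u + τ • w) z.2)).comp τ (hl z.2)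
      refine ((h1.mul h2).div_const (dist z.1 z.2 ^ D.μ z.1 z.2)).congr_deriv ?_
      simp only [dtden, Prod.fst_swap, Prod.snd_swap, Function.comp]
      rw [dist_comm z.2, D.symmμ z.2, ← add_div]
      ring)
  refine h.2.congr_deriv ?_
  simp only [zero_smul, add_zero]
  have hi := integrable_dtden hu hw
  have hmp : MeasurePreserving Prod.swap D.ν D.ν := Measure.measurePreserving_swap
  rw [integral_add (show Integrable (fun z => D.dtden u w z.swap) D.ν from
    (hmp.integrable_comp hi.1).2 hi) hi, integral_dtden_swap, dT, two_mul]

end Problem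

lemma continuous_abs_rpow_mul {a : ℝ} (ha : 1 < a) : Continuous fun x : ℝ => |x| ^ (a - 2) * x := by
  have h : Continuous (deriv fun x : ℝ => |x| ^ a) :=
    (contDiff_norm_rpow (E := ℝ) ha).continuous_deriv le_rfl
  have hd : deriv (fun x : ℝ => |x| ^ a) = fun x => a * (|x| ^ (a - 2) * x) := by
    funext x; rw [(hasDerivAt_abs_rpow x ha).deriv, mul_assoc]
  rw [hd] at h
  refine (h.const_mul a⁻¹).congr fun x => ?_
  have : a ≠ 0 := by linarith
  field_simp

lemma abs_abs_rpow_mul {a : ℝ} (ha : 1 < a) (x : ℝ) : |(|x| ^ (a - 2) * x)| = |x| ^ (a - 1) := by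
  rcases eq_or_ne x 0 with rfl | hx
  · simp [Real.zero_rpow (show a - 1 ≠ 0 by linarith)]
  · rw [abs_mul, abs_of_nonneg (by positivity), ← Real.rpow_add_one (abs_ne_zero.2 hx)]
    ring_nf

lemma abs_rpow_mul_mul_le {a b c g : ℝ} (ha : 1 < a) (hb : |b| ≤ g) (hc : |c| ≤ g) :
    |(|b| ^ (a - 2) * b * c)| ≤ g ^ a := by
  have hg : 0 ≤ g := (abs_nonneg _).trans hb
  rw [abs_mul, abs_abs_rpow_mul ha]
  calc |b| ^ (a - 1) * |c| ≤ g ^ (a - 1) * g :=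
        mul_le_mul (Real.rpow_le_rpow (abs_nonneg _) hb (by linarith)) hc (abs_nonneg _)
          (by positivity)
    _ = g ^ a := by rw [← Real.rpow_add_one' hg (by linarith)]; ring_nf

namespace Problem

variable (D : Problem N)

lemma α_gt (x : RN N) : 1 < D.α x := D.a₁_gt.trans_le (D.α_ge x)

lemma a₂_pos : 0 < D.a₂ := by linarith [D.α_gt 0, D.α_le 0]

/-- Functions controlled by the growth of the sublinear term at `u` and `w`. -/
def SubDominated (u w h : RN N → ℝ) : Prop :=
  Measurable h ∧ ∀ x, |h x| ≤ (|u x| + |w x|) ^ D.α x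

lemma exists_rpow_bound_sub (K : ℝ) :
    ∃ C, 0 ≤ C ∧ ∀ u w, D.Admissible u → D.Admissible w → D.modular u ≤ K → D.modular w ≤ K →
      ∀ h, D.SubDominated u w h → IntegrableOn (fun x => |h x| ^ (D.p₀ / D.a₂)) D.Ω ∧
        ∫ x in D.Ω, |h x| ^ (D.p₀ / D.a₂) ≤ C := by
  obtain ⟨C, hC0, hC⟩ := exists_poincare D.H D.isOpen D.bdd
  have ha₂ := D.a₂_pos
  have hp₀ : 0 < D.p₀ := by linarith [D.H.p₀_gt]
  refine ⟨volume.real D.Ω + 2 ^ D.p₀ * (C * (1 + max K 0) + C * (1 + max K 0)), by positivity,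
    fun u w hu hw hρu hρw h hh => ?_⟩
  obtain ⟨hiu, hu1⟩ := hC u hu
  obtain ⟨hiw, hw1⟩ := hC w hw
  have hpt : ∀ x, |h x| ^ (D.p₀ / D.a₂) ≤ 1 + 2 ^ D.p₀ * (|u x| ^ D.p₀ + |w x| ^ D.p₀) := by
    intro x
    have ha := abs_nonneg (u x)
    have hb := abs_nonneg (w x)
    have h1 : |u x| + |w x| ≤ 2 * max |u x| |w x| := by
      linarith [le_max_left |u x| |w x|, le_max_right |u x| |w x|]
    have h2 : (max |u x| |w x|) ^ D.p₀ ≤ |u x| ^ D.p₀ + |w x| ^ D.p₀ := by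
      rcases max_choice |u x| |w x| with h | h <;> rw [h]
      · linarith [Real.rpow_nonneg hb D.p₀]
      · linarith [Real.rpow_nonneg ha D.p₀]
    calc |h x| ^ (D.p₀ / D.a₂) ≤ ((|u x| + |w x|) ^ D.α x) ^ (D.p₀ / D.a₂) :=
          Real.rpow_le_rpow (abs_nonneg _) (hh.2 x) (by positivity)
      _ = (|u x| + |w x|) ^ (D.α x * (D.p₀ / D.a₂)) := by rw [← Real.rpow_mul (by positivity)]
      _ ≤ 1 + (|u x| + |w x|) ^ D.p₀ := by
          refine rpow_le_one_add_rpow (by positivity)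
            (mul_nonneg (by linarith [D.α_gt x]) (by positivity)) ?_
          rw [mul_div_assoc', div_le_iff₀ ha₂, mul_comm]
          exact mul_le_mul_of_nonneg_left (D.α_le x) hp₀.le
      _ ≤ 1 + (2 * max |u x| |w x|) ^ D.p₀ := by gcongr
      _ = 1 + 2 ^ D.p₀ * (max |u x| |w x|) ^ D.p₀ := by
          rw [Real.mul_rpow (by norm_num) (by positivity)]
      _ ≤ _ := by gcongr
  have hone : IntegrableOn (fun _ : RN N => (1 : ℝ)) D.Ω := integrableOn_const D.volume_ne_top
  have h12 : IntegrableOn (fun x => 2 ^ D.p₀ * (|u x| ^ D.p₀ + |w x| ^ D.p₀)) D.Ω :=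
    (hiu.add hiw).const_mul _
  have hsum : IntegrableOn (fun x => 1 + 2 ^ D.p₀ * (|u x| ^ D.p₀ + |w x| ^ D.p₀)) D.Ω :=
    hone.add h12
  have hint : IntegrableOn (fun x => |h x| ^ (D.p₀ / D.a₂)) D.Ω := by
    refine hsum.mono' (hh.1.abs.pow_const _).aestronglyMeasurable (Eventually.of_forall fun x => ?_)
    rw [Real.norm_eq_abs, abs_of_nonneg (by positivity)]
    exact hpt x
  refine ⟨hint, (integral_mono hint hsum hpt).trans ?_⟩
  rw [integral_add hone h12, integral_const_mul, integral_add hiu hiw, setIntegral_const, smul_eq_mul,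
    mul_one]
  have hKu : D.modular u ≤ max K 0 := hρu.trans (le_max_left _ _)
  have hKw : D.modular w ≤ max K 0 := hρw.trans (le_max_left _ _)
  gcongr
  · exact hu1.trans (by gcongr)
  · exact hw1.trans (by gcongr)

lemma exists_integral_bound_sub (K : ℝ) :
    ∃ C, 0 ≤ C ∧ ∀ u w, D.Admissible u → D.Admissible w → D.modular u ≤ K → D.modular w ≤ K →
      ∀ h, D.SubDominated u w h → IntegrableOn h D.Ω ∧ |∫ x in D.Ω, h x| ≤ C := by
  obtain ⟨C, hC0, hC⟩ := D.exists_rpow_bound_sub K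
  refine ⟨volume.real D.Ω + C, by positivity, fun u w hu hw hρu hρw h hh => ?_⟩
  obtain ⟨hi, hle⟩ := hC u w hu hw hρu hρw h hh
  have hpt : ∀ x, |h x| ≤ 1 + |h x| ^ (D.p₀ / D.a₂) := fun x => by
    simpa using rpow_le_one_add_rpow (abs_nonneg (h x)) zero_le_one
      ((one_lt_div D.a₂_pos).2 D.a₂_lt).le
  have hone : IntegrableOn (fun _ : RN N => (1 : ℝ)) D.Ω := integrableOn_const D.volume_ne_top
  have hsum : IntegrableOn (fun x => 1 + |h x| ^ (D.p₀ / D.a₂)) D.Ω := hone.add hi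
  have hint : IntegrableOn h D.Ω :=
    hsum.mono' hh.1.aestronglyMeasurable (Eventually.of_forall hpt)
  refine ⟨hint, abs_integral_le_integral_abs.trans ((integral_mono hint.abs hsum hpt).trans ?_)⟩
  rw [integral_add hone hi, setIntegral_const, smul_eq_mul, mul_one]
  gcongr

variable {D}

lemma integrableOn_of_subDominated {u w h : RN N → ℝ} (hu : D.Admissible u) (hw : D.Admissible w)
    (hh : D.SubDominated u w h) : IntegrableOn h D.Ω := by
  obtain ⟨C, -, hC⟩ := D.exists_integral_bound_sub (max (D.modular u) (D.modular w))
  exact (hC u w hu hw (le_max_left _ _) (le_max_right _ _) h hh).1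

lemma subDominated_S {u w v : RN N → ℝ} (hv : Measurable v)
    (h : ∀ x, |v x| ≤ |u x| + |w x|) : D.SubDominated u w fun x => |v x| ^ D.α x / D.α x := by
  refine ⟨(hv.abs.pow D.measα).div D.measα, fun x => ?_⟩
  have hα := D.α_gt x
  rw [abs_of_nonneg (by positivity)]
  refine (div_le_self (by positivity) hα.le).trans ?_
  exact Real.rpow_le_rpow (abs_nonneg _) (h x) (by linarith)

lemma subDominated_dS {u w v φ : RN N → ℝ} (hv : Measurable v) (hφ : Measurable φ)
    (h : ∀ x, |v x| ≤ |u x| + |w x|) (h' : ∀ x, |φ x| ≤ |u x| + |w x|) :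
    D.SubDominated u w fun x => |v x| ^ (D.α x - 2) * v x * φ x :=
  ⟨((hv.abs.pow (D.measα.sub_const 2)).mul hv).mul hφ,
    fun x => abs_rpow_mul_mul_le (D.α_gt x) (h x) (h' x)⟩

lemma tendsto_integral_of_subDominated {u w h : ℕ → RN N → ℝ} {K : ℝ} {h' : RN N → ℝ}
    (hu : ∀ n, D.Admissible (u n)) (hw : ∀ n, D.Admissible (w n))
    (hρu : ∀ n, D.modular (u n) ≤ K) (hρw : ∀ n, D.modular (w n) ≤ K)
    (hh : ∀ n, D.SubDominated (u n) (w n) (h n))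
    (hl : ∀ᵐ x, Tendsto (fun n => h n x) atTop (𝓝 (h' x))) :
    Tendsto (fun n => ∫ x in D.Ω, h n x) atTop (𝓝 (∫ x in D.Ω, h' x)) := by
  obtain ⟨C, -, hC⟩ := D.exists_rpow_bound_sub K
  exact (tendsto_integral_of_rpow_bound ((one_lt_div D.a₂_pos).2 D.a₂_lt)
    (fun n => (hh n).1.aestronglyMeasurable)
    (fun n => (hC _ _ (hu n) (hw n) (hρu n) (hρw n) _ (hh n)).1)
    (fun n => (hC _ _ (hu n) (hw n) (hρu n) (hρw n) _ (hh n)).2) (ae_restrict_of_ae hl)).2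

lemma tendsto_S {u : ℕ → RN N → ℝ} {v : RN N → ℝ} {K : ℝ} (hu : ∀ n, D.Admissible (u n))
    (hρu : ∀ n, D.modular (u n) ≤ K)
    (hl : ∀ᵐ x, Tendsto (fun n => u n x) atTop (𝓝 (v x))) :
    Tendsto (fun n => D.S (u n)) atTop (𝓝 (D.S v)) := by
  refine tendsto_integral_of_subDominated hu hu hρu hρu
    (fun n => subDominated_S (hu n).meas fun x => by linarith [abs_nonneg (u n x)]) ?_
  filter_upwards [hl] with x hx
  exact (hx.abs.rpow_const (Or.inr (by linarith [D.α_gt x]))).div_const _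

lemma tendsto_dS {u w : ℕ → RN N → ℝ} {v φ : RN N → ℝ} {K : ℝ} (hu : ∀ n, D.Admissible (u n))
    (hw : ∀ n, D.Admissible (w n)) (hρu : ∀ n, D.modular (u n) ≤ K)
    (hρw : ∀ n, D.modular (w n) ≤ K)
    (hl : ∀ᵐ x, Tendsto (fun n => u n x) atTop (𝓝 (v x)))
    (hlw : ∀ᵐ x, Tendsto (fun n => w n x) atTop (𝓝 (φ x))) :
    Tendsto (fun n => D.dS (u n) (w n)) atTop (𝓝 (D.dS v φ)) := by
  refine tendsto_integral_of_subDominated hu hw hρu hρw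
    (fun n => subDominated_dS (hu n).meas (hw n).meas
      (fun x => by linarith [abs_nonneg (w n x)]) (fun x => by linarith [abs_nonneg (u n x)])) ?_
  filter_upwards [hl, hlw] with x h1 h2
  exact (((continuous_abs_rpow_mul (D.α_gt x)).tendsto _).comp h1).mul h2

lemma integrableOn_S {u : RN N → ℝ} (hu : D.Admissible u) :
    IntegrableOn (fun x => |u x| ^ D.α x / D.α x) D.Ω :=
  integrableOn_of_subDominated hu hu
    (subDominated_S hu.meas fun x => by linarith [abs_nonneg (u x)])

lemma integrableOn_dS {u w : RN N → ℝ} (hu : D.Admissible u) (hw : D.Admissible w) :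
    IntegrableOn (fun x => |u x| ^ (D.α x - 2) * u x * w x) D.Ω :=
  integrableOn_of_subDominated hu hw (subDominated_dS hu.meas hw.meas
    (fun x => by linarith [abs_nonneg (w x)]) (fun x => by linarith [abs_nonneg (u x)]))

lemma hasDerivAt_line (u w : RN N → ℝ) (x : RN N) (τ : ℝ) :
    HasDerivAt (fun τ : ℝ => (u + τ • w) x) (w x) τ := by
  simpa using ((hasDerivAt_id τ).mul_const (w x)).const_add (u x)

lemma abs_line_le (u w : RN N → ℝ) {τ : ℝ} (hτ : τ ∈ Metric.ball (0 : ℝ) 1) (x : RN N) :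
    |(u + τ • w) x| ≤ |u x| + |w x| := by
  rw [mem_ball_zero_iff, Real.norm_eq_abs] at hτ
  refine (abs_add_le _ _).trans ?_
  rw [Pi.smul_apply, smul_eq_mul, abs_mul]
  nlinarith [abs_nonneg (w x)]

lemma hasDerivAt_S {u w : RN N → ℝ} (hu : D.Admissible u) (hw : D.Admissible w) :
    HasDerivAt (fun τ : ℝ => D.S (u + τ • w)) (D.dS u w) 0 := by
  have hv : ∀ τ : ℝ, D.Admissible (u + τ • w) := fun τ => hu.add D.H (hw.smul D.H τ)
  have hdom : ∀ τ ∈ Metric.ball (0 : ℝ) 1, D.SubDominated u w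
      (fun x => |(u + τ • w) x| ^ (D.α x - 2) * (u + τ • w) x * w x) := fun τ hτ =>
    subDominated_dS (hv τ).meas hw.meas (abs_line_le u w hτ)
      (fun x => by linarith [abs_nonneg (u x)])
  have hBi : IntegrableOn (fun x => (|u x| + |w x|) ^ D.α x) D.Ω :=
    integrableOn_of_subDominated hu hw ⟨(hu.meas.abs.add hw.meas.abs).pow D.measα, fun x => by
      rw [abs_of_nonneg (by positivity)]⟩
  have h := hasDerivAt_integral_of_dominated_loc_of_deriv_le (μ := volume.restrict D.Ω) (𝕜 := ℝ)
    (F := fun (τ : ℝ) x => |(u + τ • w) x| ^ D.α x / D.α x)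
    (F' := fun τ x => |(u + τ • w) x| ^ (D.α x - 2) * (u + τ • w) x * w x)
    (x₀ := (0 : ℝ)) (s := Metric.ball 0 1) (bound := fun x => (|u x| + |w x|) ^ D.α x)
    (Metric.ball_mem_nhds _ one_pos)
    (Eventually.of_forall fun τ => (integrableOn_S (hv τ)).1)
    (integrableOn_S (hv 0))
    (hdom 0 (Metric.mem_ball_self one_pos)).1.aestronglyMeasurable
    (Eventually.of_forall fun x τ hτ => (hdom τ hτ).2 x)
    hBi
    (Eventually.of_forall fun x τ _ => by
      have hα := D.α_gt x
      refine (((hasDerivAt_abs_rpow ((u + τ • w) x) hα).comp τ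
        (hasDerivAt_line u w x τ)).div_const (D.α x)).congr_deriv ?_
      field_simp)
  simpa [dS, S] using h.2

variable (D) in
/-- The lower order part of the energy. -/
def lower (lam : ℝ) (u : RN N → ℝ) : ℝ := lam * D.S u + D.T u / 4

variable (D) in
/-- The derivative of the lower order part of the energy. -/
def dlower (lam : ℝ) (u w : RN N → ℝ) : ℝ := lam * D.dS u w + D.dT u w / 2

lemma hasDerivAt_lower (lam : ℝ) {u w : RN N → ℝ} (hu : D.Admissible u) (hw : D.Admissible w) :
    HasDerivAt (fun τ : ℝ => D.lower lam (u + τ • w)) (D.dlower lam u w) 0 :=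
  (((hasDerivAt_S hu hw).const_mul lam).add ((hasDerivAt_T hu hw).div_const 4)).congr_deriv
    (by unfold dlower; ring)

lemma tendsto_lower (lam : ℝ) {u : ℕ → RN N → ℝ} {v : RN N → ℝ} {K : ℝ}
    (hu : ∀ n, D.Admissible (u n)) (hρu : ∀ n, D.modular (u n) ≤ K)
    (hl : ∀ᵐ x, Tendsto (fun n => u n x) atTop (𝓝 (v x))) :
    Tendsto (fun n => D.lower lam (u n)) atTop (𝓝 (D.lower lam v)) :=
  ((tendsto_S hu hρu hl).const_mul lam).add ((tendsto_T hu hρu hl).div_const 4)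

lemma tendsto_dlower (lam : ℝ) {u w : ℕ → RN N → ℝ} {v φ : RN N → ℝ} {K : ℝ}
    (hu : ∀ n, D.Admissible (u n)) (hw : ∀ n, D.Admissible (w n))
    (hρu : ∀ n, D.modular (u n) ≤ K) (hρw : ∀ n, D.modular (w n) ≤ K)
    (hl : ∀ᵐ x, Tendsto (fun n => u n x) atTop (𝓝 (v x)))
    (hlw : ∀ᵐ x, Tendsto (fun n => w n x) atTop (𝓝 (φ x))) :
    Tendsto (fun n => D.dlower lam (u n) (w n)) atTop (𝓝 (D.dlower lam v φ)) :=
  ((tendsto_dS hu hw hρu hρw hl hlw).const_mul lam).add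
    ((tendsto_dT hu hw hρu hρw hl hlw).div_const 2)

lemma dlower_add (lam : ℝ) {u v w : RN N → ℝ} (hu : D.Admissible u) (hv : D.Admissible v)
    (hw : D.Admissible w) : D.dlower lam u (v + w) = D.dlower lam u v + D.dlower lam u w := by
  have h1 : D.dT u (v + w) = D.dT u v + D.dT u w := by
    rw [dT, dT, dT, ← integral_add (integrable_dtden hu hv) (integrable_dtden hu hw)]
    congr 1; funext z
    simp only [dtden, Pi.add_apply]; ring
  have h2 : D.dS u (v + w) = D.dS u v + D.dS u w := by
    rw [dS, dS, dS, ← integral_add (integrableOn_dS hu hv) (integrableOn_dS hu hw)]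
    congr 1; funext z
    simp only [Pi.add_apply]; ring
  rw [dlower, dlower, dlower, h1, h2]; ring

lemma dlower_smul (lam c : ℝ) (u w : RN N → ℝ) :
    D.dlower lam u (c • w) = c * D.dlower lam u w := by
  have h1 : D.dT u (c • w) = c * D.dT u w := by
    rw [dT, dT, ← integral_const_mul]
    congr 1; funext z
    simp only [dtden, Pi.smul_apply, smul_eq_mul]; ring
  have h2 : D.dS u (c • w) = c * D.dS u w := by
    rw [dS, dS, ← integral_const_mul]
    congr 1; funext z
    simp only [Pi.smul_apply, smul_eq_mul]; ring
  rw [dlower, dlower, h1, h2]; ring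

end Problem

lemma abs_rpow_mul_mul_le_young {p a b : ℝ} (hp : 1 < p) :
    |a| ^ (p - 2) * a * (b - a) ≤ |b| ^ p / p - |a| ^ p / p := by
  have hpq := Real.HolderConjugate.conjExponent hp
  have hpp : 0 < p := by linarith
  have h1 : |a| ^ (p - 2) * a * b ≤ |a| ^ (p - 1) * |b| := by
    rw [← abs_abs_rpow_mul hp, ← abs_mul]; exact le_abs_self _
  have h2 := Real.young_inequality_of_nonneg (Real.rpow_nonneg (abs_nonneg a) (p - 1))
    (abs_nonneg b) hpq.symm
  have h3 : (|a| ^ (p - 1)) ^ p.conjExponent = |a| ^ p := by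
    rw [← Real.rpow_mul (abs_nonneg _), hpq.sub_one_mul_conj]
  have h4 : |a| ^ (p - 2) * a * a = |a| ^ p := by
    rcases eq_or_ne a 0 with rfl | ha
    · simp [Real.zero_rpow hpp.ne']
    · rw [mul_assoc, ← abs_mul_abs_self a, ← pow_two, ← Real.rpow_natCast,
        ← Real.rpow_add (abs_pos.2 ha)]
      norm_num
  have h5 : |a| ^ p / p.conjExponent = |a| ^ p - |a| ^ p / p := by
    have := hpq.inv_add_inv_eq_one
    rw [div_eq_mul_inv, div_eq_mul_inv, eq_sub_iff_add_eq, ← mul_add, add_comm, this, mul_one]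
  rw [h3, h5] at h2
  rw [mul_sub, h4]
  linarith

namespace Problem

variable (D : Problem N)

/-- The principal part of the energy. -/
def P (u : RN N → ℝ) : ℝ := ∫ z, gden D.s D.p u z / D.p z.1 z.2

/-- The integrand of the derivative of the principal part. -/
def eden (u w : RN N → ℝ) (z : RN N × RN N) : ℝ :=
  |u z.1 - u z.2| ^ (D.p z.1 z.2 - 2) * (u z.1 - u z.2) * (w z.1 - w z.2) /
    dist z.1 z.2 ^ ((N : ℝ) + D.s z.1 z.2 * D.p z.1 z.2)

variable {D}

lemma measurable_pden {u : RN N → ℝ} (hu : Measurable u) :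
    Measurable fun z : RN N × RN N => gden D.s D.p u z / D.p z.1 z.2 :=
  (measurable_gden D.H hu).div D.H.contP.measurable

lemma pden_nonneg (u : RN N → ℝ) (z : RN N × RN N) : 0 ≤ gden D.s D.p u z / D.p z.1 z.2 :=
  div_nonneg (gden_nonneg z) (D.H.p_pos _ _).le

lemma pden_le (u : RN N → ℝ) (z : RN N × RN N) :
    gden D.s D.p u z / D.p z.1 z.2 ≤ gden D.s D.p u z :=
  div_le_self (gden_nonneg z) (D.H.p_gt _ _).le

lemma integrable_pden {u : RN N → ℝ} (hu : D.Admissible u) :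
    Integrable fun z : RN N × RN N => gden D.s D.p u z / D.p z.1 z.2 :=
  hu.int.mono' (measurable_pden hu.meas).aestronglyMeasurable (Eventually.of_forall fun z => by
    rw [Real.norm_eq_abs, abs_of_nonneg (pden_nonneg u z)]; exact pden_le u z)

lemma P_nonneg (u : RN N → ℝ) : 0 ≤ D.P u := integral_nonneg (pden_nonneg u)

lemma P_le {u : RN N → ℝ} (hu : D.Admissible u) : D.P u ≤ D.modular u :=
  integral_mono (integrable_pden hu) hu.int (pden_le u)

lemma modular_le {u : RN N → ℝ} (hu : D.Admissible u) : D.modular u ≤ D.p₁ * D.P u := by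
  unfold modular rho P
  rw [← integral_const_mul]
  refine integral_mono hu.int ((integrable_pden hu).const_mul _) fun z => ?_
  have hp := D.H.p_pos z.1 z.2
  change gden D.s D.p u z ≤ D.p₁ * (gden D.s D.p u z / D.p z.1 z.2)
  rw [mul_div_assoc', le_div_iff₀ hp, mul_comm]
  exact mul_le_mul_of_nonneg_right (D.H.p_le _ _) (gden_nonneg z)

lemma P_smul_le {u : RN N → ℝ} (hu : D.Admissible u) {c C : ℝ}
    (h : ∀ x y, |c| ^ D.p x y ≤ C) : D.P (c • u) ≤ C * D.P u := by
  unfold P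
  rw [← integral_const_mul]
  refine integral_mono (integrable_pden (hu.smul D.H c)) ((integrable_pden hu).const_mul _)
    fun z => ?_
  simp only [gden_smul]
  rw [mul_div_assoc]
  exact mul_le_mul_of_nonneg_right (h _ _) (pden_nonneg u z)

lemma modular_smul_le {u : RN N → ℝ} (hu : D.Admissible u) {c C : ℝ}
    (h : ∀ x y, |c| ^ D.p x y ≤ C) : D.modular (c • u) ≤ C * D.modular u := by
  unfold modular rho
  rw [← integral_const_mul]
  refine integral_mono (hu.smul D.H c).int (hu.int.const_mul _) fun z => ?_
  simp only [gden_smul]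
  exact mul_le_mul_of_nonneg_right (h _ _) (gden_nonneg z)

lemma abs_eden_le (u w : RN N → ℝ) (z : RN N × RN N) :
    |D.eden u w z| ≤ 2 ^ D.p₁ * (gden D.s D.p u z + gden D.s D.p w z) := by
  have hd : 0 ≤ dist z.1 z.2 ^ ((N : ℝ) + D.s z.1 z.2 * D.p z.1 z.2) := by positivity
  unfold eden gden
  rw [← add_div, mul_div_assoc', abs_div, abs_of_nonneg hd]
  refine div_le_div_of_nonneg_right ?_ hd
  have ha := abs_nonneg (u z.1 - u z.2)
  have hb := abs_nonneg (w z.1 - w z.2)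
  refine (abs_rpow_mul_mul_le (D.H.p_gt _ _) (le_add_of_nonneg_right hb)
    (le_add_of_nonneg_left ha)).trans ?_
  have := two_pow_add D.H z.1 z.2 |u z.1 - u z.2| |w z.1 - w z.2|
  rwa [abs_abs, abs_abs, abs_of_nonneg (add_nonneg ha hb)] at this

lemma measurable_eden {u w : RN N → ℝ} (hu : Measurable u) (hw : Measurable w) :
    Measurable (D.eden u w) := by
  have h : ∀ {v : RN N → ℝ}, Measurable v → Measurable fun z : RN N × RN N => v z.1 - v z.2 :=
    fun hv => (hv.comp measurable_fst).sub (hv.comp measurable_snd)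
  exact ((((h hu).abs.pow (D.H.contP.measurable.sub_const 2)).mul (h hu)).mul (h hw)).div
    (measurable_dist_pow D.H)

lemma integrable_eden {u w : RN N → ℝ} (hu : D.Admissible u) (hw : D.Admissible w) :
    Integrable (D.eden u w) :=
  ((hu.int.add hw.int).const_mul (2 ^ D.p₁)).mono'
    (measurable_eden hu.meas hw.meas).aestronglyMeasurable (Eventually.of_forall (abs_eden_le u w))

lemma energyLHS_eq (u w : RN N → ℝ) : energyLHS D.s D.p u w = ∫ z, D.eden u w z := rfl

lemma energyLHS_add {u v w : RN N → ℝ} (hu : D.Admissible u) (hv : D.Admissible v)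
    (hw : D.Admissible w) : energyLHS D.s D.p u (v + w) =
      energyLHS D.s D.p u v + energyLHS D.s D.p u w := by
  rw [energyLHS_eq, energyLHS_eq, energyLHS_eq,
    ← integral_add (integrable_eden hu hv) (integrable_eden hu hw)]
  congr 1; funext z
  simp only [eden, Pi.add_apply]; ring

lemma energyLHS_smul (c : ℝ) (u w : RN N → ℝ) :
    energyLHS D.s D.p u (c • w) = c * energyLHS D.s D.p u w := by
  rw [energyLHS_eq, energyLHS_eq, ← integral_const_mul]
  congr 1; funext z
  simp only [eden, Pi.smul_apply, smul_eq_mul]; ring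

lemma energyLHS_self (u : RN N → ℝ) : energyLHS D.s D.p u u = D.modular u := by
  rw [energyLHS_eq]
  unfold modular rho
  congr 1; funext z
  simp only [eden, gden]
  congr 1
  rcases eq_or_ne (u z.1 - u z.2) 0 with h | h
  · simp [h, Real.zero_rpow (D.H.p_pos z.1 z.2).ne']
  · rw [mul_assoc, ← abs_mul_abs_self (u z.1 - u z.2), ← pow_two, ← Real.rpow_natCast,
      ← Real.rpow_add (abs_pos.2 h)]
    norm_num

lemma gden_line_le (u w : RN N → ℝ) {τ : ℝ} (hτ : τ ∈ Metric.ball (0 : ℝ) 1)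
    (z : RN N × RN N) :
    gden D.s D.p (u + τ • w) z ≤ 2 ^ D.p₁ * (gden D.s D.p u z + gden D.s D.p w z) := by
  refine (gden_add_le D.H z).trans ?_
  rw [gden_smul]
  rw [mem_ball_zero_iff, Real.norm_eq_abs] at hτ
  have : |τ| ^ D.p z.1 z.2 ≤ 1 := Real.rpow_le_one (abs_nonneg _) hτ.le (D.H.p_pos _ _).le
  gcongr
  exact mul_le_of_le_one_left (gden_nonneg z) this

lemma hasDerivAt_P {u w : RN N → ℝ} (hu : D.Admissible u) (hw : D.Admissible w) :
    HasDerivAt (fun τ : ℝ => D.P (u + τ • w)) (energyLHS D.s D.p u w) 0 := by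
  have hv : ∀ τ : ℝ, D.Admissible (u + τ • w) := fun τ => hu.add D.H (hw.smul D.H τ)
  have h := hasDerivAt_integral_of_dominated_loc_of_deriv_le (μ := volume) (𝕜 := ℝ)
    (F := fun (τ : ℝ) (z : RN N × RN N) => gden D.s D.p (u + τ • w) z / D.p z.1 z.2)
    (F' := fun τ z => D.eden (u + τ • w) w z)
    (x₀ := (0 : ℝ)) (s := Metric.ball 0 1)
    (bound := fun z => 2 ^ D.p₁ * (2 ^ D.p₁ * (gden D.s D.p u z + gden D.s D.p w z) +
      gden D.s D.p w z))
    (Metric.ball_mem_nhds _ one_pos)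
    (Eventually.of_forall fun τ => (integrable_pden (hv τ)).1)
    (integrable_pden (hv 0))
    (integrable_eden (hv 0) hw).1
    (Eventually.of_forall fun z τ hτ => by
      refine (abs_eden_le _ w z).trans ?_
      have := gden_line_le (D := D) u w hτ z
      gcongr)
    ((((hu.int.add hw.int).const_mul _).add hw.int).const_mul _)
    (Eventually.of_forall fun z τ _ => by
      have hp := D.H.p_gt z.1 z.2
      have h0 := (hasDerivAt_line u w z.1 τ).sub (hasDerivAt_line u w z.2 τ)
      refine ((((hasDerivAt_abs_rpow ((u + τ • w) z.1 - (u + τ • w) z.2) hp).comp τ h0).div_const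
        (dist z.1 z.2 ^ ((N : ℝ) + D.s z.1 z.2 * D.p z.1 z.2))).div_const
        (D.p z.1 z.2)).congr_deriv ?_
      have hp0 : D.p z.1 z.2 ≠ 0 := by linarith
      simp only [eden]
      field_simp)
  refine h.2.congr_deriv ?_
  simp only [zero_smul, add_zero]
  rfl

/-- Convexity of the principal part. -/
lemma energyLHS_sub_le {u w : RN N → ℝ} (hu : D.Admissible u) (hw : D.Admissible w) :
    energyLHS D.s D.p u (w - u) ≤ D.P w - D.P u := by
  rw [energyLHS_eq]
  unfold P
  rw [← integral_sub (integrable_pden hw) (integrable_pden hu)]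
  refine integral_mono (integrable_eden hu (hw.sub D.H hu))
    ((integrable_pden hw).sub (integrable_pden hu)) fun z => ?_
  have h := abs_rpow_mul_mul_le_young (a := u z.1 - u z.2) (b := w z.1 - w z.2)
    (D.H.p_gt z.1 z.2)
  have hd : 0 ≤ dist z.1 z.2 ^ ((N : ℝ) + D.s z.1 z.2 * D.p z.1 z.2) := by positivity
  have h' := div_le_div_of_nonneg_right h hd
  refine (le_of_eq ?_).trans (h'.trans (le_of_eq ?_))
  · simp only [eden, Pi.sub_apply]
    congr 2; ring
  · simp only [gden]; ring

lemma ae_tendsto_gden {u : ℕ → RN N → ℝ} {v : RN N → ℝ}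
    (hl : ∀ᵐ x, Tendsto (fun n => u n x) atTop (𝓝 (v x))) :
    ∀ᵐ z : RN N × RN N, Tendsto (fun n => gden D.s D.p (u n) z) atTop (𝓝 (gden D.s D.p v z)) := by
  have h1 : ∀ᵐ z : RN N × RN N, Tendsto (fun n => u n z.1) atTop (𝓝 (v z.1)) :=
    Measure.quasiMeasurePreserving_fst.ae hl
  have h2 : ∀ᵐ z : RN N × RN N, Tendsto (fun n => u n z.2) atTop (𝓝 (v z.2)) :=
    Measure.quasiMeasurePreserving_snd.ae hl
  filter_upwards [h1, h2] with z hz1 hz2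
  exact ((hz1.sub hz2).abs.rpow_const (Or.inr (D.H.p_pos _ _).le)).div_const _

lemma P_le_of_tendsto {u : ℕ → RN N → ℝ} {v : RN N → ℝ} {C : ℝ} (hu : ∀ n, D.Admissible (u n))
    (hb : ∀ᶠ n in atTop, D.P (u n) ≤ C)
    (hl : ∀ᵐ x, Tendsto (fun n => u n x) atTop (𝓝 (v x))) : D.P v ≤ C := by
  refine (integrable_and_integral_le_of_fatou (fun n => integrable_pden (hu n))
    (fun n z => pden_nonneg (u n) z) hb ?_).2
  filter_upwards [ae_tendsto_gden (D := D) hl] with z hz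
  exact hz.div_const _

lemma tendsto_P {u : ℕ → RN N → ℝ} {v : RN N → ℝ} {B : RN N × RN N → ℝ}
    (hu : ∀ n, D.Admissible (u n)) (hB : Integrable B) (hle : ∀ n z, gden D.s D.p (u n) z ≤ B z)
    (hl : ∀ x, Tendsto (fun n => u n x) atTop (𝓝 (v x))) :
    Tendsto (fun n => D.P (u n)) atTop (𝓝 (D.P v)) := by
  refine tendsto_integral_of_dominated_convergence B
    (fun n => (integrable_pden (hu n)).1) hB (fun n => Eventually.of_forall fun z => ?_) ?_
  · rw [Real.norm_eq_abs, abs_of_nonneg (pden_nonneg _ z)]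
    exact (pden_le _ z).trans (hle n z)
  · filter_upwards [ae_tendsto_gden (D := D) (Eventually.of_forall hl)] with z hz
    exact hz.div_const _

lemma tendsto_energyLHS {u : ℕ → RN N → ℝ} {v w : RN N → ℝ} {B : RN N × RN N → ℝ}
    (hu : ∀ n, D.Admissible (u n)) (hw : D.Admissible w) (hB : Integrable B)
    (hle : ∀ n z, gden D.s D.p (u n) z ≤ B z)
    (hl : ∀ x, Tendsto (fun n => u n x) atTop (𝓝 (v x))) :
    Tendsto (fun n => energyLHS D.s D.p (u n) w) atTop (𝓝 (energyLHS D.s D.p v w)) := by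
  refine tendsto_integral_of_dominated_convergence
    (fun z => 2 ^ D.p₁ * (B z + gden D.s D.p w z))
    (fun n => (integrable_eden (hu n) hw).1) ((hB.add hw.int).const_mul _)
    (fun n => Eventually.of_forall fun z => ?_) (Eventually.of_forall fun z => ?_)
  · refine (abs_eden_le (u n) w z).trans ?_
    have := hle n z
    gcongr
  · exact ((((continuous_abs_rpow_mul (D.H.p_gt z.1 z.2)).tendsto _).comp
      ((hl z.1).sub (hl z.2))).mul_const _).div_const _

variable (D) in
/-- The energy functional. -/
def energy (lam : ℝ) (u : RN N → ℝ) : ℝ := D.P u - D.lower lam u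

variable (D) in
/-- The derivative of the energy functional. -/
def denergy (lam : ℝ) (u w : RN N → ℝ) : ℝ := energyLHS D.s D.p u w - D.dlower lam u w

lemma hasDerivAt_energy (lam : ℝ) {u w : RN N → ℝ} (hu : D.Admissible u) (hw : D.Admissible w) :
    HasDerivAt (fun τ : ℝ => D.energy lam (u + τ • w)) (D.denergy lam u w) 0 :=
  (hasDerivAt_P hu hw).sub (hasDerivAt_lower lam hu hw)

lemma denergy_add (lam : ℝ) {u v w : RN N → ℝ} (hu : D.Admissible u) (hv : D.Admissible v)
    (hw : D.Admissible w) : D.denergy lam u (v + w) = D.denergy lam u v + D.denergy lam u w := by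
  rw [denergy, denergy, denergy, energyLHS_add hu hv hw, dlower_add lam hu hv hw]; ring

lemma denergy_smul (lam c : ℝ) (u w : RN N → ℝ) :
    D.denergy lam u (c • w) = c * D.denergy lam u w := by
  rw [denergy, denergy, energyLHS_smul, dlower_smul]; ring

lemma P_congr {u v : RN N → ℝ} (h : u =ᵐ[volume] v) : D.P u = D.P v := by
  refine integral_congr_ae ?_
  filter_upwards [gden_congr_ae (s := D.s) (p := D.p) h] with z hz
  rw [hz]

lemma lower_congr (lam : ℝ) {u v : RN N → ℝ} (h : u =ᵐ[volume] v) :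
    D.lower lam u = D.lower lam v := by
  have h' := ae_restrict_of_ae (s := D.Ω) h
  have h1 : D.S u = D.S v := by
    refine integral_congr_ae ?_
    filter_upwards [h'] with x hx
    rw [hx]
  have h2 : D.T u = D.T v := by
    refine integral_congr_ae ?_
    filter_upwards [D.ae_ν_fst h', D.ae_ν_snd h'] with z hz1 hz2
    rw [tden, tden, hz1, hz2]
  rw [lower, lower, h1, h2]

lemma energy_congr (lam : ℝ) {u v : RN N → ℝ} (h : u =ᵐ[volume] v) :
    D.energy lam u = D.energy lam v := by
  rw [energy, energy, P_congr h, lower_congr lam h]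

lemma denergy_congr_right (lam : ℝ) (u : RN N → ℝ) {v w : RN N → ℝ} (h : v =ᵐ[volume] w) :
    D.denergy lam u v = D.denergy lam u w := by
  have h' := ae_restrict_of_ae (s := D.Ω) h
  have h1 : D.dS u v = D.dS u w := by
    refine integral_congr_ae ?_
    filter_upwards [h'] with x hx
    rw [hx]
  have h2 : D.dT u v = D.dT u w := by
    refine integral_congr_ae ?_
    filter_upwards [D.ae_ν_snd h'] with z hz
    rw [dtden, dtden, hz]
  have h3 : energyLHS D.s D.p u v = energyLHS D.s D.p u w := by
    refine integral_congr_ae ?_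
    have e1 : ∀ᵐ z : RN N × RN N, v z.1 = w z.1 := Measure.quasiMeasurePreserving_fst.ae h
    have e2 : ∀ᵐ z : RN N × RN N, v z.2 = w z.2 := Measure.quasiMeasurePreserving_snd.ae h
    filter_upwards [e1, e2] with z hz1 hz2
    rw [hz1, hz2]
  rw [denergy, denergy, dlower, dlower, h1, h2, h3]

end Problem

namespace Problem

variable (D : Problem N)

lemma Θ_pos : 0 < D.Θ := D.H.p₁_pos.trans D.Θ_gt

lemma ae_ar : ∀ᵐ x ∂(volume.restrict D.Ω), ∀ τ : ℝ, 0 ≤ Fant D.f x τ ∧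
    D.Θ * Fant D.f x τ ≤ 2 * (τ * D.f x τ) ∧ (τ ≠ 0 → 0 < Fant D.f x τ) := by
  refine (ae_restrict_iff' D.measurableSet).2 ?_
  filter_upwards [D.ar] with x hx hxΩ τ
  rcases eq_or_ne τ 0 with rfl | hτ
  · simp [Fant]
  · obtain ⟨h1, h2⟩ := hx hxΩ τ hτ
    have := (mul_pos_iff_of_pos_left D.Θ_pos).1 h1
    exact ⟨this.le, h2, fun _ => this⟩

variable {D}

lemma rpow_mul_Fant_le {x : RN N} (hx : ∀ τ : ℝ, D.Θ * Fant D.f x τ ≤ 2 * (τ * D.f x τ))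
    {t : ℝ} (ht : 1 ≤ t) (τ : ℝ) : t ^ (D.Θ / 2) * Fant D.f x τ ≤ Fant D.f x (t * τ) := by
  have hd : ∀ σ : ℝ, 0 < σ → HasDerivAt (fun σ : ℝ => σ ^ (-(D.Θ / 2)) * Fant D.f x (σ * τ))
      (-(D.Θ / 2) * σ ^ (-(D.Θ / 2) - 1) * Fant D.f x (σ * τ) +
        σ ^ (-(D.Θ / 2)) * (D.f x (σ * τ) * τ)) σ := fun σ hσ => by
    have h1 := Real.hasDerivAt_rpow_const (x := σ) (p := -(D.Θ / 2)) (Or.inl hσ.ne')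
    have h2 := (D.car.hasDerivAt_Fant x (σ * τ)).comp σ ((hasDerivAt_id σ).mul_const τ)
    refine (h1.mul h2).congr_deriv ?_
    simp
  have hmono : MonotoneOn (fun σ : ℝ => σ ^ (-(D.Θ / 2)) * Fant D.f x (σ * τ)) (Ici 1) := by
    refine monotoneOn_of_hasDerivWithinAt_nonneg (convex_Ici 1)
      (fun σ hσ => (hd σ (zero_lt_one.trans_le hσ)).continuousAt.continuousWithinAt)
      (fun σ hσ => (hd σ (by rw [interior_Ici] at hσ; exact zero_lt_one.trans hσ)).hasDerivWithinAt)
      fun σ hσ => ?_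
    have hσ0 : 0 < σ := by rw [interior_Ici] at hσ; exact zero_lt_one.trans hσ
    have h := hx (σ * τ)
    have e : σ ^ (-(D.Θ / 2)) = σ ^ (-(D.Θ / 2) - 1) * σ := by
      rw [← Real.rpow_add_one hσ0.ne']; ring_nf
    rw [e]
    have hp : 0 ≤ σ ^ (-(D.Θ / 2) - 1) := by positivity
    have : 0 ≤ σ ^ (-(D.Θ / 2) - 1) * (2 * (σ * τ * D.f x (σ * τ)) - D.Θ * Fant D.f x (σ * τ)) :=
      mul_nonneg hp (by linarith)
    nlinarith
  have h := hmono (mem_Ici.2 le_rfl) (mem_Ici.2 ht) ht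
  simp only [Real.one_rpow, one_mul] at h
  have ht0 : 0 < t := zero_lt_one.trans_le ht
  calc _ ≤ t ^ (D.Θ / 2) * (t ^ (-(D.Θ / 2)) * Fant D.f x (t * τ)) := by gcongr
    _ = _ := by rw [← mul_assoc, ← Real.rpow_add ht0]; simp

lemma T_nonneg (u : RN N → ℝ) : 0 ≤ D.T u := by
  refine integral_nonneg_of_ae ?_
  filter_upwards [D.ae_ν_fst D.ae_ar, D.ae_ν_snd D.ae_ar] with z h1 h2
  have := (h1 (u z.1)).1
  have := (h2 (u z.2)).1
  simp only [Pi.zero_apply, tden]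
  positivity

lemma S_nonneg (u : RN N → ℝ) : 0 ≤ D.S u :=
  integral_nonneg fun x => div_nonneg (by positivity) (by linarith [D.α_gt x])

lemma rpow_mul_T_le {u : RN N → ℝ} (hu : D.Admissible u) {t : ℝ} (ht : 1 ≤ t) :
    t ^ D.Θ * D.T u ≤ D.T (t • u) := by
  unfold T
  rw [← integral_const_mul]
  refine integral_mono_ae ((integrable_tden hu).const_mul _) (integrable_tden (hu.smul D.H t)) ?_
  filter_upwards [D.ae_ν_fst D.ae_ar, D.ae_ν_snd D.ae_ar] with z h1 h2
  have ht0 : 0 < t := zero_lt_one.trans_le ht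
  have a1 := rpow_mul_Fant_le (fun τ => (h1 τ).2.1) ht (u z.1)
  have a2 := rpow_mul_Fant_le (fun τ => (h2 τ).2.1) ht (u z.2)
  have b1 := (h1 (u z.1)).1
  have b2 := (h2 (u z.2)).1
  have e : t ^ D.Θ = t ^ (D.Θ / 2) * t ^ (D.Θ / 2) := by
    rw [← Real.rpow_add ht0]; ring_nf
  simp only [tden, Pi.smul_apply, smul_eq_mul]
  rw [e, mul_div_assoc']
  refine div_le_div_of_nonneg_right ?_ (by positivity)
  calc _ = (t ^ (D.Θ / 2) * Fant D.f z.1 (u z.1)) * (t ^ (D.Θ / 2) * Fant D.f z.2 (u z.2)) := by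
        ring
    _ ≤ _ := mul_le_mul a1 a2 (by positivity) ((by positivity : (0 : ℝ) ≤ _).trans a1)

lemma mul_T_le_dT {u : RN N → ℝ} (hu : D.Admissible u) : D.Θ / 2 * D.T u ≤ D.dT u u := by
  unfold T dT
  rw [← integral_const_mul]
  refine integral_mono_ae ((integrable_tden hu).const_mul _) (integrable_dtden hu hu) ?_
  filter_upwards [D.ae_ν_fst D.ae_ar, D.ae_ν_snd D.ae_ar] with z h1 h2
  have b1 := (h1 (u z.1)).1
  have b2 := (h2 (u z.2)).2.1
  simp only [tden, dtden]
  rw [mul_div_assoc']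
  refine div_le_div_of_nonneg_right ?_ (by positivity)
  nlinarith

lemma frequently_ne_zero {u : RN N → ℝ} (hu : D.Admissible u)
    (h0 : ¬ (u =ᵐ[volume] fun _ => (0 : ℝ))) :
    ∃ᵐ x ∂(volume.restrict D.Ω), u x ≠ 0 := by
  intro hcon
  refine h0 ?_
  filter_upwards [(ae_restrict_iff' D.measurableSet).1 hcon] with x hx
  by_cases hxΩ : x ∈ D.Ω
  · exact not_not.1 (hx hxΩ)
  · exact hu.zero x hxΩ

lemma S_pos {u : RN N → ℝ} (hu : D.Admissible u) (h0 : ¬ (u =ᵐ[volume] fun _ => (0 : ℝ))) :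
    0 < D.S u := by
  refine lt_of_le_of_ne (S_nonneg u) fun h => frequently_ne_zero hu h0 ?_
  have := (integral_eq_zero_iff_of_nonneg (fun x => div_nonneg (by positivity)
    (by linarith [D.α_gt x])) (integrableOn_S hu)).1 h.symm
  filter_upwards [this] with x hx
  have hα := D.α_gt x
  simp only [Pi.zero_apply, _root_.div_eq_zero_iff] at hx
  rcases hx with hx | hx
  · rw [Real.rpow_eq_zero (abs_nonneg _) (by linarith), abs_eq_zero] at hx
    simpa using hx
  · linarith

lemma T_pos {u : RN N → ℝ} (hu : D.Admissible u) (h0 : ¬ (u =ᵐ[volume] fun _ => (0 : ℝ))) :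
    0 < D.T u := by
  refine lt_of_le_of_ne (T_nonneg u) fun h => ?_
  have hnn : 0 ≤ᵐ[D.ν] D.tden u := by
    filter_upwards [D.ae_ν_fst D.ae_ar, D.ae_ν_snd D.ae_ar] with z h1 h2
    have := (h1 (u z.1)).1
    have := (h2 (u z.2)).1
    simp only [Pi.zero_apply, tden]
    positivity
  have hz := Measure.ae_ae_of_ae_prod ((integral_eq_zero_iff_of_nonneg_ae hnn
    (integrable_tden hu)).1 h.symm)
  have hfr := frequently_ne_zero hu h0
  obtain ⟨x, hx, hxz, hxar⟩ := (hfr.and_eventually (hz.and D.ae_ar)).exists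
  have : Nontrivial (RN N) := by
    apply Module.nontrivial_of_finrank_pos (R := ℝ)
    rw [finrank_euclideanSpace_fin]; exact D.H.N_pos'
  have hne : ∀ᵐ y ∂(volume.restrict D.Ω), y ≠ x :=
    ae_restrict_of_ae (Measure.ae_ne volume x)
  refine hfr ?_
  filter_upwards [hxz, hne, D.ae_ar] with y hy hyx hyar
  have h1 := (hxar (u x)).2.2 hx
  have hd : 0 < dist x y := dist_pos.2 hyx.symm
  intro hy0
  have h2 := (hyar (u y)).2.2 hy0
  have : 0 < D.tden u (x, y) := by unfold tden; positivity
  exact this.ne' hy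

lemma modular_pos {u : RN N → ℝ} (hu : D.Admissible u)
    (h0 : ¬ (u =ᵐ[volume] fun _ => (0 : ℝ))) : 0 < D.modular u := by
  refine lt_of_le_of_ne rho_nonneg fun h => h0 ?_
  obtain ⟨C, hC0, hC⟩ := exists_integral_abs_bound D.H D.isOpen D.bdd
  have hi := (hC u hu).1
  have hb : ∀ c : ℝ, 0 ≤ c → c * ∫ x, |u x| ≤ C := fun c hc => by
    have h1 := (hC _ (hu.smul D.H c)).2
    have h2 := rho_smul_le_max D.H hu c
    rw [show rho D.s D.p u = 0 from h.symm, mul_zero] at h2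
    have h3 : rho D.s D.p (c • u) = 0 := le_antisymm h2 rho_nonneg
    rw [h3, add_zero, mul_one] at h1
    simpa [abs_mul, abs_of_nonneg hc, integral_const_mul] using h1
  have hz : ∫ x, |u x| = 0 := by
    by_contra hne
    have hpos : 0 < ∫ x, |u x| := lt_of_le_of_ne (integral_nonneg fun x => abs_nonneg _)
      (Ne.symm hne)
    have := hb ((C + 1) / ∫ x, |u x|) (by positivity)
    rw [div_mul_cancel₀ _ hne] at this
    linarith
  have := (integral_eq_zero_iff_of_nonneg (fun x => abs_nonneg (u x)) hi.abs).1 hz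
  filter_upwards [this] with x hx
  simpa using hx

lemma P_pos {u : RN N → ℝ} (hu : D.Admissible u) (h0 : ¬ (u =ᵐ[volume] fun _ => (0 : ℝ))) :
    0 < D.P u := by
  have h1 := modular_pos hu h0
  have h2 := modular_le hu
  exact pos_of_mul_pos_right (h1.trans_le h2) D.H.p₁_pos.le

variable (D)

lemma exists_S_le : ∃ C, 0 ≤ C ∧ ∀ u, D.Admissible u → D.S u ≤ C * (1 + D.modular u) := by
  obtain ⟨C, hC0, hC⟩ := exists_poincare D.H D.isOpen D.bdd
  refine ⟨volume.real D.Ω + C, by positivity, fun u hu => ?_⟩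
  obtain ⟨hi, hle⟩ := hC u hu
  have hone : IntegrableOn (fun _ : RN N => (1 : ℝ)) D.Ω := integrableOn_const D.volume_ne_top
  have hsum : IntegrableOn (fun x => 1 + |u x| ^ D.p₀) D.Ω := hone.add hi
  have hρ : 0 ≤ D.modular u := rho_nonneg
  have hv : 0 ≤ volume.real D.Ω := measureReal_nonneg
  calc D.S u ≤ ∫ x in D.Ω, (1 + |u x| ^ D.p₀) := by
        refine integral_mono (integrableOn_S hu) hsum fun x => ?_
        have hα := D.α_gt x
        exact (div_le_self (by positivity) hα.le).trans (rpow_le_one_add_rpow (abs_nonneg _)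
          (by linarith) (by linarith [D.α_le x, D.a₂_lt]))
    _ = volume.real D.Ω + ∫ x in D.Ω, |u x| ^ D.p₀ := by
        rw [integral_add hone hi, setIntegral_const, smul_eq_mul, mul_one]
    _ ≤ volume.real D.Ω + C * (1 + D.modular u) := by gcongr
    _ ≤ _ := by nlinarith

lemma exists_T_le : ∃ C, 0 ≤ C ∧ ∀ u, D.Admissible u → 0 < D.modular u → D.modular u ≤ 1 →
    D.T u ≤ C * D.modular u ^ 2 := by
  obtain ⟨C, hC0, hC⟩ := D.exists_integral_bound 1
  refine ⟨C, hC0, fun u hu h0 h1 => ?_⟩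
  have hp₁ := D.H.p₁_pos
  set ρ := D.modular u with hρ
  set τ := ρ ^ (1 / D.p₁) with hτ
  have hτ0 : 0 < τ := by positivity
  have hτ1 : τ ≤ 1 := Real.rpow_le_one h0.le h1 (by positivity)
  have hτp : τ ^ D.p₁ = ρ := by
    rw [hτ, ← Real.rpow_mul h0.le, one_div_mul_cancel hp₁.ne', Real.rpow_one]
  have hv := hu.smul D.H τ⁻¹
  have hρv : D.modular (τ⁻¹ • u) ≤ 1 := by
    refine (modular_smul_le hu (C := (τ⁻¹) ^ D.p₁) fun x y => ?_).trans (le_of_eq ?_)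
    · rw [abs_of_pos (by positivity)]
      exact Real.rpow_le_rpow_of_exponent_le (one_le_inv_iff₀.2 ⟨hτ0, hτ1⟩) (D.H.p_le x y)
    · rw [Real.inv_rpow hτ0.le, hτp]
      exact inv_mul_cancel₀ h0.ne'
  have hr₀ : 0 < D.r₀ := by linarith [D.r₀_gt]
  have hdom : D.Dominated (τ⁻¹ • u) (τ⁻¹ • u) (fun z => (τ ^ (2 * D.r₀))⁻¹ * D.tden u z) := by
    refine ⟨(dominated_tden (D := D) hu.meas
      (fun x => by linarith [abs_nonneg (u x)] : ∀ x, |u x| ≤ |u x| + |u x|)).1.const_mul _,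
      fun x hx y hy => ?_⟩
    have key : ∀ x ∈ D.Ω, |Fant D.f x (u x)| ≤
        τ ^ D.r₀ * (D.M * (|(τ⁻¹ • u) x| + |(τ⁻¹ • u) x|) ^ D.r x) := by
      intro x hx
      have hM := D.M_pos
      have hr := D.r_pos x
      have hux : |u x| = τ * |(τ⁻¹ • u) x| := by
        rw [Pi.smul_apply, smul_eq_mul, abs_mul, abs_of_pos (inv_pos.2 hτ0),
          mul_inv_cancel_left₀ hτ0.ne']
      calc |Fant D.f x (u x)| ≤ D.M * |u x| ^ D.r x := D.abs_Fant_le hx _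
        _ = D.M * (τ ^ D.r x * |(τ⁻¹ • u) x| ^ D.r x) := by
            rw [hux, Real.mul_rpow hτ0.le (abs_nonneg _)]
        _ ≤ D.M * (τ ^ D.r₀ * (|(τ⁻¹ • u) x| + |(τ⁻¹ • u) x|) ^ D.r x) := by
            refine mul_le_mul_of_nonneg_left (mul_le_mul
              (Real.rpow_le_rpow_of_exponent_ge hτ0 hτ1 (D.r_ge x))
              (Real.rpow_le_rpow (abs_nonneg _) (by linarith [abs_nonneg ((τ⁻¹ • u) x)])
                (by linarith)) (by positivity) (by positivity)) hM.le
        _ = _ := by ring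
    have hk : 0 ≤ 1 / dist x y ^ D.μ x y := by positivity
    have hτr : τ ^ (2 * D.r₀) = τ ^ D.r₀ * τ ^ D.r₀ := by
      rw [two_mul, Real.rpow_add hτ0]
    have hne : τ ^ D.r₀ ≠ 0 := by positivity
    have h1 := mul_le_mul (key x hx) (key y hy) (abs_nonneg _)
      ((abs_nonneg _).trans (key x hx))
    change |(τ ^ (2 * D.r₀))⁻¹ * (Fant D.f x (u x) * Fant D.f y (u y) / dist x y ^ D.μ x y)| ≤ _
    rw [div_eq_mul_one_div, abs_mul, abs_mul, abs_mul, abs_of_nonneg hk,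
      abs_of_nonneg (by positivity : 0 ≤ (τ ^ (2 * D.r₀))⁻¹), hτr]
    calc _ ≤ (τ ^ D.r₀ * τ ^ D.r₀)⁻¹ * (τ ^ D.r₀ *
          (D.M * (|(τ⁻¹ • u) x| + |(τ⁻¹ • u) x|) ^ D.r x) * (τ ^ D.r₀ *
          (D.M * (|(τ⁻¹ • u) y| + |(τ⁻¹ • u) y|) ^ D.r y)) * (1 / dist x y ^ D.μ x y)) := by
          gcongr
      _ = _ := by field_simp
  have hI := (hC _ _ hv hv hρv hρv _ hdom).2
  rw [integral_const_mul, abs_mul, abs_of_nonneg (by positivity : 0 ≤ (τ ^ (2 * D.r₀))⁻¹),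
    inv_mul_le_iff₀ (by positivity)] at hI
  have hτ2 : τ ^ (2 * D.r₀) ≤ ρ ^ 2 := by
    rw [← hτp, ← Real.rpow_natCast, ← Real.rpow_mul hτ0.le]
    refine Real.rpow_le_rpow_of_exponent_ge hτ0 hτ1 ?_
    push_cast
    linarith [D.r₀_gt]
  calc D.T u ≤ τ ^ (2 * D.r₀) * C := (le_abs_self _).trans hI
    _ ≤ C * ρ ^ 2 := by rw [mul_comm]; gcongr

lemma exists_geometry : ∃ R Λ κ, 0 < R ∧ 0 < Λ ∧ 0 < κ ∧ ∀ lam, 0 < lam → lam < Λ →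
    (∀ u, D.Admissible u → D.P u = R → R / 2 ≤ D.energy lam u) ∧
    ∀ u, D.Admissible u → D.denergy lam u u = 0 →
      κ * D.modular u ≤ D.energy lam u + κ := by
  obtain ⟨CS, hCS0, hCS⟩ := D.exists_S_le
  obtain ⟨CT, hCT0, hCT⟩ := D.exists_T_le
  have hp₁ := D.H.p₁_pos
  have hΘ := D.Θ_pos
  set R := min (1 / D.p₁) (1 / (CT * D.p₁ ^ 2 + 1)) with hR
  have hR0 : 0 < R := by positivity
  have hR1 : D.p₁ * R ≤ 1 := by
    calc D.p₁ * R ≤ D.p₁ * (1 / D.p₁) := by gcongr; exact min_le_left _ _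
      _ = 1 := mul_one_div_cancel hp₁.ne'
  have hR2 : CT * D.p₁ ^ 2 * R ≤ 1 := by
    calc CT * D.p₁ ^ 2 * R ≤ (CT * D.p₁ ^ 2 + 1) * (1 / (CT * D.p₁ ^ 2 + 1)) := by
          gcongr
          · linarith
          · exact min_le_right _ _
      _ = 1 := mul_one_div_cancel (by positivity)
  set κ := (1 / D.p₁ - 1 / D.Θ) / 2 with hκ
  have hκ0 : 0 < κ := by
    have := one_div_lt_one_div_of_lt hp₁ D.Θ_gt
    rw [hκ]; linarith
  refine ⟨R, min (R / (8 * (CS + 1))) (κ / (CS + 1)), κ, hR0, by positivity, hκ0,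
    fun lam hl0 hl => ⟨fun u hu hP => ?_, fun u hu hd => ?_⟩⟩
  · have hl1 : lam * (CS + 1) ≤ R / 8 := by
      have := hl.le.trans (min_le_left _ _)
      rw [le_div_iff₀ (by positivity)] at this
      linarith
    have hm := modular_le hu
    rw [hP] at hm
    have hm0 : 0 < D.modular u := hR0.trans_le (hP ▸ P_le hu)
    have hS := hCS u hu
    have hT := hCT u hu hm0 (hm.trans hR1)
    have hS' : lam * D.S u ≤ R / 4 := by
      calc lam * D.S u ≤ lam * (CS * (1 + 1)) := by
            gcongr; exact hS.trans (by gcongr; exact hm.trans hR1)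
        _ ≤ 2 * (lam * (CS + 1)) := by nlinarith
        _ ≤ R / 4 := by linarith
    have hT' : D.T u ≤ R := by
      calc D.T u ≤ CT * (D.p₁ * R) ^ 2 := hT.trans (by gcongr)
        _ = CT * D.p₁ ^ 2 * R * R := by ring
        _ ≤ 1 * R := by gcongr
        _ = R := one_mul R
    unfold energy lower
    rw [hP]; linarith
  · have hl1 : lam * CS ≤ κ := by
      have := hl.le.trans (min_le_right _ _)
      rw [le_div_iff₀ (by positivity)] at this
      linarith
    have hm0 : 0 ≤ D.modular u := rho_nonneg
    have hS := hCS u hu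
    have hm := modular_le hu
    have hT := mul_T_le_dT hu
    have hdS : 0 ≤ D.dS u u := by
      refine integral_nonneg fun x => ?_
      simp only [Pi.zero_apply]
      rw [mul_assoc]
      exact mul_nonneg (by positivity) (mul_self_nonneg _)
    unfold denergy dlower at hd
    rw [energyLHS_self] at hd
    have hS' : lam * D.S u ≤ κ * (1 + D.modular u) := by
      calc lam * D.S u ≤ lam * (CS * (1 + D.modular u)) := by gcongr
        _ = lam * CS * (1 + D.modular u) := by ring
        _ ≤ _ := by gcongr
    have h1 : D.modular u / D.p₁ ≤ D.P u := by
      rw [div_le_iff₀ hp₁]; linarith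
    have h2 : D.T u / 4 ≤ D.modular u / D.Θ - lam * D.dS u u / D.Θ + 0 + (D.T u / 4 -
        D.dT u u / (2 * D.Θ)) + (D.dT u u / (2 * D.Θ) - (D.modular u - lam * D.dS u u) / D.Θ) := by
      apply le_of_eq; ring
    have h3 : D.modular u - lam * D.dS u u = D.dT u u / 2 := by linarith
    have h4 : D.T u / 4 ≤ D.dT u u / (2 * D.Θ) := by
      rw [le_div_iff₀ (by positivity)]; linarith
    have h5 : D.dT u u / (2 * D.Θ) = (D.modular u - lam * D.dS u u) / D.Θ := by
      rw [h3]; field_simp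
    have h6 : (D.modular u - lam * D.dS u u) / D.Θ ≤ D.modular u / D.Θ :=
      div_le_div_of_nonneg_right (by linarith [mul_nonneg hl0.le hdS]) hΘ.le
    have h7 : D.modular u / D.p₁ - D.modular u / D.Θ = 2 * κ * D.modular u := by
      rw [hκ]; ring
    unfold energy lower
    linarith

lemma exists_far (R : ℝ) : ∃ e, D.Admissible e ∧ R < D.P e ∧ D.P e ≤ D.T e / 4 := by
  obtain ⟨φ, hφ, hφ0⟩ := exists_adm_ne_zero D.H D.isOpen D.bdd D.nonempty
  have hP := P_pos hφ hφ0
  have hT := T_pos hφ hφ0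
  have hlim : Tendsto (fun t : ℝ => t ^ (D.Θ - D.p₁) * D.T φ) atTop atTop :=
    (tendsto_rpow_atTop (by linarith [D.Θ_gt])).atTop_mul_const hT
  obtain ⟨t, ht1, ht2, ht3⟩ := ((eventually_ge_atTop 1).and ((eventually_gt_atTop (R / D.P φ)).and
    (hlim.eventually_ge_atTop (4 * D.P φ)))).exists
  have ht0 : 0 < t := zero_lt_one.trans_le ht1
  have hA := hφ.smul D.H t
  refine ⟨t • φ, hA, ?_, ?_⟩
  · have h := P_smul_le hA (c := t⁻¹) (C := t⁻¹) fun x y => by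
      rw [abs_of_pos (inv_pos.2 ht0)]
      have := Real.rpow_le_rpow_of_exponent_ge (inv_pos.2 ht0) (inv_le_one_of_one_le₀ ht1)
        (D.H.p_gt x y).le
      rwa [Real.rpow_one] at this
    rw [smul_smul, inv_mul_cancel₀ ht0.ne', one_smul, le_inv_mul_iff₀ ht0] at h
    rw [div_lt_iff₀ hP] at ht2
    linarith
  · have h1 := P_smul_le hφ (c := t) (C := t ^ D.p₁) fun x y => by
      rw [abs_of_pos ht0]; exact Real.rpow_le_rpow_of_exponent_le ht1 (D.H.p_le x y)
    have h2 := rpow_mul_T_le hφ ht1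
    have h3 : t ^ D.Θ = t ^ D.p₁ * t ^ (D.Θ - D.p₁) := by
      rw [← Real.rpow_add ht0]; ring_nf
    rw [h3] at h2
    have h4 : t ^ D.p₁ * (4 * D.P φ) ≤ t ^ D.p₁ * (t ^ (D.Θ - D.p₁) * D.T φ) := by gcongr
    linarith

end Problem

namespace Problem

variable {D : Problem N}

lemma rpow_mul_S_le {u : RN N → ℝ} (hu : D.Admissible u) {t : ℝ} (ht : 0 < t) (ht1 : t ≤ 1) :
    t ^ D.a₂ * D.S u ≤ D.S (t • u) := by
  unfold S
  rw [← integral_const_mul]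
  refine integral_mono ((integrableOn_S hu).const_mul _) (integrableOn_S (hu.smul D.H t))
    fun x => ?_
  have hα := D.α_gt x
  simp only [Pi.smul_apply, smul_eq_mul, abs_mul, abs_of_pos ht]
  rw [Real.mul_rpow ht.le (abs_nonneg _), ← mul_div_assoc]
  have := Real.rpow_le_rpow_of_exponent_ge ht ht1 (D.α_le x)
  gcongr

lemma exists_energy_neg {lam R : ℝ} (hlam : 0 < lam) (hR : 0 < R) :
    ∃ u, D.Admissible u ∧ D.P u ≤ R ∧ D.energy lam u < 0 := by
  obtain ⟨φ, hφ, hφ0⟩ := exists_adm_ne_zero D.H D.isOpen D.bdd D.nonempty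
  have hS := S_pos hφ hφ0
  have hp₀ := D.H.p₀_gt
  have hlim : ∀ e : ℝ, 0 < e → Tendsto (fun t : ℝ => t ^ e * D.P φ) (𝓝[>] 0) (𝓝 0) := fun e he => by
    have := (Real.continuousAt_rpow_const 0 e (Or.inr he.le)).tendsto.mul_const (D.P φ)
    rw [Real.zero_rpow he.ne', zero_mul] at this
    exact this.mono_left nhdsWithin_le_nhds
  obtain ⟨t, ht0, ht1, hA, hB⟩ := ((eventually_mem_nhdsWithin (a := (0 : ℝ)) (s := Ioi 0)).and
    (((eventually_le_nhds zero_lt_one).filter_mono nhdsWithin_le_nhds).and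
    (((hlim D.p₀ (by linarith)).eventually_le_const hR).and
    ((hlim (D.p₀ - D.a₂) (by linarith [D.a₂_lt])).eventually_lt_const (mul_pos hlam hS))))).exists
  have ht0 : 0 < t := ht0
  have hP : D.P (t • φ) ≤ t ^ D.p₀ * D.P φ := P_smul_le hφ fun x y => by
    rw [abs_of_pos ht0]
    exact Real.rpow_le_rpow_of_exponent_ge ht0 ht1 (D.H.p_ge x y)
  refine ⟨t • φ, hφ.smul D.H t, hP.trans hA, ?_⟩
  have h2 := rpow_mul_S_le hφ ht0 ht1
  have h3 := T_nonneg (D := D) (t • φ)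
  have h4 : t ^ D.p₀ = t ^ D.a₂ * t ^ (D.p₀ - D.a₂) := by rw [← Real.rpow_add ht0]; ring_nf
  have h5 : t ^ D.a₂ * (t ^ (D.p₀ - D.a₂) * D.P φ) < t ^ D.a₂ * (lam * D.S φ) := by gcongr
  have h6 := mul_le_mul_of_nonneg_left h2 hlam.le
  rw [h4] at hP
  unfold energy lower
  linarith

lemma exists_lower_le (D : Problem N) (lam K : ℝ) :
    ∃ C, ∀ u, D.Admissible u → D.modular u ≤ K → D.lower lam u ≤ C := by
  obtain ⟨C₁, -, h₁⟩ := D.exists_integral_bound K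
  obtain ⟨C₂, -, h₂⟩ := D.exists_integral_bound_sub K
  refine ⟨|lam| * C₂ + C₁ / 4, fun u hu hK => ?_⟩
  have hT := (h₁ u u hu hu hK hK _ (dominated_tden hu.meas fun x => by
    linarith [abs_nonneg (u x)])).2
  have hS := (h₂ u u hu hu hK hK _ (subDominated_S hu.meas fun x => by
    linarith [abs_nonneg (u x)])).2
  have h3 : lam * D.S u ≤ |lam| * C₂ := by
    refine (le_abs_self _).trans ?_
    rw [abs_mul]
    exact mul_le_mul_of_nonneg_left hS (abs_nonneg _)
  have h4 : D.T u ≤ C₁ := (le_abs_self _).trans hT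
  unfold lower
  linarith

/-- The energy attains its minimum on sublevel sets of its principal part. -/
lemma exists_minimizer (lam : ℝ) {R : ℝ} (hR : 0 ≤ R) :
    ∃ u, D.Admissible u ∧ D.P u ≤ R ∧ ∀ v, D.Admissible v → D.P v ≤ R →
      D.energy lam u ≤ D.energy lam v := by
  set A := D.energy lam '' {u | D.Admissible u ∧ D.P u ≤ R} with hAdef
  have hmod : ∀ u, D.Admissible u → D.P u ≤ R → D.modular u ≤ D.p₁ * R := fun u hu h =>
    (modular_le hu).trans (mul_le_mul_of_nonneg_left h D.H.p₁_pos.le)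
  obtain ⟨C, hC⟩ := D.exists_lower_le lam (D.p₁ * R)
  have hbdd : BddBelow A := by
    refine ⟨-C, ?_⟩
    rintro _ ⟨u, ⟨hu, hP⟩, rfl⟩
    have := hC u hu (hmod u hu hP)
    have := P_nonneg (D := D) u
    unfold energy
    linarith
  have hne : A.Nonempty := ⟨_, fun _ => 0, ⟨Adm.zero_fun D.H, by
    have := P_smul_le (Adm.zero_fun (Ω := D.Ω) D.H) (c := 0) (C := 0) fun x y => by
      rw [abs_zero, Real.zero_rpow (D.H.p_pos x y).ne']
    rw [zero_mul, zero_smul] at this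
    exact this.trans hR⟩, rfl⟩
  obtain ⟨a, -, ha, haA⟩ := exists_seq_tendsto_sInf hne hbdd
  choose u hu hua using haA
  obtain ⟨v, hv, -, hcl⟩ := exists_cluster D.H D.isOpen D.bdd (fun n => (hu n).1)
    (fun n => hmod _ (hu n).1 (hu n).2)
  obtain ⟨j, hj, hl⟩ := hcl id monotone_id
  have hjt : Tendsto j atTop atTop := tendsto_atTop_mono hj tendsto_id
  have hlow := tendsto_lower lam (fun n => (hu (j n)).1)
    (fun n => hmod _ (hu (j n)).1 (hu (j n)).2) hl
  have hPlim : Tendsto (fun n => D.P (u (j n))) atTop (𝓝 (sInf A + D.lower lam v)) := by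
    refine ((ha.comp hjt).add hlow).congr fun n => ?_
    simp only [Function.comp, ← hua, energy]
    ring
  have hPv : D.P v ≤ sInf A + D.lower lam v :=
    le_of_forall_pos_le_add fun ε hε => P_le_of_tendsto (fun n => (hu (j n)).1)
      (hPlim.eventually_le_const (by linarith)) hl
  refine ⟨v, hv, P_le_of_tendsto (fun n => (hu (j n)).1)
    (Eventually.of_forall fun n => (hu (j n)).2) hl, fun w hw hPw => ?_⟩
  have : sInf A ≤ D.energy lam w := csInf_le hbdd ⟨w, ⟨hw, hPw⟩, rfl⟩
  unfold energy at *
  linarith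

/-- A solution of negative energy, obtained by minimization near the origin. -/
lemma exists_critical_neg {lam R : ℝ} (hlam : 0 < lam) (hR : 0 < R)
    (hgeo : ∀ u, D.Admissible u → D.P u = R → R / 2 ≤ D.energy lam u) :
    ∃ u, D.Admissible u ∧ D.energy lam u < 0 ∧ ∀ w, D.Admissible w → D.denergy lam u w = 0 := by
  obtain ⟨φ, hφ, hPφ, hEφ⟩ := exists_energy_neg (D := D) hlam hR
  obtain ⟨u, hu, hPu, hmin⟩ := exists_minimizer (D := D) lam hR.le
  have hneg := (hmin φ hφ hPφ).trans_lt hEφ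
  have hlt : D.P u < R := lt_of_le_of_ne hPu fun h => by
    have := hgeo u hu h
    linarith
  refine ⟨u, hu, hneg, fun w hw => ?_⟩
  refine IsLocalMin.hasDerivAt_eq_zero ?_ (hasDerivAt_energy lam hu hw)
  have hc := (hasDerivAt_P hu hw).continuousAt.eventually_lt_const (u := R) (by simpa using hlt)
  filter_upwards [hc] with τ hτ
  simpa using hmin _ (hu.add D.H (hw.smul D.H τ)) hτ.le

end Problem

namespace Problem

variable {D : Problem N}

lemma exists_gden_sum_bound {ι : Type*} (t : Finset ι) {φ : ι → RN N → ℝ}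
    (hφ : ∀ i, D.Admissible (φ i)) (K : ℝ) :
    ∃ B : RN N × RN N → ℝ, Integrable B ∧ ∀ c : ι → ℝ, (∀ i, |c i| ≤ K) →
      ∀ z, gden D.s D.p (∑ i ∈ t, c i • φ i) z ≤ B z := by
  classical
  induction t using Finset.induction_on with
  | empty =>
    refine ⟨gden D.s D.p fun _ => 0, (Adm.zero_fun D.H (Ω := D.Ω)).int, fun c _ z => ?_⟩
    rw [Finset.sum_empty]
    exact le_rfl
  | insert i t hi ih =>
    obtain ⟨B, hB, hle⟩ := ih
    refine ⟨fun z => 2 ^ D.p₁ * (max 1 K ^ D.p₁ * gden D.s D.p (φ i) z + B z),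
      (((hφ i).int.const_mul _).add hB).const_mul _, fun c hc z => ?_⟩
    rw [Finset.sum_insert hi]
    refine (gden_add_le D.H z).trans ?_
    rw [gden_smul]
    have h1 : |c i| ^ D.p z.1 z.2 ≤ max 1 K ^ D.p₁ :=
      (Real.rpow_le_rpow (abs_nonneg _) ((hc i).trans (le_max_right _ _)) (D.H.p_pos _ _).le).trans
        (Real.rpow_le_rpow_of_exponent_le (le_max_left _ _) (D.H.p_le _ _))
    exact mul_le_mul_of_nonneg_left (add_le_add (mul_le_mul_of_nonneg_right h1 (gden_nonneg z))
      (hle c hc z)) (by positivity)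

section FiniteDimensional

variable {E : Type*} [NormedAddCommGroup E] [InnerProductSpace ℝ E] [FiniteDimensional ℝ E]
  {L : E →ₗ[ℝ] (RN N → ℝ)}

lemma exists_gden_bound (hL : ∀ v, D.Admissible (L v)) (K : ℝ) :
    ∃ B : RN N × RN N → ℝ, Integrable B ∧ ∀ v, ‖v‖ ≤ K → ∀ z, gden D.s D.p (L v) z ≤ B z := by
  let b := stdOrthonormalBasis ℝ E
  obtain ⟨B, hB, hle⟩ := exists_gden_sum_bound Finset.univ (fun i => hL (b i)) K
  refine ⟨B, hB, fun v hv z => ?_⟩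
  have h := hle (fun i => inner ℝ (b i) v) (fun i => by
    refine (abs_real_inner_le_norm _ _).trans ?_
    rwa [b.orthonormal.1 i, one_mul]) z
  convert h using 2
  conv_lhs => rw [← b.sum_repr' v]
  simp


lemma tendsto_apply {v : ℕ → E} {v' : E}
    (hv : Tendsto v atTop (𝓝 v')) (x : RN N) :
    Tendsto (fun n => L (v n) x) atTop (𝓝 (L v' x)) :=
  ((LinearMap.continuous_of_finiteDimensional ((LinearMap.proj x).comp L)).tendsto v').comp hv

lemma exists_gden_bound_of_tendsto (hL : ∀ v, D.Admissible (L v)) {v : ℕ → E} {v' : E}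
    (hv : Tendsto v atTop (𝓝 v')) :
    ∃ B : RN N × RN N → ℝ, Integrable B ∧ ∀ n z, gden D.s D.p (L (v n)) z ≤ B z := by
  obtain ⟨K, hK⟩ := (Metric.isBounded_range_of_tendsto v hv).exists_norm_le
  obtain ⟨B, hB, hle⟩ := exists_gden_bound hL K
  exact ⟨B, hB, fun n => hle _ (hK _ (mem_range_self n))⟩

lemma continuous_P_comp (hL : ∀ v, D.Admissible (L v)) : Continuous fun v => D.P (L v) :=
  continuous_iff_seqContinuous.2 fun _ _ hv =>
    let ⟨_, hB, hle⟩ := exists_gden_bound_of_tendsto hL hv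
    tendsto_P (fun _ => hL _) hB hle (tendsto_apply hv)

lemma continuous_lower_comp (lam : ℝ) (hL : ∀ v, D.Admissible (L v)) :
    Continuous fun v => D.lower lam (L v) :=
  continuous_iff_seqContinuous.2 fun _ _ hv =>
    let ⟨_, hB, hle⟩ := exists_gden_bound_of_tendsto hL hv
    tendsto_lower lam (fun _ => hL _) (fun n => integral_mono (hL _).int hB (hle n))
      (Eventually.of_forall (tendsto_apply hv))

lemma continuous_denergy_comp (lam : ℝ) (hL : ∀ v, D.Admissible (L v)) (w : E) :
    Continuous fun v => D.denergy lam (L v) (L w) := by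
  refine continuous_iff_seqContinuous.2 fun v v' hv => ?_
  obtain ⟨B, hB, hle⟩ := exists_gden_bound_of_tendsto hL hv
  exact (tendsto_energyLHS (fun _ => hL _) (hL w) hB hle (tendsto_apply hv)).sub
    (tendsto_dlower lam (fun _ => hL _) (fun _ => hL w)
      (fun n => (integral_mono (hL _).int hB (hle n)).trans (le_max_left _ (D.modular (L w))))
      (fun n => le_max_right _ _) (Eventually.of_forall (tendsto_apply hv))
      (Eventually.of_forall fun x => tendsto_const_nhds))

/-- Along a finite-dimensional space of functions the energy is negative outside a ball. -/
lemma isCompact_energy_ge {lam a : ℝ} (hlam : 0 ≤ lam) (ha : 0 < a)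
    (hL : ∀ v, D.Admissible (L v)) (hinj : ∀ v, L v =ᵐ[volume] (fun _ => (0 : ℝ)) → v = 0) :
    IsCompact {v | a ≤ D.energy lam (L v)} := by
  have hS := isCompact_sphere (0 : E) 1
  obtain ⟨A, hA⟩ := hS.exists_bound_of_continuousOn (continuous_P_comp hL).continuousOn
  have hTc : Continuous fun v => D.T (L v) := by
    have := continuous_lower_comp 0 hL
    simp only [lower, zero_mul, zero_add] at this
    simpa using this.mul_const 4
  obtain ⟨b, hb, hTb⟩ := hS.exists_forall_le' hTc.continuousOn (a := 0) fun v hv =>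
    T_pos (hL v) fun h => by
      rw [hinj v h] at hv
      simp at hv
  have hlim : Tendsto (fun t : ℝ => t ^ (D.Θ - D.p₁) * b) atTop atTop :=
    (tendsto_rpow_atTop (by linarith [D.Θ_gt])).atTop_mul_const hb
  obtain ⟨t₀, ht₀⟩ := ((eventually_ge_atTop 1).and (hlim.eventually_ge_atTop (4 * A))).exists_forall_of_atTop
  refine Metric.isCompact_of_isClosed_isBounded (isClosed_le continuous_const
    ((continuous_P_comp hL).sub (continuous_lower_comp lam hL))) ?_
  refine Metric.isBounded_closedBall.subset (t := Metric.closedBall 0 t₀) fun v hv => ?_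
  rw [mem_closedBall_zero_iff]
  by_contra! hlt
  obtain ⟨ht1, htA⟩ := ht₀ ‖v‖ hlt.le
  set t := ‖v‖
  have ht : 0 < t := zero_lt_one.trans_le ht1
  have hmem : t⁻¹ • v ∈ Metric.sphere (0 : E) 1 := by
    rw [mem_sphere_zero_iff_norm, norm_smul, norm_inv, norm_norm, inv_mul_cancel₀ ht.ne']
  have hv' : L v = t • L (t⁻¹ • v) := by
    rw [← map_smul, smul_smul, mul_inv_cancel₀ ht.ne', one_smul]
  have h1 : D.P (L v) ≤ t ^ D.p₁ * D.P (L (t⁻¹ • v)) := by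
    rw [hv']
    exact P_smul_le (hL _) fun x y => by
      rw [abs_of_pos ht]; exact Real.rpow_le_rpow_of_exponent_le ht1 (D.H.p_le x y)
  have h2 : t ^ D.Θ * D.T (L (t⁻¹ • v)) ≤ D.T (L v) := by
    conv_rhs => rw [hv']
    exact rpow_mul_T_le (hL _) ht1
  have h3 : t ^ D.Θ = t ^ D.p₁ * t ^ (D.Θ - D.p₁) := by
    rw [← Real.rpow_add ht]; ring_nf
  have h4 : t ^ D.p₁ * D.P (L (t⁻¹ • v)) ≤ t ^ D.p₁ * A := by
    gcongr
    exact (le_abs_self _).trans (hA _ hmem)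
  have h5 : t ^ D.Θ * b ≤ t ^ D.Θ * D.T (L (t⁻¹ • v)) := by
    gcongr
    exact hTb _ hmem
  have h6 : t ^ D.p₁ * (4 * A) ≤ t ^ D.p₁ * (t ^ (D.Θ - D.p₁) * b) := by gcongr
  have h7 : 0 ≤ lam * D.S (L v) := mul_nonneg hlam (S_nonneg _)
  have hv : a ≤ D.energy lam (L v) := hv
  rw [h3] at h5
  rw [← mul_assoc] at h6
  rw [h3] at h2
  unfold energy lower at hv
  linarith

/-- The Galerkin approximation of the mountain pass solution. -/
lemma exists_critical_finiteDimensional {lam R : ℝ} (hlam : 0 ≤ lam) (hR : 0 < R)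
    (hgeo : ∀ u, D.Admissible u → D.P u = R → R / 2 ≤ D.energy lam u)
    (hL : ∀ v, D.Admissible (L v)) (hinj : ∀ v, L v =ᵐ[volume] (fun _ => (0 : ℝ)) → v = 0)
    {e : E} (hRe : R < D.P (L e)) (he : D.P (L e) ≤ D.T (L e) / 4) :
    ∃ v, (∀ w, D.denergy lam (L v) (L w) = 0) ∧ R / 4 ≤ D.energy lam (L v) ∧
      D.energy lam (L v) ≤ D.P (L e) := by
  let b := stdOrthonormalBasis ℝ E
  have hP0 : D.P (L 0) = 0 := by
    have := P_smul_le (hL 0) (c := 0) (C := 0) fun x y => by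
      rw [abs_zero, Real.zero_rpow (D.H.p_pos x y).ne']
    rw [zero_mul, zero_smul] at this
    rw [map_zero]
    exact le_antisymm this (P_nonneg _)
  have hle : ∀ v, D.energy lam (L v) ≤ D.P (L v) := fun v => by
    have := mul_nonneg hlam (S_nonneg (D := D) (L v))
    have := T_nonneg (D := D) (L v)
    unfold energy lower
    linarith
  have hinner : ∀ v w : E, inner ℝ (∑ i, D.denergy lam (L v) (L (b i)) • b i) w =
      D.denergy lam (L v) (L w) := fun v w => by
    let ℓ : E →ₗ[ℝ] ℝ :=
      { toFun := fun w => D.denergy lam (L v) (L w)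
        map_add' := fun w w' => by rw [map_add]; exact denergy_add lam (hL v) (hL w) (hL w')
        map_smul' := fun c w => by rw [map_smul]; exact denergy_smul lam c _ _ }
    have h : ℓ w = ∑ i, inner ℝ (b i) w * ℓ (b i) := by
      conv_lhs => rw [← b.sum_repr' w]
      simp
    rw [sum_inner]
    refine Eq.trans ?_ h.symm
    refine Finset.sum_congr rfl fun i _ => ?_
    rw [real_inner_smul_left, mul_comm]
    rfl
  obtain ⟨v, hv, h1, h2⟩ := exists_critical_of_mountain (J := fun v => D.energy lam (L v))
    (g := fun v => D.P (L v)) (G := fun v => ∑ i, D.denergy lam (L v) (L (b i)) • b i)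
    ((continuous_P_comp hL).sub (continuous_lower_comp lam hL)) (continuous_P_comp hL)
    (continuous_finsetSum _ fun i _ => (continuous_denergy_comp lam hL (b i)).smul
      continuous_const)
    (fun v w => by
      rw [hinner]
      simpa only [map_add, map_smul] using hasDerivAt_energy lam (hL v) (hL w))
    (a := R / 4) (c := R / 2) (C := D.P (L e)) (R := R) (e := e) (by linarith)
    (isCompact_energy_ge hlam (by linarith) hL hinj) ((hle 0).trans (by rw [hP0]; linarith))
    (by
      have := mul_nonneg hlam (S_nonneg (D := D) (L e))
      unfold energy lower
      linarith)
    (by simpa only [hP0] using hR) hRe (fun v hv => hgeo _ (hL v) hv)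
    (fun t ht => (hle _).trans (by
      have := P_smul_le (hL e) (c := t) (C := 1) fun x y => by
        rw [abs_of_nonneg ht.1]; exact Real.rpow_le_one ht.1 ht.2 (D.H.p_pos x y).le
      simpa only [map_smul, one_mul] using this))
  exact ⟨v, fun w => by rw [← hinner, hv, inner_zero_left], h1, h2⟩

end FiniteDimensional

lemma exists_critical_finset {lam R : ℝ} (hlam : 0 ≤ lam) (hR : 0 < R)
    (hgeo : ∀ u, D.Admissible u → D.P u = R → R / 2 ≤ D.energy lam u)
    {e : RN N → ℝ} (hRe : R < D.P e) (he : D.P e ≤ D.T e / 4)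
    (t : Finset (RN N → ℝ)) (ht : ∀ φ ∈ t, D.Admissible φ) (het : e ∈ t) :
    ∃ u, D.Admissible u ∧ D.denergy lam u u = 0 ∧ (∀ w ∈ t, D.denergy lam u w = 0) ∧
      R / 4 ≤ D.energy lam u ∧ D.energy lam u ≤ D.P e := by
  let L₀ : EuclideanSpace ℝ t →ₗ[ℝ] (RN N → ℝ) :=
    (Fintype.linearCombination ℝ fun φ : t => (φ : RN N → ℝ)).comp
      (WithLp.linearEquiv 2 ℝ (t → ℝ)).toLinearMap
  have hL₀ : ∀ v, D.Admissible (L₀ v) := fun v =>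
    Adm.sum D.H _ fun φ _ => (ht φ φ.2).smul D.H _
  let K : Submodule ℝ (EuclideanSpace ℝ t) :=
    { carrier := {v | L₀ v =ᵐ[volume] fun _ => (0 : ℝ)}
      add_mem' := fun {v w} hv hw => by
        rw [mem_ofPred_eq, map_add]
        filter_upwards [hv, hw] with x h1 h2
        rw [Pi.add_apply, h1, h2, add_zero]
      zero_mem' := by
        rw [mem_ofPred_eq, map_zero]
        exact Eventually.of_forall fun x => rfl
      smul_mem' := fun c v hv => by
        rw [mem_ofPred_eq, map_smul]
        filter_upwards [hv] with x h1
        rw [Pi.smul_apply, h1, smul_zero] }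
  let L : Kᗮ →ₗ[ℝ] (RN N → ℝ) := L₀.comp Kᗮ.subtype
  have hrep : ∀ φ ∈ t, ∃ v, L v =ᵐ[volume] φ := fun φ hφ => by
    classical
    obtain ⟨k, hk, v, hv, hkv⟩ := Submodule.exists_add_mem_mem_orthogonal (K := K)
      (EuclideanSpace.single (⟨φ, hφ⟩ : t) (1 : ℝ))
    have hsingle : L₀ (EuclideanSpace.single (⟨φ, hφ⟩ : t) (1 : ℝ)) = φ := by
      change Fintype.linearCombination ℝ (fun φ : t => (φ : RN N → ℝ)) (Pi.single ⟨φ, hφ⟩ 1) = φ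
      rw [Fintype.linearCombination_apply_single, one_smul]
    have hk : L₀ k =ᵐ[volume] fun _ => (0 : ℝ) := hk
    refine ⟨⟨v, hv⟩, ?_⟩
    rw [hkv, map_add] at hsingle
    filter_upwards [hk] with x hx
    rw [← hsingle, Pi.add_apply, hx, zero_add]
    rfl
  have hL : ∀ v, D.Admissible (L v) := fun v => hL₀ v
  obtain ⟨e', he'⟩ := hrep e het
  have hPe := P_congr (D := D) he'
  have hTe : D.T (L e') = D.T e := by
    have := lower_congr (D := D) 0 he'
    unfold lower at this
    linarith
  obtain ⟨v, hv, h1, h2⟩ := exists_critical_finiteDimensional hlam hR hgeo hL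
    (fun v hv => by
      have h : (v : EuclideanSpace ℝ t) ∈ K := hv
      have := Submodule.inner_right_of_mem_orthogonal h v.2
      exact Subtype.ext (inner_self_eq_zero.1 this))
    (e := e') (by rwa [hPe]) (by rwa [hPe, hTe])
  refine ⟨L v, hL v, hv v, fun w hw => ?_, h1, hPe ▸ h2⟩
  obtain ⟨w', hw'⟩ := hrep w hw
  rw [← denergy_congr_right lam (L v) hw', hv]

end Problem

namespace Problem

variable {D : Problem N}

lemma denergy_sub (lam : ℝ) {u v w : RN N → ℝ} (hu : D.Admissible u) (hv : D.Admissible v)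
    (hw : D.Admissible w) : D.denergy lam u (v - w) = D.denergy lam u v - D.denergy lam u w := by
  rw [sub_eq_add_neg, ← neg_one_smul ℝ w, denergy_add lam hu hv (hw.smul D.H _), denergy_smul]
  ring

/-- By convexity of the principal part, a function solving the associated variational inequality
is critical. -/
lemma denergy_eq_zero_of_forall_le {lam : ℝ} {u : RN N → ℝ} (hu : D.Admissible u)
    (h : ∀ w, D.Admissible w → D.dlower lam u (w - u) ≤ D.P w - D.P u) {w : RN N → ℝ}
    (hw : D.Admissible w) : D.denergy lam u w = 0 := by
  have hd : HasDerivAt (fun τ : ℝ => D.P (u + τ • w) - τ * D.dlower lam u w)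
      (D.denergy lam u w) 0 := by
    have := (hasDerivAt_P hu hw).sub ((hasDerivAt_id (0 : ℝ)).mul_const (D.dlower lam u w))
    rw [one_mul] at this
    exact this
  refine IsLocalMin.hasDerivAt_eq_zero (Eventually.of_forall fun τ => ?_) hd
  have := h (u + τ • w) (hu.add D.H (hw.smul D.H τ))
  rw [add_sub_cancel_left, dlower_smul] at this
  simp only [zero_smul, add_zero, zero_mul, sub_zero]
  linarith

/-- A solution of positive energy, obtained as a limit of Galerkin approximations. -/
lemma exists_critical_pos {lam R κ : ℝ} (hlam : 0 ≤ lam) (hR : 0 < R) (hκ : 0 < κ)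
    (hgeo : ∀ u, D.Admissible u → D.P u = R → R / 2 ≤ D.energy lam u)
    (hps : ∀ u, D.Admissible u → D.denergy lam u u = 0 →
      κ * D.modular u ≤ D.energy lam u + κ) :
    ∃ u, D.Admissible u ∧ 0 < D.energy lam u ∧ ∀ w, D.Admissible w → D.denergy lam u w = 0 := by
  classical
  obtain ⟨e, he, hRe, hPT⟩ := D.exists_far R
  let ι := {t : Finset (RN N → ℝ) // (∀ φ ∈ t, D.Admissible φ) ∧ e ∈ t}
  have hunion : ∀ i j : ι, (∀ φ ∈ i.1 ∪ j.1, D.Admissible φ) ∧ e ∈ i.1 ∪ j.1 := fun i j =>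
    ⟨fun φ hφ => (Finset.mem_union.1 hφ).elim (i.2.1 φ) (j.2.1 φ),
      Finset.mem_union_left _ i.2.2⟩
  have : IsDirectedOrder ι :=
    ⟨fun i j => ⟨⟨i.1 ∪ j.1, hunion i j⟩, Finset.subset_union_left, Finset.subset_union_right⟩⟩
  have : Nonempty ι := ⟨⟨{e}, fun φ hφ => by rwa [Finset.mem_singleton.1 hφ],
    Finset.mem_singleton_self e⟩⟩
  choose u hu hself hcrit hlow hup using fun i : ι =>
    exists_critical_finset hlam hR hgeo hRe hPT i.1 i.2.1 i.2.2
  have hmod : ∀ i, D.modular (u i) ≤ (D.P e + κ) / κ := fun i => by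
    rw [le_div_iff₀ hκ]
    linarith [hps _ (hu i) (hself i), hup i]
  obtain ⟨v, hv, hρv, hcl⟩ := exists_cluster D.H D.isOpen D.bdd hu hmod
  have key : ∀ w, D.Admissible w → ∃ a : ℕ → RN N → ℝ, (∀ n, D.Admissible (a n)) ∧
      (∀ᵐ x, Tendsto (fun n => a n x) atTop (𝓝 (v x))) ∧
      Tendsto (fun n => D.lower lam (a n)) atTop (𝓝 (D.lower lam v)) ∧
      Tendsto (fun n => D.dlower lam (a n) (w - a n)) atTop (𝓝 (D.dlower lam v (w - v))) ∧
      ∀ n, R / 4 ≤ D.energy lam (a n) ∧ D.P (a n) ≤ D.P w - D.dlower lam (a n) (w - a n) := by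
    intro w hw
    let i₀ : ι := ⟨{e, w}, fun φ hφ => by
      rcases Finset.mem_insert.1 hφ with rfl | h
      · exact he
      · rwa [Finset.mem_singleton.1 h], Finset.mem_insert_self _ _⟩
    obtain ⟨j, hj, hl⟩ := hcl (fun _ => i₀) monotone_const
    have hsub : ∀ n, D.Admissible (w - u (j n)) := fun n => hw.sub D.H (hu _)
    refine ⟨fun n => u (j n), fun n => hu _, hl, tendsto_lower lam (fun n => hu _)
      (fun n => hmod _) hl, ?_, fun n => ⟨hlow _, ?_⟩⟩
    · have hB : ∀ n, D.modular (w - u (j n)) ≤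
          2 ^ D.p₁ * (D.modular w + (D.P e + κ) / κ) := fun n => by
        refine (rho_sub_le D.H hw (hu _)).trans ?_
        have := hmod (j n)
        gcongr
      refine tendsto_dlower lam (fun n => hu _) hsub
        (fun n => (hmod _).trans (le_max_left _ _)) (fun n => (hB n).trans (le_max_right _ _))
        hl ?_
      filter_upwards [hl] with x hx using tendsto_const_nhds.sub hx
    · have hw' : w ∈ (j n).1 := hj n (Finset.mem_insert_of_mem (Finset.mem_singleton_self w))
      have h1 := energyLHS_sub_le (hu (j n)) hw
      have h2 := denergy_sub lam (hu (j n)) hw (hu (j n))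
      rw [hcrit _ w hw', hself, sub_zero] at h2
      unfold denergy at h2
      linarith
  refine ⟨v, hv, ?_, fun w hw => denergy_eq_zero_of_forall_le hv (fun w hw => ?_) hw⟩
  · obtain ⟨a, ha, -, h1, h2, h3⟩ := key v hv
    have hz : D.dlower lam v (v - v) = 0 := by
      rw [sub_self, ← zero_smul ℝ v, dlower_smul, zero_mul]
    rw [hz] at h2
    have hlim := (tendsto_const_nhds (x := D.P v)).sub (h2.add h1)
    have := ge_of_tendsto' hlim (b := R / 4) fun n => by
      have := h3 n
      unfold energy at this
      linarith
    unfold energy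
    linarith
  · obtain ⟨a, ha, hl, h1, h2, h3⟩ := key w hw
    have hlim := (tendsto_const_nhds (x := D.P w)).sub h2
    have : D.P v ≤ D.P w - D.dlower lam v (w - v) := le_of_forall_pos_le_add fun ε hε =>
      P_le_of_tendsto ha ((hlim.eventually_le_const (lt_add_of_pos_right _ hε)).mono
        fun n hn => (h3 n).2.trans hn) hl
    linarith

/-- Two critical points of the energy. -/
lemma exists_two_critical (D : Problem N) : ∃ Λ : ℝ, 0 < Λ ∧ ∀ lam, 0 < lam → lam < Λ →
    ∃ u₁ u₂, D.Admissible u₁ ∧ D.Admissible u₂ ∧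
      ¬ (u₁ =ᵐ[volume] fun _ => (0 : ℝ)) ∧ ¬ (u₂ =ᵐ[volume] fun _ => (0 : ℝ)) ∧
      ¬ (u₁ =ᵐ[volume] u₂) ∧
      (∀ w, D.Admissible w → D.denergy lam u₁ w = 0) ∧
      ∀ w, D.Admissible w → D.denergy lam u₂ w = 0 := by
  obtain ⟨R, Λ, κ, hR, hΛ, hκ, h⟩ := D.exists_geometry
  refine ⟨Λ, hΛ, fun lam hlam hlt => ?_⟩
  obtain ⟨hgeo, hps⟩ := h lam hlam hlt
  obtain ⟨u₁, hu₁, hE₁, h₁⟩ := exists_critical_neg hlam hR hgeo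
  obtain ⟨u₂, hu₂, hE₂, h₂⟩ := exists_critical_pos hlam.le hR hκ hgeo hps
  have hz : D.energy lam (fun _ => 0) = 0 := by
    have hA : D.Admissible fun _ => 0 := Adm.zero_fun D.H
    have hP : D.P (fun _ => 0) = 0 := by
      have := P_smul_le hA (c := 0) (C := 0) fun x y => by
        rw [abs_zero, Real.zero_rpow (D.H.p_pos x y).ne']
      rw [zero_mul, zero_smul] at this
      exact le_antisymm this (P_nonneg _)
    have hS : D.S (fun _ => 0) = 0 := by
      unfold S
      simp [Real.zero_rpow (zero_lt_one.trans (D.α_gt _)).ne']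
    have hT : D.T (fun _ => 0) = 0 := by
      unfold T tden
      simp [Fant]
    rw [energy, lower, hP, hS, hT]
    ring
  refine ⟨u₁, u₂, hu₁, hu₂, fun h0 => ?_, fun h0 => ?_, fun h0 => ?_, h₁, h₂⟩
  · rw [energy_congr lam h0, hz] at hE₁
    exact lt_irrefl _ hE₁
  · rw [energy_congr lam h0, hz] at hE₂
    exact lt_irrefl _ hE₂
  · rw [energy_congr lam h0] at hE₁
    exact lt_asymm hE₁ hE₂

end Problem

section Spaces

variable {s p : RN N → RN N → ℝ} {s₀ s₁ p₀ p₁ : ℝ} {Ω : Set (RN N)} {u w : RN N → ℝ}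

lemma ofReal_rpow_div_eq_gden (H : Exps s p s₀ s₁ p₀ p₁) {l : ℝ} (hl : 0 < l) (z : RN N × RN N) :
    ENNReal.ofReal (|u z.1 - u z.2| / l) ^ p z.1 z.2 /
      ENNReal.ofReal (dist z.1 z.2) ^ ((N : ℝ) + s z.1 z.2 * p z.1 z.2) =
      ENNReal.ofReal (gden s p (l⁻¹ • u) z) := by
  have hp := H.p_pos z.1 z.2
  have hd : |(l⁻¹ • u) z.1 - (l⁻¹ • u) z.2| = |u z.1 - u z.2| / l := by
    rw [Pi.smul_apply, Pi.smul_apply, smul_eq_mul, smul_eq_mul, ← mul_sub, abs_mul,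
      abs_of_pos (inv_pos.2 hl), inv_mul_eq_div]
  rw [gden, hd, ENNReal.ofReal_rpow_of_nonneg (by positivity) hp.le]
  rcases dist_nonneg.eq_or_lt' (a := dist z.1 z.2) with h | h
  · rw [dist_eq_zero] at h
    rw [h] at hp
    simp [h, Real.zero_rpow hp.ne']
  · rw [ENNReal.ofReal_rpow_of_pos h, ENNReal.ofReal_div_of_pos (by positivity)]

lemma Adm.memX0 (hu : Adm Ω s p u) (H : Exps s p s₀ s₁ p₀ p₁) (hΩo : IsOpen Ω)
    (hΩb : Bornology.IsBounded Ω) : MemX0 Ω s p (fun x => p x x) u := by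
  refine ⟨hu.meas, ⟨hu.meas, 1, one_pos, ?_⟩, ⟨1, one_pos, ?_⟩, Eventually.of_forall hu.zero⟩
  · obtain ⟨C, -, hC⟩ := exists_embedding H hΩo hΩb (m := fun x => p x x)
      (H.contP.comp (continuous_id.prodMk continuous_id)) (fun x _ => H.p_pos x x)
      (fun x _ => by nlinarith [mul_pos (H.p_pos x x) (mul_pos (H.s_pos x x) (H.p_pos x x))])
      (rho s p u)
    refine (lintegral_congr fun x => ?_).trans_lt (hC u hu le_rfl).1.lintegral_lt_top
    rw [div_one, ENNReal.ofReal_rpow_of_nonneg (abs_nonneg _) (H.p_pos x x).le]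
  · have h := (setLIntegral_le_lintegral (Qset Ω) fun z =>
      ENNReal.ofReal (gden s p u z)).trans_lt hu.int.lintegral_lt_top
    refine (lintegral_congr fun z => ?_).trans_lt h
    rw [ofReal_rpow_div_eq_gden H one_pos, inv_one, one_smul]

lemma MemX0.exists_adm (H : Exps s p s₀ s₁ p₀ p₁) (hΩo : IsOpen Ω)
    (hw : MemX0 Ω s p (fun x => p x x) w) : ∃ v, Adm Ω s p v ∧ w =ᵐ[volume] v := by
  obtain ⟨hm, -, ⟨l, hl, hfin⟩, hz⟩ := hw
  have hae : w =ᵐ[volume] Ω.indicator w := by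
    filter_upwards [hz] with x hx
    by_cases h : x ∈ Ω
    · rw [indicator_of_mem h]
    · rw [indicator_of_notMem h, hx h]
  have hQ : MeasurableSet (Qset Ω) :=
    MeasurableSet.univ.diff (hΩo.measurableSet.compl.prod hΩo.measurableSet.compl)
  have hm' : Measurable (l⁻¹ • w) := hm.const_smul _
  have hi : IntegrableOn (gden s p (l⁻¹ • w)) (Qset Ω) := by
    refine ⟨(measurable_gden H hm').aestronglyMeasurable, ?_⟩
    rw [hasFiniteIntegral_iff_ofReal (Eventually.of_forall fun z => gden_nonneg z)]
    refine (lintegral_congr fun z => ?_).trans_lt hfin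
    rw [ofReal_rpow_div_eq_gden H hl]
  have hi' : IntegrableOn (gden s p w) (Qset Ω) := by
    refine (hi.const_mul (max 1 l ^ p₁)).mono' (measurable_gden H hm).aestronglyMeasurable
      (Eventually.of_forall fun z => ?_)
    have hlw : w = l • (l⁻¹ • w) := by rw [smul_smul, mul_inv_cancel₀ hl.ne', one_smul]
    rw [Real.norm_eq_abs, abs_of_nonneg (gden_nonneg z)]
    conv_lhs => rw [hlw, gden_smul, abs_of_pos hl]
    refine mul_le_mul_of_nonneg_right ?_ (gden_nonneg z)
    exact (Real.rpow_le_rpow hl.le (le_max_right _ _) (H.p_pos _ _).le).trans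
      (Real.rpow_le_rpow_of_exponent_le (le_max_left _ _) (H.p_le _ _))
  refine ⟨Ω.indicator w, ⟨hm.indicator hΩo.measurableSet,
    fun x hx => indicator_of_notMem hx _, ?_⟩, hae⟩
  refine (hi'.integrable_indicator hQ).congr ?_
  filter_upwards [gden_congr_ae (s := s) (p := p) hae] with z hz
  by_cases h : z ∈ Qset Ω
  · rw [indicator_of_mem h, hz]
  · have h' : z ∈ Ωᶜ ×ˢ Ωᶜ := by
      by_contra h'
      exact h ⟨mem_univ z, h'⟩
    rw [indicator_of_notMem h, gden, indicator_of_notMem h'.1, indicator_of_notMem h'.2, sub_self,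
      abs_zero, Real.zero_rpow (H.p_pos _ _).ne', _root_.zero_div]

end Spaces

namespace Problem

variable {D : Problem N}

/-- Critical points of the energy are weak solutions. -/
lemma weak_solution_of_critical {lam : ℝ} {u : RN N → ℝ} (hu : D.Admissible u)
    (hcrit : ∀ w, D.Admissible w → D.denergy lam u w = 0) {w : RN N → ℝ}
    (hw : MemX0 D.Ω D.s D.p (fun x => D.p x x) w) :
    energyLHS D.s D.p u w = lam * (∫ x in D.Ω, |u x| ^ (D.α x - 2) * u x * w x) +
      (1 / 2) * choquardRHS D.Ω D.μ D.f u w := by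
  obtain ⟨v, hv, hwv⟩ := hw.exists_adm D.H D.isOpen
  have h := denergy_congr_right (D := D) lam u hwv
  rw [hcrit v hv] at h
  have hint : Integrable (D.dtden u w) D.ν := by
    refine (integrable_dtden hu hv).congr ?_
    filter_upwards [D.ae_ν_snd (ae_restrict_of_ae hwv)] with z hz
    rw [dtden, dtden, hz]
  have hT : D.dT u w = choquardRHS D.Ω D.μ D.f u w := integral_prod _ hint
  rw [denergy, dlower, hT, dS] at h
  linarith

end Problem

lemma bddBelow_of_sInf_pos {A : Set ℝ} (h : 0 < sInf A) : BddBelow A := by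
  by_contra hA
  rw [Real.sInf_of_not_bddBelow hA] at h
  exact lt_irrefl _ h

lemma inf2_le {f : RN N → RN N → ℝ} (h : 0 < inf2 f) (x y : RN N) : inf2 f ≤ f x y :=
  csInf_le (bddBelow_of_sInf_pos h) ⟨x, y, rfl⟩

lemma le_sup2 {f : RN N → RN N → ℝ} (h : BddAbove {t | ∃ x y, f x y = t}) (x y : RN N) :
    f x y ≤ sup2 f :=
  le_csSup h ⟨x, y, rfl⟩

lemma infOn_le {A : Set (RN N)} {g : RN N → ℝ} (h : 0 < infOn A g) {x : RN N} (hx : x ∈ A) :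
    infOn A g ≤ g x :=
  csInf_le (bddBelow_of_sInf_pos h) (mem_image_of_mem g hx)

lemma le_supOn {A : Set (RN N)} {g : RN N → ℝ} (h : BddAbove (g '' A)) {x : RN N} (hx : x ∈ A) :
    g x ≤ supOn A g :=
  le_csSup h (mem_image_of_mem g hx)

/-- The exponent relation `2 / q + μ / N = 2` forces `q⁺ < 2` and bounds `μ`. -/
lemma sup2_lt_two_and_le {μ q : RN N → RN N → ℝ} (hN : 0 < N) (hμ : Mu1 μ) (hq : CPlus2 q)
    (hqμ : ∀ x y, 2 / q x y + μ x y / (N : ℝ) = 2) :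
    1 < sup2 q ∧ sup2 q < 2 ∧ (∀ x y, μ x y = N * (2 - 2 / q x y)) ∧
      ∀ x y, μ x y ≤ N * (2 - 2 / sup2 q) := by
  have hN' : (0 : ℝ) < N := by exact_mod_cast hN
  have hq1 : ∀ x y, 1 < q x y := fun x y =>
    hq.2.1.trans_le (inf2_le (zero_lt_one.trans hq.2.1) x y)
  have hQ1 : 1 < sup2 q := (hq1 0 0).trans_le (le_sup2 hq.2.2 0 0)
  have hμq : ∀ x y, μ x y = N * (2 - 2 / q x y) := fun x y => by
    have h : 2 - 2 / q x y = μ x y / N := by linarith [hqμ x y]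
    rw [h, mul_div_cancel₀ _ hN'.ne']
  have hb : 1 < 2 - sup2 μ / N := by
    have := (div_lt_one hN').2 hμ.2.2.2
    linarith
  have hQ2 : sup2 q ≤ 2 / (2 - sup2 μ / N) := by
    refine csSup_le ⟨_, 0, 0, rfl⟩ ?_
    rintro _ ⟨x, y, rfl⟩
    have h1 : μ x y / N ≤ sup2 μ / N := by
      have := le_sup2 hμ.2.1 x y
      gcongr
    have h2 : 2 - sup2 μ / N ≤ 2 / q x y := by linarith [hqμ x y]
    have hq0 : 0 < q x y := by linarith [hq1 x y]
    rw [le_div_iff₀ hq0] at h2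
    rw [le_div_iff₀ (by linarith)]
    linarith
  refine ⟨hQ1, hQ2.trans_lt ?_, hμq, fun x y => ?_⟩
  · rw [div_lt_iff₀ (by linarith)]
    linarith
  · rw [hμq]
    have := le_sup2 hq.2.2 x y
    have hq0 : 0 < q x y := by linarith [hq1 x y]
    gcongr

/-- There is room above the exponents for higher integrability of the Choquard integrand. -/
lemma exists_exponents {Ω : Set (RN N)} {s p : RN N → RN N → ℝ} {s₀ s₁ p₀ p₁ Q : ℝ}
    {r : RN N → ℝ} (H : Exps s p s₀ s₁ p₀ p₁) (hΩb : Bornology.IsBounded Ω) (hr : Continuous r)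
    (hr0 : ∀ x, 0 < r x) (hQ1 : 1 < Q) (hQ2 : Q < 2) (hrQ : ∀ x, r x * Q < pstar s p x) :
    ∃ t e : ℝ, 1 < t ∧ t ≤ 2 ∧ 1 < e ∧ e * (t / (2 * t - 2)) * (N * (2 - 2 / Q)) < N ∧
      ∀ x ∈ closure Ω, e * t * r x * (N - s x x * p x x) < N * p x x := by
  have hN : (0 : ℝ) < N := H.N_pos
  have hQ0 : 0 < Q := zero_lt_one.trans hQ1
  have hden : ∀ x, 0 < N - s x x * p x x := fun x => by linarith [H.sp_le x x, H.sub]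
  have hdiag : Continuous fun x : RN N => (x, x) := continuous_id.prodMk continuous_id
  have hps : Continuous (pstar s p) :=
    (continuous_const.mul (H.contP.comp hdiag)).div
      (continuous_const.sub ((H.contS.comp hdiag).mul (H.contP.comp hdiag))) fun x => (hden x).ne'
  obtain ⟨c, hc1, hc⟩ := hΩb.isCompact_closure.exists_forall_le' (a := 1)
    (f := fun x => pstar s p x / (r x * Q))
    (hps.div (hr.mul continuous_const) fun x => (mul_pos (hr0 x) hQ0).ne').continuousOn
    (fun x _ => (one_lt_div (mul_pos (hr0 x) hQ0)).2 (hrQ x))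
  obtain ⟨t, hQt, ht⟩ := exists_between (lt_min hQ2 (lt_mul_of_one_lt_left hQ0 hc1))
  have ht2 := ht.trans_le (min_le_left _ _)
  have htc := ht.trans_le (min_le_right _ _)
  have ht0 : 0 < t := hQ0.trans hQt
  have hk0 : 0 < t / (2 * t - 2) * (N * (2 - 2 / Q)) := by
    have h1 : 0 < 2 * t - 2 := by linarith
    have h2 : 0 < 2 - 2 / Q := by
      have := (div_lt_iff₀ hQ0).2 (by linarith : (2 : ℝ) < 2 * Q)
      linarith
    positivity
  have hk : t / (2 * t - 2) * (N * (2 - 2 / Q)) < N := by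
    have h1 : 0 < 2 * t - 2 := by linarith
    have h2 : t / (2 * t - 2) * (2 - 2 / Q) < 1 := by
      have : t / (2 * t - 2) * (2 - 2 / Q) = t * (2 * Q - 2) / ((2 * t - 2) * Q) := by
        field_simp
      rw [this, div_lt_one (by positivity)]
      linarith
    calc _ = N * (t / (2 * t - 2) * (2 - 2 / Q)) := by ring
      _ < N * 1 := by gcongr
      _ = N := mul_one _
  obtain ⟨e, he1, he⟩ := exists_between
    (lt_min ((one_lt_div ht0).2 htc) ((one_lt_div hk0).2 hk))
  have het := he.trans_le (min_le_left _ _)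
  have hek := he.trans_le (min_le_right _ _)
  rw [lt_div_iff₀ ht0] at het
  rw [lt_div_iff₀ hk0] at hek
  refine ⟨t, e, by linarith, ht2.le, he1, by rwa [mul_assoc], fun x hx => ?_⟩
  have h := hc x hx
  rw [le_div_iff₀ (mul_pos (hr0 x) hQ0)] at h
  rw [← lt_div_iff₀ (hden x)]
  calc e * t * r x < c * Q * r x := mul_lt_mul_of_pos_right het (hr0 x)
    _ = c * (r x * Q) := by ring
    _ ≤ _ := h

end Proof

/-- Multiplicity: two distinct nontrivial weak solutions (Theorem multiplicity). -/
theorem statement2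
    {N : ℕ} (hN : 2 ≤ N) (Ω : Set (RN N))
    (hΩo : IsOpen Ω) (hΩb : Bornology.IsBounded Ω) (hΩne : Ω.Nonempty)
    (s p μ q : RN N → RN N → ℝ) (f : RN N → ℝ → ℝ) (M Θ : ℝ) (r : RN N → ℝ)
    (hs : S1 s) (hp : P1 s p) (hμ : Mu1 μ) (hq : CPlus2 q)
    (hqμ : ∀ x y, 2 / q x y + μ x y / (N : ℝ) = 2)
    (hf : Caratheodory f)
    (hr : CPlusOn univ r) (hrM : MemM s p q r) (hrp : sup2 p < infOn univ r)
    (hf1 : F1 Ω f M r) (hΘ : sup2 p < Θ) (hf2 : F2 Ω f Θ)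
    (α : RN N → ℝ) (hα : CPlusOn (closure Ω) α)
    (hαp : supOn (closure Ω) α < inf2 p) :
    ∃ Λ : ℝ, 0 < Λ ∧ ∀ lam : ℝ, 0 < lam → lam < Λ →
      ∃ u₁ u₂ : RN N → ℝ,
        MemX0 Ω s p (fun x => p x x) u₁ ∧ MemX0 Ω s p (fun x => p x x) u₂ ∧
        ¬ (u₁ =ᵐ[volume] (fun _ => (0 : ℝ))) ∧
        ¬ (u₂ =ᵐ[volume] (fun _ => (0 : ℝ))) ∧
        ¬ (u₁ =ᵐ[volume] u₂) ∧
        (∀ w : RN N → ℝ, MemX0 Ω s p (fun x => p x x) w →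
          energyLHS s p u₁ w =
            lam * (∫ x in Ω, |u₁ x| ^ (α x - 2) * u₁ x * w x) +
              (1 / 2) * choquardRHS Ω μ f u₁ w) ∧
        (∀ w : RN N → ℝ, MemX0 Ω s p (fun x => p x x) w →
          energyLHS s p u₂ w =
            lam * (∫ x in Ω, |u₂ x| ^ (α x - 2) * u₂ x * w x) +
              (1 / 2) * choquardRHS Ω μ f u₂ w) := by
  classical
  have hN' : 0 < N := by omega
  obtain ⟨hs1, -, hs3, hs4, hs5⟩ := hs
  obtain ⟨⟨hp1, hp2, hp3⟩, -, hp5⟩ := hp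
  obtain ⟨hr1, hr2, hr3⟩ := hr
  obtain ⟨hα1, hα2, hα3⟩ := hα
  rw [continuousOn_univ] at hr1
  have H : Exps s p (inf2 s) (sup2 s) (inf2 p) (sup2 p) :=
    ⟨hs1, hp1, hs4, inf2_le hs4, le_sup2 hs3, hs5, hp2, inf2_le (zero_lt_one.trans hp2),
      le_sup2 hp3, hp5⟩
  obtain ⟨hQ1, hQ2, hμq, hμle⟩ := sup2_lt_two_and_le hN' hμ hq hqμ
  have hr0 : ∀ x, infOn univ r ≤ r x := fun x =>
    infOn_le (zero_lt_one.trans hr2) (mem_univ x)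
  obtain ⟨t, e, ht1, ht2, he1, hker, hgr⟩ := exists_exponents H hΩb hr1
    (fun x => by linarith [hr0 x]) hQ1 hQ2 fun x => (hrM x).2.2
  have hμc : Continuous fun z : RN N × RN N => μ z.1 z.2 := by
    simp only [hμq]
    refine continuous_const.mul (continuous_const.sub (continuous_const.div hq.1 fun z => ?_))
    have := hq.2.1.trans_le (inf2_le (zero_lt_one.trans hq.2.1) z.1 z.2)
    linarith
  obtain ⟨x₀, hx₀⟩ := hΩne
  have hα0 : 0 < infOn (closure Ω) α := zero_lt_one.trans hα2
  have hαle : infOn (closure Ω) α ≤ supOn (closure Ω) α :=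
    (infOn_le hα0 (subset_closure hx₀)).trans (le_supOn hα3 (subset_closure hx₀))
  let D : Problem N :=
    { Ω := Ω, isOpen := hΩo, bdd := hΩb, nonempty := ⟨x₀, hx₀⟩, s := s, p := p, μ := μ
      s₀ := _, s₁ := _, p₀ := _, p₁ := _, H := H
      μ₁ := _, contμ := hμc, symmμ := hμ.1
      μ_pos := fun x y => hμ.2.2.1.trans_le (inf2_le hμ.2.2.1 x y), μ_le := hμle
      f := f, car := hf, M := M, M_pos := hf1.1, r := r, contr := hr1
      r₀ := infOn univ r, r₁ := supOn univ r, r₀_gt := hrp, r_ge := hr0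
      r_le := fun x => le_supOn hr3 (mem_univ x)
      growth := hf1.2, Θ := Θ, Θ_gt := hΘ, ar := hf2
      t := t, e := e, t_gt := ht1, t_le := ht2, e_gt := he1, kernel_sub := hker
      growth_sub := hgr
      α := (closure Ω).piecewise α fun _ => infOn (closure Ω) α
      measα := hα1.measurable_piecewise continuousOn_const isClosed_closure.measurableSet
      a₁ := infOn (closure Ω) α, a₂ := supOn (closure Ω) α, a₁_gt := hα2
      α_ge := fun x => by
        by_cases hx : x ∈ closure Ω
        · rw [piecewise_eq_of_mem _ _ _ hx]; exact infOn_le hα0 hx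
        · rw [piecewise_eq_of_notMem _ _ _ hx]
      α_le := fun x => by
        by_cases hx : x ∈ closure Ω
        · rw [piecewise_eq_of_mem _ _ _ hx]; exact le_supOn hα3 hx
        · rw [piecewise_eq_of_notMem _ _ _ hx]; exact hαle
      a₂_lt := hαp }
  have hint : ∀ u w : RN N → ℝ, ∫ x in Ω, |u x| ^ (D.α x - 2) * u x * w x =
      ∫ x in Ω, |u x| ^ (α x - 2) * u x * w x := fun u w =>
    setIntegral_congr_fun hΩo.measurableSet fun x hx => by
      have : D.α x = α x :=
        piecewise_eq_of_mem (closure Ω) α (fun _ => infOn (closure Ω) α) (subset_closure hx)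
      simp only [this]
  obtain ⟨Λ, hΛ, h⟩ := D.exists_two_critical
  refine ⟨Λ, hΛ, fun lam hlam hlt => ?_⟩
  obtain ⟨u₁, u₂, hu₁, hu₂, h₁, h₂, h₁₂, hc₁, hc₂⟩ := h lam hlam hlt
  refine ⟨u₁, u₂, hu₁.memX0 H hΩo hΩb, hu₂.memX0 H hΩo hΩb, h₁, h₂, h₁₂, fun w hw => ?_,
    fun w hw => ?_⟩
  · rw [← hint]
    exact Problem.weak_solution_of_critical hu₁ hc₁ hw
  · rw [← hint]
    exact Problem.weak_solution_of_critical hu₂ hc₂ hw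

end VarOrderChoquard
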